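/- arXiv:1909.11563 — 13 statements merged into one kernel-verified Lean document; each statement's English description precedes it below -/
import Mathlib

section
/- Let A : D(A) ⊆ H₀ → H₁ be a densely defined closed linear operator between Hilbert spaces. Then there exists a constant c ∈ (0,∞) such that ‖x‖_{H₀} ≤ c‖Ax‖_{H₁} for all x ∈ D(𝒜) = D(A) ∩ closure(R(A*)) if and only if the range R(A) is a closed subspace of H₁. -/
open Filter Topology
open scoped ENNReal

/-- The range of a partially defined linear map, as a set. -/
def pRange {R E F : Type*} [Ring R] [AddCommGroup E] [Module R E]
    [AddCommGroup F] [Module R F] (T : E →ₗ.[R] F) : Set F :=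
  Set.range fun x : T.domain => T x

variable {𝕜 E F : Type*} [RCLike 𝕜]
  [NormedAddCommGroup E] [InnerProductSpace 𝕜 E] [CompleteSpace E]
  [NormedAddCommGroup F] [InnerProductSpace 𝕜 F] [CompleteSpace F]

namespace LinearPMap

/-- The kernel of a partially defined linear map, as a submodule of the ambient space. -/
def ambientKer (T : E →ₗ.[𝕜] F) : Submodule 𝕜 E :=
  T.graph.comap (LinearMap.inl 𝕜 E F)

omit [CompleteSpace E] [CompleteSpace F] in
theorem mem_ambientKer_iff {T : E →ₗ.[𝕜] F} {x : E} : x ∈ T.ambientKer ↔ (x, 0) ∈ T.graph :=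
  Iff.rfl

omit [CompleteSpace E] [CompleteSpace F] in
theorem isClosed_ambientKer {T : E →ₗ.[𝕜] F} (hc : T.IsClosed) :
    _root_.IsClosed (T.ambientKer : Set E) :=
  hc.preimage (by fun_prop : Continuous fun x : E => (x, (0 : F)))

theorem orthogonal_range_adjoint {T : E →ₗ.[𝕜] F} (hd : Dense (T.domain : Set E))
    (hc : T.IsClosed) : (LinearMap.range T.adjoint.toFun)ᗮ = T.ambientKer := by
  ext x
  constructor
  · intro hx
    let K : Submodule 𝕜 (WithLp 2 (E × F)) :=
      T.graph.comap (WithLp.linearEquiv 2 𝕜 (E × F)).toLinearMap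
    have hK : _root_.IsClosed (K : Set (WithLp 2 (E × F))) :=
      hc.preimage (WithLp.prod_continuous_ofLp 2 E F)
    have : CompleteSpace K := hK.completeSpace_coe
    have hxK : WithLp.toLp 2 (x, (0 : F)) ∈ Kᗮᗮ := by
      rw [Submodule.mem_orthogonal]
      intro u hu
      have h : ∀ z : T.domain, inner 𝕜 (-u.fst) (z : E) = inner 𝕜 u.snd (T z) := by
        intro z
        have hz := (Submodule.mem_orthogonal' K u).1 hu (WithLp.toLp 2 ((z : E), T z))
          (T.mem_graph z)
        rw [WithLp.prod_inner_apply] at hz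
        rw [inner_neg_left]
        exact neg_eq_of_add_eq_zero_right hz
      have hmem : u.snd ∈ T.adjoint.domain := mem_adjoint_domain_of_exists _ ⟨_, h⟩
      have happ : T.adjoint ⟨u.snd, hmem⟩ = -u.fst := adjoint_apply_eq hd _ h
      have h0 := (Submodule.mem_orthogonal _ x).1 hx _ ⟨⟨u.snd, hmem⟩, happ⟩
      rw [inner_neg_left, neg_eq_zero] at h0
      rw [WithLp.prod_inner_apply]
      simpa using h0
    rw [Submodule.orthogonal_orthogonal] at hxK
    exact hxK
  · intro hx
    obtain ⟨z, hz, hTz⟩ := (mem_graph_iff T).1 hx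
    change (z : E) = x at hz
    change T z = 0 at hTz
    rw [Submodule.mem_orthogonal]
    rintro _ ⟨y, rfl⟩
    have h := adjoint_isFormalAdjoint hd y z
    rw [hTz, inner_zero_right, hz] at h
    exact h

theorem mem_closure_pRange_adjoint_iff {T : E →ₗ.[𝕜] F} (hd : Dense (T.domain : Set E))
    (hc : T.IsClosed) {x : E} : x ∈ _root_.closure (pRange T.adjoint) ↔ x ∈ T.ambientKerᗮ := by
  rw [← orthogonal_range_adjoint hd hc, Submodule.orthogonal_orthogonal_eq_closure]
  rfl

/-- The graph of the restriction of `T` to the orthogonal complement of its kernel. -/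
def reducedGraph (T : E →ₗ.[𝕜] F) : Submodule 𝕜 (E × F) :=
  T.graph ⊓ T.ambientKerᗮ.comap (LinearMap.fst 𝕜 E F)

omit [CompleteSpace E] [CompleteSpace F] in
theorem isClosed_reducedGraph {T : E →ₗ.[𝕜] F} (hc : T.IsClosed) :
    _root_.IsClosed (T.reducedGraph : Set (E × F)) :=
  hc.inter (T.ambientKer.isClosed_orthogonal.preimage continuous_fst)

/-- The second projection from the reduced graph. -/
def reducedGraphSnd (T : E →ₗ.[𝕜] F) : T.reducedGraph →L[𝕜] F :=
  (ContinuousLinearMap.snd 𝕜 E F).comp T.reducedGraph.subtypeL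

omit [CompleteSpace E] [CompleteSpace F] in
theorem reducedGraphSnd_injective (T : E →ₗ.[𝕜] F) :
    Function.Injective T.reducedGraphSnd := by
  rw [injective_iff_map_eq_zero]
  rintro ⟨⟨x, y⟩, hG, hN⟩ (rfl : y = 0)
  have hx : x = 0 := inner_self_eq_zero.1 (hN x hG)
  subst hx
  rfl

omit [CompleteSpace F] in
theorem range_reducedGraphSnd {T : E →ₗ.[𝕜] F} (hc : T.IsClosed) :
    Set.range T.reducedGraphSnd = pRange T := by
  ext y
  constructor
  · rintro ⟨⟨⟨x, y⟩, hG, hN⟩, rfl⟩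
    obtain ⟨z, -, hz⟩ := (mem_graph_iff T).1 hG
    exact ⟨z, hz⟩
  · rintro ⟨z, rfl⟩
    have : CompleteSpace T.ambientKer := (isClosed_ambientKer hc).completeSpace_coe
    obtain ⟨n, hn, m, hm, hnm⟩ := T.ambientKer.exists_add_mem_mem_orthogonal (z : E)
    have hG : (m, T z) ∈ T.graph := by
      have h := T.graph.sub_mem (T.mem_graph z) (mem_ambientKer_iff.1 hn)
      rwa [Prod.mk_sub_mk, sub_zero, hnm, add_sub_cancel_left] at h
    exact ⟨⟨(m, T z), hG, hm⟩, rfl⟩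

end LinearPMap

/-- For a densely defined closed operator `T`, the Poincaré–Friedrichs
estimate on the reduced domain `D(T) ∩ closure (R(T*))` holds for some constant `c ∈ (0,∞)`
if and only if the range of `T` is closed. -/
theorem poincare_friedrichs_iff_closed_range
    (T : E →ₗ.[𝕜] F) (hd : Dense (T.domain : Set E)) (hc : T.IsClosed) :
    (∃ c : ℝ, 0 < c ∧ ∀ x : T.domain, (x : E) ∈ closure (pRange T.adjoint) →
      ‖(x : E)‖ ≤ c * ‖T x‖) ↔ IsClosed (pRange T) := by
  have : CompleteSpace T.reducedGraph := (LinearPMap.isClosed_reducedGraph hc).completeSpace_coe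
  rw [← LinearPMap.range_reducedGraphSnd hc,
    T.reducedGraphSnd.isClosed_range_iff_antilipschitz_of_injective T.reducedGraphSnd_injective]
  constructor
  · rintro ⟨c, -, h⟩
    refine ⟨(max c 1).toNNReal, T.reducedGraphSnd.antilipschitz_of_bound ?_⟩
    rintro ⟨⟨x, y⟩, hG, hN⟩
    obtain ⟨z, rfl, rfl⟩ := (LinearPMap.mem_graph_iff T).1 hG
    have hz := h z ((LinearPMap.mem_closure_pRange_adjoint_iff hd hc).2 hN)
    rw [Real.coe_toNNReal _ (by positivity)]
    change max ‖(z : E)‖ ‖T z‖ ≤ max c 1 * ‖T z‖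
    refine max_le (hz.trans ?_) ?_
    · gcongr
      exact le_max_left _ _
    · exact le_mul_of_one_le_left (norm_nonneg _) (le_max_right _ _)
  · rintro ⟨K, hK⟩
    refine ⟨K + 1, by positivity, fun z hz => ?_⟩
    have h := hK.le_mul_norm (map_zero _) ⟨((z : E), T z), T.mem_graph z,
      (LinearPMap.mem_closure_pRange_adjoint_iff hd hc).1 hz⟩
    change max ‖(z : E)‖ ‖T z‖ ≤ K * ‖T z‖ at h
    refine (le_max_left _ _).trans (h.trans ?_)
    gcongr
    simp
end

section
/- Let A : D(A) ⊆ H₀ → H₁ be a densely defined closed linear operator between Hilbert spaces. Then there exists c ∈ (0,∞) with ‖x‖_{H₀} ≤ c‖Ax‖_{H₁} for all x ∈ D(𝒜) = D(A) ∩ closure(R(A*)) if and only if there exists c* ∈ (0,∞) with ‖y‖_{H₁} ≤ c*‖A*y‖_{H₀} for all y ∈ D(𝒜*) = D(A*) ∩ closure(R(A)). -/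
open Filter Topology
open scoped ENNReal

variable {𝕜 E F : Type*} [RCLike 𝕜]
  [NormedAddCommGroup E] [InnerProductSpace 𝕜 E] [CompleteSpace E]
  [NormedAddCommGroup F] [InnerProductSpace 𝕜 F] [CompleteSpace F]

/-- For a densely defined closed operator `T`, the orthogonal complement of the range of `T†` is
contained in the kernel of `T`. -/
theorem LinearPMap.mem_graph_zero_of_inner_adjoint_eq_zero {T : E →ₗ.[𝕜] F}
    (hd : Dense (T.domain : Set E)) (hc : T.IsClosed) {x : E}
    (hx : ∀ y : T.adjoint.domain, inner 𝕜 (T.adjoint y) x = 0) : (x, (0 : F)) ∈ T.graph := by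
  let G : Submodule 𝕜 (WithLp 2 (E × F)) :=
    T.graph.comap (WithLp.linearEquiv 2 𝕜 (E × F)).toLinearMap
  have hG : _root_.IsClosed (G : Set (WithLp 2 (E × F))) :=
    hc.preimage (WithLp.prod_continuous_ofLp 2 E F)
  have : CompleteSpace G := hG.completeSpace_coe
  suffices h : WithLp.toLp 2 (x, (0 : F)) ∈ G from h
  rw [← G.orthogonal_orthogonal, Submodule.mem_orthogonal]
  intro w hw
  have hw' (a : T.domain) : inner 𝕜 (-w.fst) (a : E) = inner 𝕜 w.snd (T a) := by
    have h := (Submodule.mem_orthogonal' _ _).1 hw (WithLp.toLp 2 ((a : E), T a))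
      (T.mem_graph a)
    rw [WithLp.prod_inner_apply] at h
    rw [inner_neg_left]
    exact neg_eq_of_add_eq_zero_right h
  have hdom : w.snd ∈ T.adjoint.domain := mem_adjoint_domain_of_exists _ ⟨-w.fst, hw'⟩
  have h := hx ⟨w.snd, hdom⟩
  rw [adjoint_apply_eq hd ⟨w.snd, hdom⟩ hw', inner_neg_left, neg_eq_zero] at h
  simpa [WithLp.prod_inner_apply] using h

/-- For a densely defined operator `T`, the orthogonal complement of the range of `T` is
contained in the kernel of `T†`. -/
theorem LinearPMap.mem_adjoint_graph_zero_of_inner_eq_zero {T : E →ₗ.[𝕜] F}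
    (hd : Dense (T.domain : Set E)) {y : F}
    (hy : ∀ x : T.domain, inner 𝕜 (T x) y = 0) : (y, (0 : E)) ∈ T.adjoint.graph := by
  have h (x : T.domain) : inner 𝕜 (0 : E) (x : E) = inner 𝕜 y (T x) := by
    rw [inner_zero_left, inner_eq_zero_symm.1 (hy x)]
  exact T.adjoint.mem_graph_iff.2
    ⟨⟨y, mem_adjoint_domain_of_exists _ ⟨0, h⟩⟩, rfl, adjoint_apply_eq hd _ h⟩

/-- If `T` and `S` are formally adjoint and `R(S)ᗮ ⊆ N(T)`, then a Poincaré–Friedrichs estimate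
for `T` on the closure of `R(S)` gives one for `S` on the closure of `R(T)`, with the same
constant. -/
theorem LinearPMap.IsFormalAdjoint.norm_le_mul_norm {T : E →ₗ.[𝕜] F} {S : F →ₗ.[𝕜] E}
    (hTS : T.IsFormalAdjoint S)
    (hker : ∀ x : E, (∀ y : S.domain, inner 𝕜 (S y) x = 0) → (x, (0 : F)) ∈ T.graph)
    {c : ℝ} (hc : 0 ≤ c)
    (hT : ∀ x : T.domain, (x : E) ∈ _root_.closure (pRange S) → ‖(x : E)‖ ≤ c * ‖T x‖)
    (y : S.domain) (hy : (y : F) ∈ _root_.closure (pRange T)) : ‖(y : F)‖ ≤ c * ‖S y‖ := by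
  have hrange (x : T.domain) : ‖inner 𝕜 (T x) (y : F)‖ ≤ c * ‖S y‖ * ‖T x‖ := by
    let K : Submodule 𝕜 E := (LinearMap.range S.toFun).topologicalClosure
    have : CompleteSpace K := (Submodule.isClosed_topologicalClosure _).completeSpace_coe
    obtain ⟨u, hu, v, hv, huv⟩ := K.exists_add_mem_mem_orthogonal (x : E)
    obtain ⟨v', rfl, hv'⟩ := T.mem_graph_iff.1 <| hker v fun z =>
      (Submodule.mem_orthogonal _ _).1 hv (S z)
        (Submodule.le_topologicalClosure _ (LinearMap.mem_range_self S.toFun z))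
    have hxu : ((x - v' : T.domain) : E) = u := by
      rw [Submodule.coe_sub, huv, add_sub_cancel_right]
    have hTu : T (x - v') = T x := by rw [T.map_sub, hv', sub_zero]
    have hle : ‖((x - v' : T.domain) : E)‖ ≤ c * ‖T x‖ :=
      hTu ▸ hT (x - v') (hxu ▸ hu)
    calc ‖inner 𝕜 (T x) (y : F)‖ = ‖inner 𝕜 ((x - v' : T.domain) : E) (S y)‖ := by
          rw [← hTS, hTu]
      _ ≤ ‖((x - v' : T.domain) : E)‖ * ‖S y‖ := norm_inner_le_norm _ _
      _ ≤ c * ‖T x‖ * ‖S y‖ := by gcongr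
      _ = c * ‖S y‖ * ‖T x‖ := by ring
  have hclosed : _root_.IsClosed {z : F | ‖inner 𝕜 z (y : F)‖ ≤ c * ‖S y‖ * ‖z‖} :=
    isClosed_le (by fun_prop) (by fun_prop)
  have hyy : ‖inner 𝕜 (y : F) (y : F)‖ ≤ c * ‖S y‖ * ‖(y : F)‖ :=
    closure_minimal (Set.range_subset_iff.2 hrange) hclosed hy
  rw [inner_self_eq_norm_sq_to_K, norm_pow, RCLike.norm_ofReal, abs_norm, pow_two] at hyy
  rcases (norm_nonneg (y : F)).eq_or_lt with h0 | hpos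
  · rw [← h0]
    positivity
  · exact le_of_mul_le_mul_right hyy hpos

/-- For a densely defined closed operator `T`, the Poincaré–Friedrichs
estimate for `T` on `D(T) ∩ closure (R(T*))` holds for some constant iff the corresponding
estimate for the adjoint `T*` on `D(T*) ∩ closure (R(T))` holds for some constant. -/
theorem poincare_friedrichs_iff_poincare_friedrichs_adjoint
    (T : E →ₗ.[𝕜] F) (hd : Dense (T.domain : Set E)) (hc : T.IsClosed) :
    (∃ c : ℝ, 0 < c ∧ ∀ x : T.domain, (x : E) ∈ closure (pRange T.adjoint) →
      ‖(x : E)‖ ≤ c * ‖T x‖) ↔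
    (∃ c : ℝ, 0 < c ∧ ∀ y : T.adjoint.domain, (y : F) ∈ closure (pRange T) →
      ‖(y : F)‖ ≤ c * ‖T.adjoint y‖) := by
  constructor
  · rintro ⟨c, hc0, h⟩
    exact ⟨c, hc0, (LinearPMap.adjoint_isFormalAdjoint hd).symm.norm_le_mul_norm
      (fun _ => LinearPMap.mem_graph_zero_of_inner_adjoint_eq_zero hd hc) hc0.le h⟩
  · rintro ⟨c, hc0, h⟩
    exact ⟨c, hc0, (LinearPMap.adjoint_isFormalAdjoint hd).norm_le_mul_norm
      (fun _ => LinearPMap.mem_adjoint_graph_zero_of_inner_eq_zero hd) hc0.le h⟩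
end

section
/- Let A : D(A) ⊆ H₀ → H₁ be a densely defined closed linear operator between Hilbert spaces. Then the embedding D(𝒜) ↪ H₀ is compact if and only if the embedding D(𝒜*) ↪ H₁ is compact. -/
open Filter Topology
open scoped ENNReal

/-- Compactness of the embedding of `{x ∈ D(T) : x ∈ V}` (with the graph norm of `T`)
into the ambient space `E`: every graph-norm bounded sequence has a subsequence
converging in `E`. -/
def CompactEmbed {𝕜 E F : Type*} [RCLike 𝕜]
    [NormedAddCommGroup E] [InnerProductSpace 𝕜 E]
    [NormedAddCommGroup F] [InnerProductSpace 𝕜 F]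
    (T : E →ₗ.[𝕜] F) (V : Set E) : Prop :=
  ∀ x : ℕ → T.domain, (∀ n, (x n : E) ∈ V) →
    (∃ C : ℝ, ∀ n, ‖(x n : E)‖ + ‖T (x n)‖ ≤ C) →
    ∃ φ : ℕ → ℕ, StrictMono φ ∧ ∃ l : E,
      Tendsto (fun k => (x (φ k) : E)) atTop (𝓝 l)

variable {𝕜 E F : Type*} [RCLike 𝕜]
  [NormedAddCommGroup E] [InnerProductSpace 𝕜 E] [CompleteSpace E]
  [NormedAddCommGroup F] [InnerProductSpace 𝕜 F] [CompleteSpace F]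

omit [CompleteSpace E] [CompleteSpace F] in
theorem coe_topologicalClosure_range_toFun (S : F →ₗ.[𝕜] E) :
    ((LinearMap.range S.toFun).topologicalClosure : Set E) = closure (pRange S) := by
  rw [Submodule.topologicalClosure_coe]
  rfl

/-- A vector lies in the kernel of a closed densely defined operator as soon as it is orthogonal
to the range of the adjoint. -/
theorem mem_graph_zero_of_forall_inner_adjoint_eq_zero {T : E →ₗ.[𝕜] F}
    (hd : Dense (T.domain : Set E)) (hc : T.IsClosed) {z : E}
    (hz : ∀ y : T.adjoint.domain, inner 𝕜 (T.adjoint y) z = 0) : (z, (0 : F)) ∈ T.graph := by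
  let G : Submodule 𝕜 (WithLp 2 (E × F)) :=
    T.graph.comap (WithLp.linearEquiv 2 𝕜 (E × F)).toLinearMap
  have hG : IsClosed (G : Set (WithLp 2 (E × F))) :=
    IsClosed.preimage (WithLp.prod_continuous_ofLp 2 E F) hc
  have : CompleteSpace G := hG.completeSpace_coe
  suffices WithLp.toLp 2 (z, (0 : F)) ∈ G from this
  rw [← Submodule.orthogonal_orthogonal G, Submodule.mem_orthogonal]
  intro w hw
  rw [Submodule.mem_orthogonal'] at hw
  have hinner (x : T.domain) : inner 𝕜 (-w.fst) (x : E) = inner 𝕜 w.snd (T x) := by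
    have h := hw (WithLp.toLp 2 ((x : E), T x)) (T.mem_graph x)
    rw [WithLp.prod_inner_apply] at h
    rw [inner_neg_left]
    exact neg_eq_of_add_eq_zero_right h
  have hmem : w.snd ∈ T.adjoint.domain :=
    LinearPMap.mem_adjoint_domain_of_exists _ ⟨-w.fst, hinner⟩
  have hz' := hz ⟨w.snd, hmem⟩
  rw [LinearPMap.adjoint_apply_eq hd _ hinner, inner_neg_left, neg_eq_zero] at hz'
  rw [WithLp.prod_inner_apply]
  simpa using hz'

omit [CompleteSpace F] in
/-- A vector orthogonal to the range of a densely defined operator lies in the kernel of the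
adjoint. -/
theorem mem_graph_adjoint_zero_of_forall_inner_eq_zero {T : E →ₗ.[𝕜] F}
    (hd : Dense (T.domain : Set E)) {z : F}
    (hz : ∀ x : T.domain, inner 𝕜 (T x) z = 0) : (z, (0 : E)) ∈ T.adjoint.graph := by
  have h (x : T.domain) : inner 𝕜 (0 : E) (x : E) = inner 𝕜 z (T x) := by
    rw [inner_zero_left, inner_eq_zero_symm.mp (hz x)]
  rw [LinearPMap.mem_graph_iff]
  exact ⟨⟨z, LinearPMap.mem_adjoint_domain_of_exists _ ⟨0, h⟩⟩, rfl,
    LinearPMap.adjoint_apply_eq hd _ h⟩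

omit [CompleteSpace E] [CompleteSpace F] in
/-- A kernel vector of `T` in the closure of the range of a formal adjoint vanishes. -/
theorem eq_zero_of_mem_closure_pRange {T : E →ₗ.[𝕜] F} {S : F →ₗ.[𝕜] E}
    (hTS : T.IsFormalAdjoint S) {x : T.domain} (hx : (x : E) ∈ closure (pRange S))
    (hTx : T x = 0) : (x : E) = 0 := by
  have hclosed : IsClosed {w : E | inner 𝕜 (x : E) w = 0} :=
    isClosed_eq (by fun_prop) continuous_const
  have hsub : pRange S ⊆ {w : E | inner 𝕜 (x : E) w = 0} := by
    rintro _ ⟨y, rfl⟩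
    change inner 𝕜 (x : E) (S y) = 0
    rw [← hTS x y, hTx, inner_zero_left]
  exact inner_self_eq_zero.mp (closure_minimal hsub hclosed hx)

omit [CompleteSpace E] [CompleteSpace F] in
/-- The Friedrichs/Poincaré type estimate implied by compactness of the embedding. -/
theorem CompactEmbed.exists_norm_le {T : E →ₗ.[𝕜] F} {S : F →ₗ.[𝕜] E}
    (hT : CompactEmbed T (closure (pRange S))) (hc : T.IsClosed) (hTS : T.IsFormalAdjoint S) :
    ∃ c : ℝ, ∀ x : T.domain, (x : E) ∈ closure (pRange S) → ‖(x : E)‖ ≤ c * ‖T x‖ := by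
  by_contra! h
  choose x hxS hx using fun n : ℕ => h (n + 1)
  have hpos (n : ℕ) : 0 < ‖(x n : E)‖ := lt_of_le_of_lt (by positivity) (hx n)
  let u (n : ℕ) : T.domain := ((‖(x n : E)‖⁻¹ : ℝ) : 𝕜) • x n
  have hu (n : ℕ) : ‖(u n : E)‖ = 1 := by
    simp [u, norm_smul, (hpos n).ne']
  have hTu (n : ℕ) : ‖T (u n)‖ ≤ 1 / ((n : ℝ) + 1) := by
    have h1 : ‖T (u n)‖ = ‖(x n : E)‖⁻¹ * ‖T (x n)‖ := by
      simp [u, norm_smul, T.map_smul]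
    rw [h1, inv_mul_eq_div, div_le_div_iff₀ (hpos n) (by positivity)]
    linarith [hx n]
  have huS (n : ℕ) : (u n : E) ∈ closure (pRange S) := by
    rw [← coe_topologicalClosure_range_toFun]
    refine Submodule.smul_mem _ _ ?_
    rw [← SetLike.mem_coe, coe_topologicalClosure_range_toFun]
    exact hxS n
  have hTu0 : Tendsto (fun n => T (u n)) atTop (𝓝 0) :=
    squeeze_zero_norm hTu tendsto_one_div_add_atTop_nhds_zero_nat
  obtain ⟨φ, hφ, l, hl⟩ := hT u huS ⟨2, fun n => by
    have : 1 / ((n : ℝ) + 1) ≤ 1 := by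
      rw [div_le_one (by positivity)]
      linarith [n.cast_nonneg (α := ℝ)]
    linarith [hu n, hTu n]⟩
  have hgraph : (l, (0 : F)) ∈ T.graph :=
    hc.mem_of_tendsto (hl.prodMk_nhds (hTu0.comp hφ.tendsto_atTop))
      (Eventually.of_forall fun k => T.mem_graph (u (φ k)))
  obtain ⟨y, rfl, hy⟩ := (LinearPMap.mem_graph_iff T).mp hgraph
  have hyS : (y : E) ∈ closure (pRange S) :=
    isClosed_closure.mem_of_tendsto hl (Eventually.of_forall fun k => huS (φ k))
  have hnorm : ‖(y : E)‖ = 1 := by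
    refine tendsto_nhds_unique hl.norm ?_
    simp [hu]
  simp [eq_zero_of_mem_closure_pRange hTS hyS hy] at hnorm

omit [CompleteSpace F] in
/-- If `T` vanishes on the orthogonal complement of the range of `S`, then every value of `T` is
attained on the closure of the range of `S`. -/
theorem exists_mem_closure_pRange_apply_eq {T : E →ₗ.[𝕜] F} {S : F →ₗ.[𝕜] E}
    (hker : ∀ z : E, (∀ y : S.domain, inner 𝕜 (S y) z = 0) → (z, (0 : F)) ∈ T.graph)
    (x : T.domain) : ∃ x' : T.domain, (x' : E) ∈ closure (pRange S) ∧ T x' = T x := by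
  let K := (LinearMap.range S.toFun).topologicalClosure
  have : CompleteSpace K := (Submodule.isClosed_topologicalClosure _).completeSpace_coe
  have hz := Submodule.sub_starProjection_mem_orthogonal (K := K) (x : E)
  obtain ⟨z, hzx, hTz⟩ := (LinearPMap.mem_graph_iff T).mp <|
    hker ((x : E) - K.starProjection x) fun y =>
      (Submodule.mem_orthogonal _ _).mp hz _ (Submodule.le_topologicalClosure _ ⟨y, rfl⟩)
  refine ⟨x - z, ?_, by rw [T.map_sub, hTz, sub_zero]⟩
  have hcoe : ((x - z : T.domain) : E) = K.starProjection x := by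
    rw [Submodule.coe_sub, hzx, sub_sub_cancel]
  rw [hcoe, ← coe_topologicalClosure_range_toFun]
  exact Submodule.starProjection_apply_mem K _

/-- Compactness of the embedding passes from `T` to a formal adjoint `S` of `T`, provided `T` is
closed and vanishes on the orthogonal complement of the range of `S`. -/
theorem CompactEmbed.of_isFormalAdjoint {T : E →ₗ.[𝕜] F} {S : F →ₗ.[𝕜] E}
    (hT : CompactEmbed T (closure (pRange S))) (hc : T.IsClosed) (hTS : T.IsFormalAdjoint S)
    (hker : ∀ z : E, (∀ y : S.domain, inner 𝕜 (S y) z = 0) → (z, (0 : F)) ∈ T.graph) :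
    CompactEmbed S (closure (pRange T)) := by
  rintro y hyT ⟨C, hC⟩
  obtain ⟨c, hcx⟩ := hT.exists_norm_le hc hTS
  have happrox (n : ℕ) : ∃ x : T.domain, (x : E) ∈ closure (pRange S) ∧
      ‖(y n : F) - T x‖ < 1 / ((n : ℝ) + 1) := by
    obtain ⟨_, ⟨x, rfl⟩, hx⟩ :=
      Metric.mem_closure_iff.mp (hyT n) (1 / ((n : ℝ) + 1)) (by positivity)
    obtain ⟨x', hx'S, hx'⟩ := exists_mem_closure_pRange_apply_eq hker x
    exact ⟨x', hx'S, by rwa [hx', ← dist_eq_norm]⟩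
  choose x hxS hyx using happrox
  have hyC (n : ℕ) : ‖(y n : F)‖ ≤ C := by linarith [hC n, norm_nonneg (S (y n))]
  have hSC (n : ℕ) : ‖S (y n)‖ ≤ C := by linarith [hC n, norm_nonneg (y n : F)]
  have hTx (n : ℕ) : ‖T (x n)‖ ≤ C + 1 := by
    have h1 : 1 / ((n : ℝ) + 1) ≤ 1 := by
      rw [div_le_one (by positivity)]
      linarith [n.cast_nonneg (α := ℝ)]
    have h2 := norm_sub_norm_le (T (x n)) (y n : F)
    rw [norm_sub_rev] at h2
    linarith [hyC n, hyx n]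
  obtain ⟨φ, hφ, l, hl⟩ := hT x hxS ⟨|c| * (C + 1) + (C + 1), fun n => by
    have h1 : c * ‖T (x n)‖ ≤ |c| * (C + 1) :=
      mul_le_mul (le_abs_self c) (hTx n) (norm_nonneg _) (abs_nonneg c)
    linarith [hcx (x n) (hxS n), hTx n]⟩
  refine ⟨φ, hφ, cauchySeq_tendsto_of_complete ?_⟩
  let e (n : ℕ) : F := (y n : F) - T (x n)
  have he : Tendsto e atTop (𝓝 0) :=
    squeeze_zero_norm (fun n => (hyx n).le) tendsto_one_div_add_atTop_nhds_zero_nat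
  have hkey (n m : ℕ) : ‖(y n : F) - y m‖ ^ 2 ≤
      (2 * C) * (‖(x n : E) - x m‖ + ‖e n - e m‖) := by
    have hsplit : (y n : F) - y m = T (x n - x m) + (e n - e m) := by
      rw [T.map_sub]
      simp only [e]
      abel
    have hinner : inner 𝕜 ((y n : F) - y m) ((y n : F) - y m) =
        inner 𝕜 ((x n : E) - x m) (S (y n) - S (y m)) +
          inner 𝕜 (e n - e m) ((y n : F) - y m) := by
      have h := hTS (x n - x m) (y n - y m)
      rw [S.map_sub, Submodule.coe_sub, Submodule.coe_sub] at h
      rw [← h, ← inner_add_left, ← hsplit]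
    have hS : ‖S (y n) - S (y m)‖ ≤ 2 * C := by
      linarith [norm_sub_le (S (y n)) (S (y m)), hSC n, hSC m]
    have hY : ‖(y n : F) - y m‖ ≤ 2 * C := by
      linarith [norm_sub_le (y n : F) (y m : F), hyC n, hyC m]
    calc ‖(y n : F) - y m‖ ^ 2 = ‖inner 𝕜 ((y n : F) - y m) ((y n : F) - y m)‖ := by
          rw [inner_self_eq_norm_sq_to_K]
          simp
      _ ≤ ‖(x n : E) - x m‖ * ‖S (y n) - S (y m)‖ + ‖e n - e m‖ * ‖(y n : F) - y m‖ := by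
          rw [hinner]
          exact (norm_add_le _ _).trans
            (add_le_add (norm_inner_le_norm _ _) (norm_inner_le_norm _ _))
      _ ≤ ‖(x n : E) - x m‖ * (2 * C) + ‖e n - e m‖ * (2 * C) := by gcongr
      _ = (2 * C) * (‖(x n : E) - x m‖ + ‖e n - e m‖) := by ring
  have hx0 := cauchySeq_iff_tendsto_dist_atTop_0.mp hl.cauchySeq
  have he0 := cauchySeq_iff_tendsto_dist_atTop_0.mp (he.comp hφ.tendsto_atTop).cauchySeq
  rw [cauchySeq_iff_tendsto_dist_atTop_0]
  have hsqrt := ((hx0.add he0).const_mul (2 * C)).sqrt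
  simp only [add_zero, mul_zero, Real.sqrt_zero] at hsqrt
  refine squeeze_zero (fun _ => dist_nonneg) (fun p => ?_) hsqrt
  apply Real.le_sqrt_of_sq_le
  simpa only [dist_eq_norm, Function.comp_apply] using hkey (φ p.1) (φ p.2)

/-- For a densely defined closed operator `T`, the embedding
`D(𝒜) = D(T) ∩ closure (R(T*)) ↪ E` is compact iff the embedding
`D(𝒜*) = D(T*) ∩ closure (R(T)) ↪ F` is compact. -/
theorem compactEmbed_iff_compactEmbed_adjoint
    (T : E →ₗ.[𝕜] F) (hd : Dense (T.domain : Set E)) (hc : T.IsClosed) :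
    CompactEmbed T (closure (pRange T.adjoint)) ↔
      CompactEmbed T.adjoint (closure (pRange T)) := by
  exact ⟨fun h => h.of_isFormalAdjoint hc (LinearPMap.adjoint_isFormalAdjoint hd).symm
      fun _ hz => mem_graph_zero_of_forall_inner_adjoint_eq_zero hd hc hz,
    fun h => h.of_isFormalAdjoint (LinearPMap.adjoint_isClosed hd)
      (LinearPMap.adjoint_isFormalAdjoint hd)
      fun _ hz => mem_graph_adjoint_zero_of_forall_inner_eq_zero hd hz⟩
end

section
/- Let A : D(A) ⊆ H₀ → H₁ be a densely defined closed linear operator between Hilbert spaces. If the embedding D(𝒜) ↪ H₀ is compact, then the ranges R(A) and R(A*) are closed, and there exists a constant c ∈ (0,∞) such that ‖x‖_{H₀} ≤ c‖Ax‖_{H₁} for all x ∈ D(𝒜). -/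
open Filter Topology
open scoped ENNReal

variable {𝕜 E F : Type*} [RCLike 𝕜]
  [NormedAddCommGroup E] [InnerProductSpace 𝕜 E] [CompleteSpace E]
  [NormedAddCommGroup F] [InnerProductSpace 𝕜 F] [CompleteSpace F]

namespace LinearPMap

omit [CompleteSpace E] [CompleteSpace F] in
theorem IsClosed.exists_apply_eq_of_tendsto {T : E →ₗ.[𝕜] F} (hc : T.IsClosed)
    {x : ℕ → T.domain} {a : E} {b : F} (ha : Tendsto (fun n => (x n : E)) atTop (𝓝 a))
    (hb : Tendsto (fun n => T (x n)) atTop (𝓝 b)) : ∃ z : T.domain, (z : E) = a ∧ T z = b := by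
  have h : (a, b) ∈ (T.graph : Set (E × F)) :=
    _root_.IsClosed.mem_of_tendsto hc (ha.prodMk_nhds hb)
      (Eventually.of_forall fun n => T.mem_graph (x n))
  exact T.mem_graph_iff.mp h

omit [CompleteSpace E] [CompleteSpace F] in
/-- An operator whose kernel contains `Vᗮ` attains each of its values on `V`. -/
theorem exists_mem_apply_eq {T : E →ₗ.[𝕜] F} (V : Submodule 𝕜 E) [V.HasOrthogonalProjection]
    (hV : ∀ u ∈ Vᗮ, ∃ z : T.domain, (z : E) = u ∧ T z = 0) (x : T.domain) :
    ∃ p : T.domain, (p : E) ∈ V ∧ T p = T x := by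
  obtain ⟨z, hz, hz0⟩ := hV _ (V.sub_starProjection_mem_orthogonal (x : E))
  refine ⟨x - z, ?_, by rw [map_sub, hz0, sub_zero]⟩
  rw [Submodule.coe_sub, hz, sub_sub_cancel]
  exact V.starProjection_apply_mem _

omit [CompleteSpace F] in
/-- A closed operator which is bounded below on a subspace whose orthogonal complement lies
in the kernel has closed range. -/
theorem isClosed_pRange_of_bounded_below {T : E →ₗ.[𝕜] F} (hc : T.IsClosed) (V : Submodule 𝕜 E)
    [V.HasOrthogonalProjection] (hV : ∀ u ∈ Vᗮ, ∃ z : T.domain, (z : E) = u ∧ T z = 0)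
    {c : ℝ} (h : ∀ x : T.domain, (x : E) ∈ V → ‖(x : E)‖ ≤ c * ‖T x‖) :
    _root_.IsClosed (pRange T) := by
  refine isClosed_of_closure_subset fun y hy => ?_
  obtain ⟨v, hv, hvy⟩ := mem_closure_iff_seq_limit.mp hy
  have hex : ∀ n, ∃ p : T.domain, (p : E) ∈ V ∧ T p = v n := fun n => by
    obtain ⟨x, hx⟩ := hv n
    obtain ⟨p, hpV, hp⟩ := exists_mem_apply_eq V hV x
    exact ⟨p, hpV, hp.trans hx⟩
  choose p hpV hp using hex
  have hcau : CauchySeq fun n => (p n : E) := by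
    have hv0 := cauchySeq_iff_tendsto_dist_atTop_0.mp hvy.cauchySeq
    refine cauchySeq_iff_tendsto_dist_atTop_0.mpr
      (squeeze_zero (fun _ => dist_nonneg) (fun n => ?_) (by simpa using hv0.const_mul c))
    have := h (p n.1 - p n.2) (V.sub_mem (hpV _) (hpV _))
    rwa [map_sub, hp, hp, Submodule.coe_sub, ← dist_eq_norm, ← dist_eq_norm] at this
  obtain ⟨a, ha⟩ := cauchySeq_tendsto_of_complete hcau
  obtain ⟨z, -, hz⟩ := hc.exists_apply_eq_of_tendsto ha (b := y) (by simpa only [hp] using hvy)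
  exact ⟨z, hz⟩

/-- For a closed densely defined operator, `R(T*)ᗮ` is contained in the kernel of `T`. -/
theorem exists_apply_eq_zero_of_mem_orthogonal_range_adjoint {T : E →ₗ.[𝕜] F}
    (hd : Dense (T.domain : Set E)) (hc : T.IsClosed) {x : E}
    (hx : x ∈ (LinearMap.range T.adjoint.toFun)ᗮ) : ∃ z : T.domain, (z : E) = x ∧ T z = 0 := by
  let G : Submodule 𝕜 (WithLp 2 (E × F)) :=
    T.graph.comap (WithLp.linearEquiv 2 𝕜 (E × F)).toLinearMap
  have hG : _root_.IsClosed (G : Set (WithLp 2 (E × F))) :=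
    _root_.IsClosed.preimage (WithLp.prod_continuous_ofLp _ _ _) hc
  have hmem : WithLp.toLp 2 (x, (0 : F)) ∈ G := by
    have : CompleteSpace G := hG.completeSpace_coe
    rw [← G.orthogonal_orthogonal, Submodule.mem_orthogonal]
    intro w hw
    have key : ∀ u : T.domain, inner 𝕜 (-w.fst) (u : E) = inner 𝕜 w.snd (T u) := fun u => by
      have := (Submodule.mem_orthogonal' G w).mp hw (WithLp.toLp 2 ((u : E), T u)) (T.mem_graph u)
      rw [WithLp.prod_inner_apply] at this
      rw [inner_neg_left]
      exact neg_eq_of_add_eq_zero_right this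
    have hdom : w.snd ∈ T.adjoint.domain := mem_adjoint_domain_of_exists _ ⟨_, key⟩
    have hadj : T.adjoint ⟨w.snd, hdom⟩ = -w.fst := adjoint_apply_eq hd _ key
    have h0 := (Submodule.mem_orthogonal _ x).mp hx _ ⟨⟨w.snd, hdom⟩, hadj⟩
    rw [inner_neg_left, neg_eq_zero] at h0
    rw [WithLp.prod_inner_apply]
    simpa using h0
  exact T.mem_graph_iff.mp hmem

omit [CompleteSpace F] in
/-- `R(T)ᗮ` is contained in the kernel of the adjoint. -/
theorem exists_adjoint_apply_eq_zero_of_mem_orthogonal_range {T : E →ₗ.[𝕜] F}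
    (hd : Dense (T.domain : Set E)) {y : F} (hy : y ∈ (LinearMap.range T.toFun)ᗮ) :
    ∃ z : T.adjoint.domain, (z : F) = y ∧ T.adjoint z = 0 := by
  have key : ∀ u : T.domain, inner 𝕜 (0 : E) (u : E) = inner 𝕜 y (T u) := fun u => by
    rw [inner_zero_left]
    exact ((Submodule.mem_orthogonal' _ y).mp hy _ ⟨u, rfl⟩).symm
  exact ⟨⟨y, mem_adjoint_domain_of_exists _ ⟨_, key⟩⟩, rfl, adjoint_apply_eq hd _ key⟩

omit [CompleteSpace F] in
/-- The kernel of `T` meets the closure of `R(T*)` only in zero. -/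
theorem eq_zero_of_apply_eq_zero_of_mem_closure {T : E →ₗ.[𝕜] F}
    (hd : Dense (T.domain : Set E)) {x : T.domain} (hx : T x = 0)
    (hmem : (x : E) ∈ _root_.closure (pRange T.adjoint)) : (x : E) = 0 := by
  have hperp : (x : E) ∈ (LinearMap.range T.adjoint.toFun)ᗮ := by
    rw [Submodule.mem_orthogonal]
    rintro _ ⟨y, rfl⟩
    have := adjoint_isFormalAdjoint hd y x
    rwa [hx, inner_zero_right] at this
  have hV : (x : E) ∈ (LinearMap.range T.adjoint.toFun).topologicalClosure := hmem
  rw [← Submodule.orthogonal_closure] at hperp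
  exact inner_self_eq_zero.mp ((Submodule.mem_orthogonal _ _).mp hperp _ hV)

omit [CompleteSpace F] in
/-- The Poincaré–Friedrichs estimate on `D(T) ∩ closure (R(T*))`. -/
theorem exists_norm_le_of_compactEmbed {T : E →ₗ.[𝕜] F} (hd : Dense (T.domain : Set E))
    (hc : T.IsClosed) (hcpt : CompactEmbed T (_root_.closure (pRange T.adjoint))) :
    ∃ c : ℝ, 0 < c ∧ ∀ x : T.domain, (x : E) ∈ _root_.closure (pRange T.adjoint) →
      ‖(x : E)‖ ≤ c * ‖T x‖ := by
  by_contra! hcon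
  have hex : ∀ n : ℕ, ∃ x : T.domain, (x : E) ∈ _root_.closure (pRange T.adjoint) ∧
      ‖(x : E)‖ = 1 ∧ ‖T x‖ ≤ 1 / ((n : ℝ) + 1) := fun n => by
    have hn : (0 : ℝ) < n + 1 := by positivity
    obtain ⟨x, hxV, hx⟩ := hcon (n + 1) hn
    have hpos : 0 < ‖(x : E)‖ := lt_of_le_of_lt (by positivity) hx
    have hnorm : ‖((‖(x : E)‖⁻¹ : ℝ) : 𝕜)‖ = ‖(x : E)‖⁻¹ := by simp
    refine ⟨((‖(x : E)‖⁻¹ : ℝ) : 𝕜) • x,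
      (LinearMap.range T.adjoint.toFun).topologicalClosure.smul_mem _ hxV, ?_, ?_⟩
    · rw [Submodule.coe_smul, norm_smul, hnorm, inv_mul_cancel₀ hpos.ne']
    · rw [map_smul, norm_smul, hnorm, inv_mul_le_iff₀ hpos, mul_one_div, le_div_iff₀ hn, mul_comm]
      exact hx.le
  choose x hxV hx1 hxT using hex
  have hT0 : Tendsto (fun n => T (x n)) atTop (𝓝 0) :=
    squeeze_zero_norm hxT tendsto_one_div_add_atTop_nhds_zero_nat
  obtain ⟨φ, hφ, l, hl⟩ := hcpt x hxV ⟨1 + 1, fun n => by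
    refine add_le_add (hx1 n).le ((hxT n).trans ?_)
    rw [div_le_one (by positivity)]
    exact le_add_of_nonneg_left n.cast_nonneg⟩
  obtain ⟨z, rfl, hz⟩ := hc.exists_apply_eq_of_tendsto hl (hT0.comp hφ.tendsto_atTop)
  have hzV : (z : E) ∈ _root_.closure (pRange T.adjoint) :=
    isClosed_closure.mem_of_tendsto hl (Eventually.of_forall fun k => hxV (φ k))
  have hz1 : ‖(z : E)‖ = 1 :=
    tendsto_nhds_unique hl.norm (by simp only [hx1]; exact tendsto_const_nhds)
  rw [eq_zero_of_apply_eq_zero_of_mem_closure hd hz hzV, norm_zero] at hz1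
  exact zero_ne_one hz1

end LinearPMap

/-- If the embedding `D(𝒜) = D(T) ∩ closure (R(T*)) ↪ E` is compact, then the
ranges `R(T)` and `R(T*)` are closed and the Poincaré–Friedrichs estimate holds on `D(𝒜)`. -/
theorem closed_ranges_and_poincare_friedrichs_of_compactEmbed
    (T : E →ₗ.[𝕜] F) (hd : Dense (T.domain : Set E)) (hc : T.IsClosed)
    (hcpt : CompactEmbed T (closure (pRange T.adjoint))) :
    IsClosed (pRange T) ∧ IsClosed (pRange T.adjoint) ∧
    ∃ c : ℝ, 0 < c ∧ ∀ x : T.domain, (x : E) ∈ closure (pRange T.adjoint) →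
      ‖(x : E)‖ ≤ c * ‖T x‖ := by
  obtain ⟨c, hc0, hest⟩ := LinearPMap.exists_norm_le_of_compactEmbed hd hc hcpt
  let V := (LinearMap.range T.adjoint.toFun).topologicalClosure
  have : CompleteSpace V := isClosed_closure.completeSpace_coe
  have hV : ∀ u ∈ Vᗮ, ∃ z : T.domain, (z : E) = u ∧ T z = 0 := fun u hu =>
    LinearPMap.exists_apply_eq_zero_of_mem_orthogonal_range_adjoint hd hc
      (by rwa [Submodule.orthogonal_closure] at hu)
  have hT : IsClosed (pRange T) :=
    LinearPMap.isClosed_pRange_of_bounded_below hc V hV hest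
  refine ⟨hT, ?_, c, hc0, hest⟩
  have : CompleteSpace (LinearMap.range T.toFun) := IsClosed.completeSpace_coe (hs := hT)
  refine LinearPMap.isClosed_pRange_of_bounded_below (LinearPMap.adjoint_isClosed hd)
    (LinearMap.range T.toFun)
    (fun u hu => LinearPMap.exists_adjoint_apply_eq_zero_of_mem_orthogonal_range hd hu)
    (c := c) ?_
  rintro y ⟨x, hx⟩
  obtain ⟨p, hpV, hp⟩ := LinearPMap.exists_mem_apply_eq V hV x
  have hpy : T p = (y : F) := hp.trans hx
  have hinner := LinearPMap.adjoint_isFormalAdjoint hd y p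
  rw [hpy] at hinner
  have hsq : ‖(y : F)‖ * ‖(y : F)‖ ≤ c * ‖T.adjoint y‖ * ‖(y : F)‖ := by
    calc ‖(y : F)‖ * ‖(y : F)‖ = ‖inner 𝕜 (T.adjoint y) (p : E)‖ := by
          rw [hinner, inner_self_eq_norm_sq_to_K, norm_pow, RCLike.norm_ofReal, abs_norm, sq]
      _ ≤ ‖T.adjoint y‖ * ‖(p : E)‖ := norm_inner_le_norm _ _
      _ ≤ ‖T.adjoint y‖ * (c * ‖(y : F)‖) := by
          gcongr
          simpa only [hpy] using hest p hpV
      _ = c * ‖T.adjoint y‖ * ‖(y : F)‖ := by ring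
  rcases (norm_nonneg (y : F)).eq_or_lt with h0 | h0
  · rw [← h0]
    positivity
  · exact le_of_mul_le_mul_right hsq h0
end

section
/- Let A : D(A) ⊆ H₀ → H₁ be a densely defined closed linear operator between Hilbert spaces. Then the two Poincaré–Friedrichs infima coincide: λ_A = λ_{A*} as elements of [0,∞]; equivalently, the best Poincaré–Friedrichs constants for A and for A* are equal, c_A = c_{A*}. -/
open Filter Topology
open scoped ENNReal

/-- The Poincaré–Friedrichs infimum `inf { ‖T x‖ / ‖x‖ : 0 ≠ x ∈ D(T) ∩ V }`,
taken in `[0,∞]` with `inf ∅ = ∞`. -/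
noncomputable def lamSet {𝕜 E F : Type*} [RCLike 𝕜]
    [NormedAddCommGroup E] [InnerProductSpace 𝕜 E]
    [NormedAddCommGroup F] [InnerProductSpace 𝕜 F]
    (T : E →ₗ.[𝕜] F) (V : Set E) : ℝ≥0∞ :=
  ⨅ x : {x : T.domain // (x : E) ≠ 0 ∧ (x : E) ∈ V},
    ENNReal.ofReal (‖T x.1‖ / ‖(x.1 : E)‖)

variable {𝕜 E F : Type*} [RCLike 𝕜]
  [NormedAddCommGroup E] [InnerProductSpace 𝕜 E] [CompleteSpace E]
  [NormedAddCommGroup F] [InnerProductSpace 𝕜 F] [CompleteSpace F]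

namespace LinearPMap

omit [CompleteSpace F] in
theorem exists_apply_adjoint_eq_zero_of_forall_inner {T : E →ₗ.[𝕜] F}
    (hd : Dense (T.domain : Set E)) {y : F} (hy : ∀ x : T.domain, inner 𝕜 (T x) y = 0) :
    ∃ h : y ∈ T.adjoint.domain, T.adjoint ⟨y, h⟩ = 0 := by
  have hw : ∀ x : T.domain, inner 𝕜 (0 : E) x = inner 𝕜 y (T x) := fun x => by
    rw [inner_zero_left, inner_eq_zero_symm.1 (hy x)]
  exact ⟨mem_adjoint_domain_of_exists y ⟨0, hw⟩, adjoint_apply_eq hd _ hw⟩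

theorem exists_apply_eq_zero_of_forall_inner_adjoint {T : E →ₗ.[𝕜] F}
    (hd : Dense (T.domain : Set E)) (hc : T.IsClosed) {x : E}
    (hx : ∀ y : T.adjoint.domain, inner 𝕜 (T.adjoint y) x = 0) :
    ∃ h : x ∈ T.domain, T ⟨x, h⟩ = 0 := by
  let G : Submodule 𝕜 (WithLp 2 (E × F)) :=
    T.graph.comap (WithLp.linearEquiv 2 𝕜 (E × F)).toLinearMap
  have hG : _root_.IsClosed (G : Set (WithLp 2 (E × F))) :=
    _root_.IsClosed.preimage (WithLp.prod_continuous_ofLp 2 E F) hc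
  have hmem : WithLp.toLp 2 (x, (0 : F)) ∈ G := by
    rw [← hG.submodule_topologicalClosure_eq, ← G.orthogonal_orthogonal_eq_closure,
      Submodule.mem_orthogonal]
    intro v hv
    have hw : ∀ e : T.domain, inner 𝕜 (-v.fst) (e : E) = inner 𝕜 v.snd (T e) := fun e => by
      have he : WithLp.toLp 2 ((e : E), T e) ∈ G := T.mem_graph e
      have := Submodule.inner_left_of_mem_orthogonal he hv
      rw [WithLp.prod_inner_apply] at this
      rw [inner_neg_left]
      exact neg_eq_of_add_eq_zero_right this
    have hv' := adjoint_apply_eq hd ⟨_, mem_adjoint_domain_of_exists _ ⟨_, hw⟩⟩ hw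
    have h0 := hx ⟨_, mem_adjoint_domain_of_exists _ ⟨_, hw⟩⟩
    rw [hv', inner_neg_left, neg_eq_zero] at h0
    rw [WithLp.prod_inner_apply]
    simpa using h0
  obtain ⟨e, he, he'⟩ := (mem_graph_iff T).1 (show (x, (0 : F)) ∈ T.graph from hmem)
  obtain rfl : (e : E) = x := he
  exact ⟨e.2, he'⟩

end LinearPMap

omit [CompleteSpace F] in
theorem lamSet_le_of_isFormalAdjoint {T : E →ₗ.[𝕜] F} {S : F →ₗ.[𝕜] E}
    (hST : S.IsFormalAdjoint T)
    (hker : ∀ x : E, (∀ y : S.domain, inner 𝕜 (S y) x = 0) → ∃ h : x ∈ T.domain, T ⟨x, h⟩ = 0) :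
    lamSet T (closure (pRange S)) ≤ lamSet S (closure (pRange T)) := by
  refine le_iInf fun ⟨y, hy0, hy⟩ => ENNReal.le_of_forall_nnreal_lt fun r hr => ?_
  have hbound : ∀ x : T.domain, (x : E) ∈ closure (pRange S) → r * ‖(x : E)‖ ≤ ‖T x‖ := by
    intro x hx
    by_cases hx0 : (x : E) = 0
    · simp [hx0]
    · have h := hr.le.trans (iInf_le _ ⟨x, hx0, hx⟩)
      rw [← ENNReal.ofReal_coe_nnreal, ENNReal.ofReal_le_ofReal_iff (by positivity)] at h
      exact (le_div_iff₀ (norm_pos_iff.2 hx0)).1 h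
  have hrange : ∀ z ∈ closure (pRange T), r * ‖inner 𝕜 (y : F) z‖ ≤ ‖S y‖ * ‖z‖ := by
    refine fun z hz => closure_minimal (t := {z | r * ‖inner 𝕜 (y : F) z‖ ≤ ‖S y‖ * ‖z‖}) ?_
      (isClosed_le (by fun_prop) (by fun_prop)) hz
    rintro _ ⟨x, rfl⟩
    let K : Submodule 𝕜 E := (LinearMap.range S.toFun).topologicalClosure
    obtain ⟨x₁, hx₁, x₂, hx₂, hx⟩ := K.exists_add_mem_mem_orthogonal (x : E)
    obtain ⟨hx₂d, hTx₂⟩ := hker x₂ fun w => Submodule.inner_right_of_mem_orthogonal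
      (Submodule.le_topologicalClosure _ (LinearMap.mem_range_self S.toFun w)) hx₂
    have hx₁d : x₁ ∈ T.domain := by
      rw [eq_sub_of_add_eq hx.symm]
      exact T.domain.sub_mem x.2 hx₂d
    have hTx : T x = T ⟨x₁, hx₁d⟩ := by
      rw [show x = ⟨x₁, hx₁d⟩ + ⟨x₂, hx₂d⟩ from Subtype.ext hx, T.map_add, hTx₂, add_zero]
    have hx₁S : x₁ ∈ closure (pRange S) := by
      have : pRange S = (LinearMap.range S.toFun : Set E) := rfl
      rw [this]
      exact hx₁
    change r * ‖inner 𝕜 (y : F) (T x)‖ ≤ ‖S y‖ * ‖T x‖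
    rw [hTx, ← hST y]
    calc (r : ℝ) * ‖inner 𝕜 (S y) x₁‖ ≤ r * (‖S y‖ * ‖x₁‖) := by
          gcongr
          exact norm_inner_le_norm _ _
      _ = ‖S y‖ * (r * ‖x₁‖) := by ring
      _ ≤ ‖S y‖ * ‖T ⟨x₁, hx₁d⟩‖ := by
          gcongr
          exact hbound ⟨x₁, hx₁d⟩ hx₁S
  have hpos : 0 < ‖(y : F)‖ := norm_pos_iff.2 hy0
  rw [← ENNReal.ofReal_coe_nnreal]
  refine ENNReal.ofReal_le_ofReal ((le_div_iff₀ hpos).2 (le_of_mul_le_mul_right ?_ hpos))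
  have h := hrange y hy
  rwa [inner_self_eq_norm_sq_to_K, norm_pow, RCLike.norm_ofReal, abs_norm, pow_two,
    ← mul_assoc] at h

/-- For a densely defined closed operator `T`, the two
Poincaré–Friedrichs infima coincide, `λ_A = λ_{A*}` in `[0,∞]`; equivalently the best
Poincaré–Friedrichs constants coincide, `c_A = 1/λ_A = 1/λ_{A*} = c_{A*}`. -/
theorem lam_eq_lam_adjoint
    (T : E →ₗ.[𝕜] F) (hd : Dense (T.domain : Set E)) (hc : T.IsClosed) :
    lamSet T (closure (pRange T.adjoint)) = lamSet T.adjoint (closure (pRange T)) ∧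
    (lamSet T (closure (pRange T.adjoint)))⁻¹ = (lamSet T.adjoint (closure (pRange T)))⁻¹ := by
  have h : lamSet T (closure (pRange T.adjoint)) = lamSet T.adjoint (closure (pRange T)) :=
    le_antisymm
      (lamSet_le_of_isFormalAdjoint (LinearPMap.adjoint_isFormalAdjoint hd) fun _ =>
        LinearPMap.exists_apply_eq_zero_of_forall_inner_adjoint hd hc)
      (lamSet_le_of_isFormalAdjoint (LinearPMap.adjoint_isFormalAdjoint hd).symm fun _ =>
        LinearPMap.exists_apply_adjoint_eq_zero_of_forall_inner hd)
  exact ⟨h, congrArg _ h⟩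
end

section
/- Let A : D(A) ⊆ H₀ → H₁ be a densely defined closed linear operator between Hilbert spaces. Then the operator A*A with domain D(A*A) = { x ∈ D(A) : Ax ∈ D(A*) } is self-adjoint: it is densely defined and equals its own Hilbert adjoint. Moreover it is nonnegative: ⟨A*Ax, x⟩_{H₀} = ‖Ax‖²_{H₁} ≥ 0 for all x ∈ D(A*A). -/
open Filter Topology
open scoped ENNReal

/-- Composition of partially defined linear maps: `pComp S T` is `S ∘ T` with natural domain
`{x ∈ D(T) : T x ∈ D(S)}`. -/
noncomputable def pComp {R E F G : Type*} [Ring R] [AddCommGroup E] [Module R E]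
    [AddCommGroup F] [Module R F] [AddCommGroup G] [Module R G]
    (S : F →ₗ.[R] G) (T : E →ₗ.[R] F) : E →ₗ.[R] G where
  domain := (S.domain.comap T.toFun).map T.domain.subtype
  toFun := (S.toFun.comp (T.toFun.restrict fun _ hx => Submodule.mem_comap.mp hx)).comp
    (Submodule.equivMapOfInjective T.domain.subtype (Submodule.injective_subtype _)
      (S.domain.comap T.toFun)).symm.toLinearMap

variable {𝕜 E F : Type*} [RCLike 𝕜]
  [NormedAddCommGroup E] [InnerProductSpace 𝕜 E] [CompleteSpace E]
  [NormedAddCommGroup F] [InnerProductSpace 𝕜 F] [CompleteSpace F]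

local notation "⟪" x ", " y "⟫" => @inner 𝕜 _ _ x y

theorem mem_pComp_domain {R E F G : Type*} [Ring R] [AddCommGroup E] [Module R E]
    [AddCommGroup F] [Module R F] [AddCommGroup G] [Module R G]
    {S : F →ₗ.[R] G} {T : E →ₗ.[R] F} {x : E} :
    x ∈ (pComp S T).domain ↔ ∃ h : x ∈ T.domain, T ⟨x, h⟩ ∈ S.domain := by
  constructor
  · rintro ⟨y, hy, rfl⟩
    exact ⟨y.2, hy⟩
  · rintro ⟨h, h'⟩
    exact ⟨⟨x, h⟩, h', rfl⟩

theorem pComp_apply {R E F G : Type*} [Ring R] [AddCommGroup E] [Module R E]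
    [AddCommGroup F] [Module R F] [AddCommGroup G] [Module R G]
    (S : F →ₗ.[R] G) (T : E →ₗ.[R] F) (x : T.domain) (hx : T x ∈ S.domain)
    (h : (x : E) ∈ (pComp S T).domain) :
    pComp S T ⟨x, h⟩ = S ⟨T x, hx⟩ := by
  have key : (Submodule.equivMapOfInjective T.domain.subtype (Submodule.injective_subtype _)
      (S.domain.comap T.toFun)).symm ⟨x, h⟩ = ⟨x, hx⟩ := by
    rw [LinearEquiv.symm_apply_eq]
    rfl
  change S.toFun (T.toFun.restrict (fun _ hx => Submodule.mem_comap.mp hx)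
    ((Submodule.equivMapOfInjective T.domain.subtype (Submodule.injective_subtype _)
      (S.domain.comap T.toFun)).symm ⟨x, h⟩)) = _
  rw [key]
  rfl

/-- A densely defined symmetric operator `S` with `1 + S` surjective is self-adjoint. -/
theorem LinearPMap.IsFormalAdjoint.adjoint_eq_of_surjective {S : E →ₗ.[𝕜] E}
    (hd : Dense (S.domain : Set E)) (hS : S.IsFormalAdjoint S)
    (hsurj : ∀ z : E, ∃ x : S.domain, (x : E) + S x = z) : S.adjoint = S := by
  have hle : S ≤ S.adjoint := hS.le_adjoint hd
  refine (LinearPMap.eq_of_le_of_domain_eq hle (le_antisymm hle.1 fun y hy => ?_)).symm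
  obtain ⟨x, hx⟩ := hsurj (y + S.adjoint ⟨y, hy⟩)
  have hyx : y = x := by
    refine ext_inner_right 𝕜 fun w => ?_
    obtain ⟨v, rfl⟩ := hsurj w
    have h1 := LinearPMap.adjoint_isFormalAdjoint hd ⟨y, hy⟩ v
    rw [inner_add_right, inner_add_right, ← h1, ← hS x v, ← inner_add_left, ← inner_add_left, hx]
  exact hyx ▸ x.2

/-- For a densely defined closed operator `T`, the operator `1 + T*T` is surjective. -/
theorem LinearPMap.IsClosed.exists_add_adjoint_apply_eq {T : E →ₗ.[𝕜] F}
    (hc : T.IsClosed) (hd : Dense (T.domain : Set E)) (z : E) :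
    ∃ (x : T.domain) (hx : T x ∈ T.adjoint.domain), (x : E) + T.adjoint ⟨T x, hx⟩ = z := by
  let K : Submodule 𝕜 (WithLp 2 (E × F)) :=
    T.graph.comap (WithLp.linearEquiv 2 𝕜 (E × F)).toLinearMap
  have hK : _root_.IsClosed (K : Set (WithLp 2 (E × F))) :=
    hc.preimage (WithLp.prod_continuous_ofLp 2 E F)
  have : CompleteSpace K := hK.completeSpace_coe
  obtain ⟨p, hp, w, hw, hpw⟩ := K.exists_add_mem_mem_orthogonal (WithLp.toLp 2 (z, (0 : F)))
  obtain ⟨x, hx1, hx2⟩ := (LinearPMap.mem_graph_iff T).mp hp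
  change (x : E) = p.fst at hx1
  change T x = p.snd at hx2
  have hz : z = p.fst + w.fst := congrArg (fun q : WithLp 2 (E × F) => q.fst) hpw
  have h0 : 0 = p.snd + w.snd := congrArg (fun q : WithLp 2 (E × F) => q.snd) hpw
  have key : ∀ v : T.domain, ⟪z - x, (v : E)⟫ = ⟪T x, T v⟫ := fun v => by
    have hv : WithLp.toLp 2 ((v : E), T v) ∈ K := T.mem_graph v
    have h := Submodule.inner_left_of_mem_orthogonal hv hw
    rw [WithLp.prod_inner_apply] at h
    have h1 : z - x = w.fst := by rw [hz, hx1, add_sub_cancel_left]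
    have h2 : T x = -w.snd := by rw [hx2]; exact eq_neg_of_add_eq_zero_left h0.symm
    rw [h1, h2, inner_neg_left]
    exact eq_neg_of_add_eq_zero_left h
  have hmem := LinearPMap.mem_adjoint_domain_of_exists (T x) ⟨z - x, key⟩
  refine ⟨x, hmem, ?_⟩
  rw [LinearPMap.adjoint_apply_eq hd ⟨T x, hmem⟩ key, add_sub_cancel]

theorem inner_adjoint_apply_self {T : E →ₗ.[𝕜] F} (hd : Dense (T.domain : Set E))
    (x : T.domain) (hx : T x ∈ T.adjoint.domain) :
    ⟪T.adjoint ⟨T x, hx⟩, (x : E)⟫ = ((‖T x‖ ^ 2 : ℝ) : 𝕜) := by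
  rw [LinearPMap.adjoint_isFormalAdjoint hd ⟨T x, hx⟩ x, inner_self_eq_norm_sq_to_K]
  push_cast
  rfl

theorem pComp_adjoint_self_isFormalAdjoint {T : E →ₗ.[𝕜] F} (hd : Dense (T.domain : Set E)) :
    (pComp T.adjoint T).IsFormalAdjoint (pComp T.adjoint T) := by
  rintro ⟨x, hx⟩ ⟨y, hy⟩
  obtain ⟨hx1, hx2⟩ := mem_pComp_domain.mp hx
  obtain ⟨hy1, hy2⟩ := mem_pComp_domain.mp hy
  have hT := LinearPMap.adjoint_isFormalAdjoint hd
  rw [pComp_apply T.adjoint T ⟨x, hx1⟩ hx2 hx, pComp_apply T.adjoint T ⟨y, hy1⟩ hy2 hy]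
  exact (hT ⟨_, hx2⟩ ⟨y, hy1⟩).trans (hT.symm ⟨x, hx1⟩ ⟨_, hy2⟩)

theorem LinearPMap.IsClosed.dense_pComp_adjoint_self_domain {T : E →ₗ.[𝕜] F}
    (hc : T.IsClosed) (hd : Dense (T.domain : Set E)) :
    Dense ((pComp T.adjoint T).domain : Set E) := by
  rw [Submodule.dense_iff_topologicalClosure_eq_top, Submodule.topologicalClosure_eq_top_iff,
    Submodule.eq_bot_iff]
  intro z hz
  obtain ⟨x, hx, rfl⟩ := hc.exists_add_adjoint_apply_eq hd z
  have h := Submodule.inner_left_of_mem_orthogonal (mem_pComp_domain.mpr ⟨x.2, hx⟩) hz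
  rw [inner_add_left, inner_adjoint_apply_self hd x hx, inner_self_eq_norm_sq_to_K] at h
  have hnorm : ‖(x : E)‖ ^ 2 + ‖T x‖ ^ 2 = 0 := by exact_mod_cast h
  have hx0 : x = 0 := by
    rw [← Submodule.coe_eq_zero, ← norm_eq_zero]
    nlinarith [sq_nonneg ‖(x : E)‖, sq_nonneg ‖T x‖]
  subst hx0
  have hT0 : (⟨T 0, hx⟩ : T.adjoint.domain) = 0 := Subtype.ext T.map_zero
  rw [hT0, LinearPMap.map_zero, Submodule.coe_zero, add_zero]

/-- For a densely defined closed operator `T`, the operator `T*T` with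
domain `{x ∈ D(T) : T x ∈ D(T*)}` is self-adjoint (densely defined and equal to its own
Hilbert adjoint) and nonnegative: `⟪T*T x, x⟫ = ‖T x‖² ≥ 0` on its domain. -/
theorem adjoint_comp_self_isSelfAdjoint_and_nonneg
    (T : E →ₗ.[𝕜] F) (hd : Dense (T.domain : Set E)) (hc : T.IsClosed) :
    Dense ((pComp T.adjoint T).domain : Set E) ∧
    (pComp T.adjoint T).adjoint = pComp T.adjoint T ∧
    ∀ (x : T.domain) (hx : T x ∈ T.adjoint.domain),
      ⟪T.adjoint ⟨T x, hx⟩, (x : E)⟫ = ((‖T x‖ ^ 2 : ℝ) : 𝕜) := by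
  have hdense := hc.dense_pComp_adjoint_self_domain hd
  refine ⟨hdense, (pComp_adjoint_self_isFormalAdjoint hd).adjoint_eq_of_surjective hdense
    fun z => ?_, inner_adjoint_apply_self hd⟩
  obtain ⟨x, hx, hz⟩ := hc.exists_add_adjoint_apply_eq hd z
  have hmem : (x : E) ∈ (pComp T.adjoint T).domain := mem_pComp_domain.mpr ⟨x.2, hx⟩
  exact ⟨⟨x, hmem⟩, by rw [pComp_apply T.adjoint T x hx hmem, hz]⟩
end

section
/- Let A : D(A) ⊆ H₀ → H₁ be a densely defined closed linear operator between Hilbert spaces. Assume the embedding D(𝒜) ↪ H₀ is compact and D(𝒜) ≠ {0}. Then λ_A ∈ (0,∞) and the infimum defining λ_A is attained: there exists x_A ∈ D(𝒜) with ‖x_A‖_{H₀} = 1 and ‖Ax_A‖_{H₁} = λ_A; moreover Ax_A ∈ D(A*) and A*(Ax_A) = λ_A² x_A. -/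
open Filter Topology
open scoped ENNReal

variable {𝕜 E F : Type*} [RCLike 𝕜]
  [NormedAddCommGroup E] [InnerProductSpace 𝕜 E] [CompleteSpace E]
  [NormedAddCommGroup F] [InnerProductSpace 𝕜 F] [CompleteSpace F]

open scoped ComplexConjugate

/-- A vector orthogonal to the range of the adjoint of a closed operator lies in its kernel. -/
theorem LinearPMap.IsClosed.exists_apply_eq_zero_of_inner_adjoint_eq_zero
    {T : E →ₗ.[𝕜] F} (hd : Dense (T.domain : Set E)) (hc : T.IsClosed) {z : E}
    (hz : ∀ y : T.adjoint.domain, inner 𝕜 (T.adjoint y) z = 0) :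
    ∃ h : z ∈ T.domain, T ⟨z, h⟩ = 0 := by
  let K : Submodule 𝕜 (WithLp 2 (E × F)) :=
    T.graph.comap (WithLp.linearEquiv 2 𝕜 (E × F)).toLinearMap
  have hK : _root_.IsClosed (K : Set (WithLp 2 (E × F))) :=
    _root_.IsClosed.preimage (WithLp.prod_continuous_ofLp 2 E F) hc
  have hzK : WithLp.toLp 2 (z, (0 : F)) ∈ Kᗮᗮ := by
    rw [Submodule.mem_orthogonal]
    intro u hu
    rw [Submodule.mem_orthogonal'] at hu
    have key : ∀ x : T.domain, inner 𝕜 u.fst (x : E) = inner 𝕜 (-u.snd) (T x) := by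
      intro x
      have := hu (WithLp.toLp 2 ((x : E), T x)) (T.mem_graph x)
      rw [WithLp.prod_inner_apply] at this
      rw [inner_neg_left]
      exact eq_neg_of_add_eq_zero_left this
    have hdom := LinearPMap.mem_adjoint_domain_of_exists (-u.snd) ⟨u.fst, key⟩
    have := hz ⟨_, hdom⟩
    rw [LinearPMap.adjoint_apply_eq hd ⟨_, hdom⟩ key] at this
    rw [WithLp.prod_inner_apply]
    simpa using this
  rw [Submodule.orthogonal_orthogonal_eq_closure, hK.submodule_topologicalClosure_eq] at hzK
  have hg : (z, (0 : F)) ∈ T.graph := hzK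
  obtain ⟨y, hy, hy0⟩ := (T.mem_graph_iff).1 hg
  subst hy
  exact ⟨y.2, hy0⟩

/-- If `T` is bounded below by `μ` on a subspace and attains this bound at `x`, then the first
variation of `‖T x‖ ^ 2 - μ ^ 2 * ‖x‖ ^ 2` along that subspace vanishes. -/
theorem LinearPMap.inner_apply_eq_of_norm_apply_eq
    {𝕜 E F : Type*} [RCLike 𝕜] [NormedAddCommGroup E] [InnerProductSpace 𝕜 E]
    [NormedAddCommGroup F] [InnerProductSpace 𝕜 F]
    {T : E →ₗ.[𝕜] F} {W : Submodule 𝕜 E} {μ : ℝ} (hμ : 0 ≤ μ)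
    (hle : ∀ y : T.domain, (y : E) ∈ W → μ * ‖(y : E)‖ ≤ ‖T y‖)
    {x : T.domain} (hx : (x : E) ∈ W) (heq : ‖T x‖ = μ * ‖(x : E)‖)
    {y : T.domain} (hy : (y : E) ∈ W) :
    inner 𝕜 (T x) (T y) = ((μ ^ 2 : ℝ) : 𝕜) * inner 𝕜 (x : E) (y : E) := by
  have hre : ∀ y : T.domain, (y : E) ∈ W →
      RCLike.re (inner 𝕜 (T x) (T y) - ((μ ^ 2 : ℝ) : 𝕜) * inner 𝕜 (x : E) (y : E)) = 0 := by
    intro y hy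
    rw [_root_.map_sub, RCLike.re_ofReal_mul]
    have hq : ∀ t : ℝ, 0 ≤ (‖T y‖ ^ 2 - μ ^ 2 * ‖(y : E)‖ ^ 2) * (t * t) +
        (2 * (RCLike.re (inner 𝕜 (T x) (T y)) -
          μ ^ 2 * RCLike.re (inner 𝕜 (x : E) (y : E)))) * t + 0 := by
      intro t
      have h1 := hle (x + (t : 𝕜) • y) (W.add_mem hx (W.smul_mem _ hy))
      have h2 := pow_le_pow_left₀ (by positivity) h1 2
      rw [T.map_add, T.map_smul, Submodule.coe_add, Submodule.coe_smul, mul_pow,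
        norm_add_sq (𝕜 := 𝕜), norm_add_sq (𝕜 := 𝕜), inner_smul_right, inner_smul_right,
        RCLike.re_ofReal_mul, RCLike.re_ofReal_mul, norm_smul, norm_smul, heq,
        RCLike.norm_ofReal, mul_pow |t|, mul_pow |t|, sq_abs] at h2
      linarith
    have := discrim_le_zero hq
    rw [discrim] at this
    nlinarith
  have h := hre
    (conj (inner 𝕜 (T x) (T y) - ((μ ^ 2 : ℝ) : 𝕜) * inner 𝕜 (x : E) (y : E)) • y)
    (W.smul_mem _ hy)
  rw [T.map_smul, Submodule.coe_smul, inner_smul_right, inner_smul_right, mul_left_comm,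
    ← mul_sub, RCLike.conj_mul] at h
  norm_cast at h
  exact sub_eq_zero.1 (norm_eq_zero.1 (pow_eq_zero_iff two_ne_zero |>.1 h))

/-- On a closed subspace on which the graph-norm embedding is compact, a closed operator attains
its infimum over unit vectors. -/
theorem LinearPMap.IsClosed.exists_norm_apply_eq_of_compactEmbed
    {𝕜 E F : Type*} [RCLike 𝕜] [NormedAddCommGroup E] [InnerProductSpace 𝕜 E]
    [NormedAddCommGroup F] [InnerProductSpace 𝕜 F] [CompleteSpace F]
    {T : E →ₗ.[𝕜] F} (hc : T.IsClosed) {W : Submodule 𝕜 E}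
    (hW : _root_.IsClosed (W : Set E)) (hcpt : CompactEmbed T (W : Set E)) {μ : ℝ} (hμ : 0 ≤ μ)
    (hle : ∀ y : T.domain, (y : E) ∈ W → μ * ‖(y : E)‖ ≤ ‖T y‖)
    {x : ℕ → T.domain} (hx : ∀ n, (x n : E) ∈ W) (hx1 : ∀ n, ‖(x n : E)‖ = 1)
    (hlim : Tendsto (fun n => ‖T (x n)‖) atTop (𝓝 μ)) :
    ∃ y : T.domain, (y : E) ∈ W ∧ ‖(y : E)‖ = 1 ∧ ‖T y‖ = μ := by
  obtain ⟨C, hC⟩ := hlim.bddAbove_range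
  obtain ⟨φ, hφ, l, hl⟩ := hcpt x hx
    ⟨1 + C, fun n => by rw [hx1]; exact add_le_add_right (hC ⟨n, rfl⟩) 1⟩
  have hTlim := hlim.comp hφ.tendsto_atTop
  have hl1 : ‖l‖ = 1 := tendsto_nhds_unique hl.norm (by simp [hx1])
  have hcau : CauchySeq fun k => T (x (φ k)) := by
    rw [cauchySeq_iff_tendsto_dist_atTop_0]
    have hbound : ∀ p : ℕ × ℕ, dist (T (x (φ p.1))) (T (x (φ p.2))) ^ 2 ≤
        2 * ‖T (x (φ p.1))‖ ^ 2 + 2 * ‖T (x (φ p.2))‖ ^ 2 -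
          μ ^ 2 * ‖(x (φ p.1) : E) + x (φ p.2)‖ ^ 2 := by
      intro p
      have h1 := hle (x (φ p.1) + x (φ p.2)) (W.add_mem (hx _) (hx _))
      have h2 := pow_le_pow_left₀ (by positivity) h1 2
      have h3 := parallelogram_law_with_norm 𝕜 (T (x (φ p.1))) (T (x (φ p.2)))
      rw [T.map_add, Submodule.coe_add, mul_pow] at h2
      rw [dist_eq_norm]
      nlinarith
    have hfst : Tendsto (Prod.fst : ℕ × ℕ → ℕ) atTop atTop := by
      rw [← prod_atTop_atTop_eq]; exact tendsto_fst
    have hsnd : Tendsto (Prod.snd : ℕ × ℕ → ℕ) atTop atTop := by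
      rw [← prod_atTop_atTop_eq]; exact tendsto_snd
    have hsq : Tendsto (fun p : ℕ × ℕ => dist (T (x (φ p.1))) (T (x (φ p.2))) ^ 2)
        atTop (𝓝 0) := by
      refine squeeze_zero (fun _ => by positivity) hbound ?_
      have := ((((hTlim.comp hfst).pow 2).const_mul 2).add
        (((hTlim.comp hsnd).pow 2).const_mul 2)).sub
        ((((hl.comp hfst).add (hl.comp hsnd)).norm.pow 2).const_mul (μ ^ 2))
      rw [← two_smul 𝕜 l, norm_smul, hl1, RCLike.norm_two] at this
      rwa [show 2 * μ ^ 2 + 2 * μ ^ 2 - μ ^ 2 * (2 * 1) ^ 2 = 0 by ring] at this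
    have := hsq.sqrt
    simpa [Real.sqrt_sq dist_nonneg] using this
  obtain ⟨m, hm⟩ := cauchySeq_tendsto_of_complete hcau
  have hg : (l, m) ∈ T.graph :=
    hc.mem_of_tendsto (hl.prodMk_nhds hm) (Eventually.of_forall fun k => T.mem_graph _)
  obtain ⟨y, hy, hym⟩ := (T.mem_graph_iff).1 hg
  simp only at hy hym
  refine ⟨y, ?_, by rw [hy, hl1], ?_⟩
  · rw [hy]
    exact hW.mem_of_tendsto hl (Eventually.of_forall fun k => hx _)
  · rw [hym]
    exact tendsto_nhds_unique hm.norm hTlim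

/-- If `D(𝒜) = D(T) ∩ closure (R(T*))` embeds compactly into `E` and is
nontrivial, then `λ_A ∈ (0,∞)` and the infimum is attained by a normalized eigenvector:
there is `x_A ∈ D(𝒜)` with `‖x_A‖ = 1`, `‖T x_A‖ = λ_A`, `T x_A ∈ D(T*)` and
`T*(T x_A) = λ_A² • x_A`. -/
theorem lam_pos_and_attained_of_compactEmbed
    (T : E →ₗ.[𝕜] F) (hd : Dense (T.domain : Set E)) (hc : T.IsClosed)
    (hcpt : CompactEmbed T (closure (pRange T.adjoint)))
    (hne : ∃ x : T.domain, (x : E) ∈ closure (pRange T.adjoint) ∧ (x : E) ≠ 0) :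
    lamSet T (closure (pRange T.adjoint)) ≠ 0 ∧
    lamSet T (closure (pRange T.adjoint)) ≠ ⊤ ∧
    ∃ x : T.domain, (x : E) ∈ closure (pRange T.adjoint) ∧ ‖(x : E)‖ = 1 ∧
      ‖T x‖ = (lamSet T (closure (pRange T.adjoint))).toReal ∧
      ∃ h : T x ∈ T.adjoint.domain,
        T.adjoint ⟨T x, h⟩ =
          (((lamSet T (closure (pRange T.adjoint))).toReal ^ 2 : ℝ) : 𝕜) • (x : E) := by
  let R : Submodule 𝕜 E := LinearMap.range T.adjoint.toFun
  let W : Submodule 𝕜 E := R.topologicalClosure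
  have hWcl : IsClosed (W : Set E) := R.isClosed_topologicalClosure
  have hWeq : closure (pRange T.adjoint) = (W : Set E) := by
    rw [Submodule.topologicalClosure_coe]
    rfl
  rw [hWeq] at hcpt hne ⊢
  simp only [SetLike.mem_coe] at hne ⊢
  have hlam_le : ∀ y : T.domain, (y : E) ≠ 0 → (y : E) ∈ W →
      lamSet T (W : Set E) ≤ ENNReal.ofReal (‖T y‖ / ‖(y : E)‖) := fun y h0 hy =>
    iInf_le (fun x : {x : T.domain // (x : E) ≠ 0 ∧ (x : E) ∈ (W : Set E)} =>
      ENNReal.ofReal (‖T x.1‖ / ‖(x.1 : E)‖)) ⟨y, h0, hy⟩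
  have htop : lamSet T (W : Set E) ≠ ⊤ := by
    obtain ⟨x, hx, hx0⟩ := hne
    exact ne_top_of_le_ne_top ENNReal.ofReal_ne_top (hlam_le x hx0 hx)
  set μ := (lamSet T (W : Set E)).toReal with hμdef
  have hμ : 0 ≤ μ := ENNReal.toReal_nonneg
  have hlamμ : lamSet T (W : Set E) = ENNReal.ofReal μ := (ENNReal.ofReal_toReal htop).symm
  have hle : ∀ y : T.domain, (y : E) ∈ W → μ * ‖(y : E)‖ ≤ ‖T y‖ := by
    intro y hy
    rcases eq_or_ne (y : E) 0 with h0 | h0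
    · simp [h0]
    · rw [← le_div_iff₀ (norm_pos_iff.2 h0)]
      exact ENNReal.toReal_le_of_le_ofReal (by positivity) (hlam_le y h0 hy)
  have hseq : ∀ n : ℕ, ∃ x : T.domain, (x : E) ∈ W ∧ ‖(x : E)‖ = 1 ∧
      ‖T x‖ < μ + 1 / ((n : ℝ) + 1) := by
    intro n
    have hlt : lamSet T (W : Set E) < ENNReal.ofReal (μ + 1 / ((n : ℝ) + 1)) := by
      have : (0 : ℝ) < 1 / ((n : ℝ) + 1) := by positivity
      rw [hlamμ]
      exact (ENNReal.ofReal_lt_ofReal_iff (by linarith)).2 (by linarith)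
    obtain ⟨⟨x, hx0, hxW⟩, hx⟩ := iInf_lt_iff.1 hlt
    refine ⟨((‖(x : E)‖⁻¹ : ℝ) : 𝕜) • x, W.smul_mem _ hxW, ?_, ?_⟩
    · rw [Submodule.coe_smul, norm_smul, RCLike.norm_ofReal, abs_of_nonneg (by positivity)]
      exact inv_mul_cancel₀ (norm_ne_zero_iff.2 hx0)
    · rw [T.map_smul, norm_smul, RCLike.norm_ofReal, abs_of_nonneg (by positivity),
        mul_comm, ← div_eq_mul_inv]
      exact (ENNReal.ofReal_lt_ofReal_iff (by positivity)).1 hx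
  choose x hxW hx1 hxlt using hseq
  have hlim : Tendsto (fun n => ‖T (x n)‖) atTop (𝓝 μ) := by
    refine tendsto_of_tendsto_of_tendsto_of_le_of_le tendsto_const_nhds
      (h := fun n : ℕ => μ + 1 / ((n : ℝ) + 1)) ?_ (fun n => ?_) (fun n => (hxlt n).le)
    · simpa using tendsto_one_div_add_atTop_nhds_zero_nat.const_add μ
    · simpa [hx1] using hle (x n) (hxW n)
  obtain ⟨y, hyW, hy1, hyμ⟩ :=
    hc.exists_norm_apply_eq_of_compactEmbed hWcl hcpt hμ hle hxW hx1 hlim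
  have hker : ∀ z ∈ Wᗮ, ∃ h : z ∈ T.domain, T ⟨z, h⟩ = 0 := fun z hz =>
    hc.exists_apply_eq_zero_of_inner_adjoint_eq_zero hd fun w =>
      Submodule.inner_right_of_mem_orthogonal
        (R.le_topologicalClosure (LinearMap.mem_range_self T.adjoint.toFun w)) hz
  have hμ0 : μ ≠ 0 := by
    intro h0
    have hTy : T y = 0 := norm_eq_zero.1 (hyμ.trans h0)
    have hyR : (y : E) ∈ Rᗮ := by
      rw [Submodule.mem_orthogonal]
      rintro _ ⟨w, rfl⟩
      refine (LinearPMap.adjoint_isFormalAdjoint hd w y).trans ?_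
      rw [hTy, inner_zero_right]
    rw [← Submodule.orthogonal_closure] at hyR
    have hy0 : (y : E) = 0 :=
      inner_self_eq_zero.1 (Submodule.inner_right_of_mem_orthogonal (𝕜 := 𝕜) hyW hyR)
    simp [hy0] at hy1
  have hEL : ∀ z : T.domain,
      inner 𝕜 (((μ ^ 2 : ℝ) : 𝕜) • (y : E)) (z : E) = inner 𝕜 (T y) (T z) := by
    intro z
    have : CompleteSpace W := hWcl.completeSpace_coe
    obtain ⟨u, hu, v, hv, huv⟩ := W.exists_add_mem_mem_orthogonal (z : E)
    obtain ⟨hvd, hTv⟩ := hker v hv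
    have hud : u ∈ T.domain := by
      rw [eq_sub_of_add_eq huv.symm]
      exact T.domain.sub_mem z.2 hvd
    have hz : z = ⟨u, hud⟩ + ⟨v, hvd⟩ := Subtype.ext huv
    rw [hz, T.map_add, hTv, add_zero, LinearPMap.inner_apply_eq_of_norm_apply_eq hμ hle hyW
      (by rw [hyμ, hy1, mul_one]) (y := ⟨u, hud⟩) hu, Submodule.coe_add, inner_smul_left,
      inner_add_right, Submodule.inner_right_of_mem_orthogonal hyW hv, add_zero,
      RCLike.conj_ofReal]
  have hdom := LinearPMap.mem_adjoint_domain_of_exists (T y) ⟨_, hEL⟩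
  exact ⟨fun h => hμ0 (by rw [hμdef, h, ENNReal.toReal_zero]), htop, y, hyW, hy1, hyμ, hdom,
    LinearPMap.adjoint_apply_eq hd ⟨_, hdom⟩ hEL⟩
end

section
/- Let A : D(A) ⊆ H₀ → H₁ be a densely defined closed linear operator between Hilbert spaces. Assume the embedding D(𝒜) ↪ H₀ is compact and D(𝒜) ≠ {0}. Then λ_A² is the smallest positive eigenvalue of A*A: there exists 0 ≠ x ∈ D(A*A) with A*Ax = λ_A² x, and every μ > 0 for which the equation A*Ax = μx has a nonzero solution x ∈ D(A*A) satisfies μ ≥ λ_A². -/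
open Filter Topology
open scoped ENNReal

variable {𝕜 E F : Type*} [RCLike 𝕜]
  [NormedAddCommGroup E] [InnerProductSpace 𝕜 E] [CompleteSpace E]
  [NormedAddCommGroup F] [InnerProductSpace 𝕜 F] [CompleteSpace F]

/-- A vector orthogonal to the range of the adjoint of a closed densely defined operator lies in
the kernel of the operator. -/
theorem exists_domain_eq_zero_of_orthogonal_range_adjoint (T : E →ₗ.[𝕜] F)
    (hd : Dense (T.domain : Set E)) (hc : T.IsClosed) {z : E}
    (hz : ∀ y : T.adjoint.domain, inner 𝕜 (T.adjoint y) z = 0) :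
    ∃ u : T.domain, (u : E) = z ∧ T u = 0 := by
  let e := WithLp.prodContinuousLinearEquiv 2 𝕜 E F
  let G : Submodule 𝕜 (WithLp 2 (E × F)) := T.graph.comap e.toLinearEquiv.toLinearMap
  have hG : IsClosed (G : Set (WithLp 2 (E × F))) := IsClosed.preimage e.continuous hc
  have : CompleteSpace G := hG.completeSpace_coe
  let p : WithLp 2 (E × F) := WithLp.toLp 2 (z, 0)
  let q : WithLp 2 (E × F) := G.starProjection p
  have hq : q ∈ G := G.starProjection_apply_mem p
  have hr : p - q ∈ Gᗮ := G.sub_starProjection_mem_orthogonal p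
  obtain ⟨u, hu1, hu2⟩ := (T.mem_graph_iff).1 (show (q.fst, q.snd) ∈ T.graph from hq)
  simp only at hu1 hu2
  have key : ∀ x : T.domain, inner 𝕜 (z - u) (x : E) = inner 𝕜 (T u) (T x) := fun x => by
    have hx : WithLp.toLp 2 ((x : E), T x) ∈ G := T.mem_graph x
    have h := (G.mem_orthogonal' _).1 hr _ hx
    rw [WithLp.prod_inner_apply] at h
    simp only [p, WithLp.ofLp_sub, Prod.fst_sub, Prod.snd_sub, zero_sub, inner_neg_left] at h
    change inner 𝕜 (z - q.fst) (x : E) + -inner 𝕜 q.snd (T x) = 0 at h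
    rw [← hu1, ← hu2] at h
    linear_combination h
  have hmem : T u ∈ T.adjoint.domain := T.mem_adjoint_domain_of_exists _ ⟨_, key⟩
  have hadj : T.adjoint ⟨T u, hmem⟩ = z - u := LinearPMap.adjoint_apply_eq hd _ key
  have h1 : inner 𝕜 (z - u) z = 0 := hadj ▸ hz ⟨T u, hmem⟩
  have h2 : inner 𝕜 (z - u) (z - u) + inner 𝕜 (T u) (T u) = (0 : 𝕜) := by
    rw [inner_sub_right, h1, key]; ring
  have h3 : ‖z - u‖ ^ 2 + ‖T u‖ ^ 2 = 0 := by
    rw [inner_self_eq_norm_sq_to_K, inner_self_eq_norm_sq_to_K] at h2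
    exact_mod_cast h2
  have h4 : ‖z - u‖ = 0 := by nlinarith [sq_nonneg ‖z - u‖, sq_nonneg ‖T u‖]
  have h5 : ‖T u‖ = 0 := by nlinarith [sq_nonneg ‖z - u‖, sq_nonneg ‖T u‖]
  exact ⟨u, (sub_eq_zero.1 (norm_eq_zero.1 h4)).symm, norm_eq_zero.1 h5⟩

theorem lamSet_toReal_mul_norm_le {𝕜 E F : Type*} [RCLike 𝕜]
    [NormedAddCommGroup E] [InnerProductSpace 𝕜 E]
    [NormedAddCommGroup F] [InnerProductSpace 𝕜 F]
    (T : E →ₗ.[𝕜] F) {V : Set E} {x : T.domain} (hx : (x : E) ∈ V) :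
    (lamSet T V).toReal * ‖(x : E)‖ ≤ ‖T x‖ := by
  by_cases h0 : (x : E) = 0
  · simp [h0]
  · rw [← le_div_iff₀ (norm_pos_iff.2 h0)]
    exact ENNReal.toReal_le_of_le_ofReal (by positivity)
      (iInf_le (fun x : {x : T.domain // (x : E) ≠ 0 ∧ (x : E) ∈ V} =>
        ENNReal.ofReal (‖T x.1‖ / ‖(x.1 : E)‖)) ⟨x, h0, hx⟩)

theorem exists_unit_norm_lt_lamSet_add {𝕜 E F : Type*} [RCLike 𝕜]
    [NormedAddCommGroup E] [InnerProductSpace 𝕜 E]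
    [NormedAddCommGroup F] [InnerProductSpace 𝕜 F]
    (T : E →ₗ.[𝕜] F) (K : Submodule 𝕜 E)
    (hne : ∃ x : T.domain, (x : E) ∈ K ∧ (x : E) ≠ 0) {ε : ℝ} (hε : 0 < ε) :
    ∃ x : T.domain, (x : E) ∈ K ∧ ‖(x : E)‖ = 1 ∧ ‖T x‖ < (lamSet T K).toReal + ε := by
  have htop : lamSet T K ≠ ⊤ := by
    obtain ⟨x, hx, h0⟩ := hne
    exact ne_top_of_le_ne_top ENNReal.ofReal_ne_top
      (iInf_le (fun x : {x : T.domain // (x : E) ≠ 0 ∧ (x : E) ∈ (K : Set E)} =>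
        ENNReal.ofReal (‖T x.1‖ / ‖(x.1 : E)‖)) ⟨x, h0, hx⟩)
  have hlt : lamSet T K < ENNReal.ofReal ((lamSet T K).toReal + ε) := by
    rw [ENNReal.lt_ofReal_iff_toReal_lt htop]
    linarith
  obtain ⟨⟨x, h0, hx⟩, hlt⟩ := iInf_lt_iff.1 hlt
  have hpos := norm_pos_iff.2 h0
  refine ⟨((‖(x : E)‖⁻¹ : ℝ) : 𝕜) • x, K.smul_mem _ hx, ?_, ?_⟩
  · rw [Submodule.coe_smul, norm_smul, RCLike.norm_ofReal, abs_of_pos (inv_pos.2 hpos),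
      inv_mul_cancel₀ hpos.ne']
  · rw [T.map_smul, norm_smul, RCLike.norm_ofReal, abs_of_pos (inv_pos.2 hpos), inv_mul_eq_div]
    exact (ENNReal.ofReal_lt_ofReal_iff (by positivity)).1 hlt

/-- The Poincaré–Friedrichs infimum is attained. -/
theorem exists_unit_norm_eq_lamSet {𝕜 E F : Type*} [RCLike 𝕜]
    [NormedAddCommGroup E] [InnerProductSpace 𝕜 E]
    [NormedAddCommGroup F] [InnerProductSpace 𝕜 F] [CompleteSpace F]
    (T : E →ₗ.[𝕜] F) (hc : T.IsClosed) (K : Submodule 𝕜 E)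
    (hK : IsClosed (K : Set E)) (hcpt : CompactEmbed T K)
    (hne : ∃ x : T.domain, (x : E) ∈ K ∧ (x : E) ≠ 0) :
    ∃ x : T.domain, (x : E) ∈ K ∧ ‖(x : E)‖ = 1 ∧ ‖T x‖ = (lamSet T K).toReal := by
  set l := (lamSet T K).toReal with hl
  have hl0 : 0 ≤ l := ENNReal.toReal_nonneg
  choose x hxK hx1 hxT using fun n : ℕ =>
    exists_unit_norm_lt_lamSet_add T K hne (Nat.one_div_pos_of_nat (α := ℝ) (n := n))
  have hxl : ∀ n, l ≤ ‖T (x n)‖ := fun n => by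
    simpa [hx1] using lamSet_toReal_mul_norm_le T (V := K) (hxK n)
  have hlim : Tendsto (fun n => ‖T (x n)‖) atTop (𝓝 l) := by
    refine tendsto_of_tendsto_of_tendsto_of_le_of_le tendsto_const_nhds ?_ hxl
      fun n => (hxT n).le
    simpa using tendsto_const_nhds.add (tendsto_one_div_add_atTop_nhds_zero_nat (𝕜 := ℝ))
  obtain ⟨φ, hφ, x₀, hx₀⟩ := hcpt x hxK ⟨1 + (l + 1), fun n => by
    have : 1 / ((n : ℝ) + 1) ≤ 1 := by
      rw [div_le_one (by positivity)]
      linarith [n.cast_nonneg (α := ℝ)]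
    linarith [hx1 n, hxT n]⟩
  have hlimφ : Tendsto (fun n => ‖T (x (φ n))‖) atTop (𝓝 l) := hlim.comp hφ.tendsto_atTop
  have hpar : ∀ m n, ‖T (x (φ m)) - T (x (φ n))‖ ^ 2 ≤ 2 * ‖T (x (φ m))‖ ^ 2 +
      2 * ‖T (x (φ n))‖ ^ 2 - l ^ 2 * ‖(x (φ m) : E) + x (φ n)‖ ^ 2 := fun m n => by
    have h1 := lamSet_toReal_mul_norm_le T (V := K) (x := x (φ m) + x (φ n))
      (K.add_mem (hxK _) (hxK _))
    rw [T.map_add, Submodule.coe_add, ← hl] at h1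
    have h2 := pow_le_pow_left₀ (by positivity) h1 2
    have h3 := parallelogram_law_with_norm 𝕜 (T (x (φ m))) (T (x (φ n)))
    nlinarith
  have hnorm : ‖x₀‖ = 1 :=
    tendsto_nhds_unique hx₀.norm (by simp [hx1])
  have hzero : Tendsto (fun p : ℕ × ℕ => 2 * ‖T (x (φ p.1))‖ ^ 2 + 2 * ‖T (x (φ p.2))‖ ^ 2 -
      l ^ 2 * ‖(x (φ p.1) : E) + x (φ p.2)‖ ^ 2) atTop (𝓝 0) := by
    rw [← prod_atTop_atTop_eq]
    have h := ((((hlimφ.comp tendsto_fst).pow 2).const_mul 2).add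
      (((hlimφ.comp tendsto_snd).pow 2).const_mul 2)).sub
      ((((hx₀.comp tendsto_fst).add (hx₀.comp tendsto_snd)).norm.pow 2).const_mul (l ^ 2))
    have h0 : 2 * l ^ 2 + 2 * l ^ 2 - l ^ 2 * ‖x₀ + x₀‖ ^ 2 = 0 := by
      rw [← two_smul 𝕜 x₀, norm_smul, hnorm, RCLike.norm_ofNat]
      ring
    rw [h0] at h
    exact h
  have hcau : CauchySeq fun n => T (x (φ n)) := by
    rw [cauchySeq_iff_tendsto_dist_atTop_0]
    have h := (squeeze_zero (fun p : ℕ × ℕ => sq_nonneg _) (fun p => hpar p.1 p.2) hzero).sqrt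
    simpa [Real.sqrt_sq, dist_eq_norm] using h
  obtain ⟨y, hy⟩ := cauchySeq_tendsto_of_complete hcau
  have hgr : (x₀, y) ∈ T.graph :=
    IsClosed.mem_of_tendsto hc (hx₀.prodMk_nhds hy) (Eventually.of_forall fun n => T.mem_graph _)
  obtain ⟨u, hu1, hu2⟩ := T.mem_graph_iff.1 hgr
  simp only at hu1 hu2
  refine ⟨u, ?_, ?_, ?_⟩
  · rw [hu1]
    exact hK.mem_of_tendsto hx₀ (Eventually.of_forall fun n => hxK _)
  · rw [hu1, hnorm]
  · rw [hu2]
    exact tendsto_nhds_unique hy.norm hlimφ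

/-- The Euler–Lagrange equation of a minimizer of `‖T x‖ ^ 2 - l ^ 2 * ‖x‖ ^ 2`. -/
theorem inner_map_eq_of_norm_map_eq {𝕜 E F : Type*} [RCLike 𝕜]
    [NormedAddCommGroup E] [InnerProductSpace 𝕜 E]
    [NormedAddCommGroup F] [InnerProductSpace 𝕜 F]
    (T : E →ₗ.[𝕜] F) (K : Submodule 𝕜 E) {l : ℝ} (hl : 0 ≤ l)
    (hle : ∀ x : T.domain, (x : E) ∈ K → l * ‖(x : E)‖ ≤ ‖T x‖) {x : T.domain}
    (hxK : (x : E) ∈ K) (hx : ‖T x‖ = l * ‖(x : E)‖) {v : T.domain} (hv : (v : E) ∈ K) :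
    inner 𝕜 (T x) (T v) = ((l ^ 2 : ℝ) : 𝕜) * inner 𝕜 (x : E) (v : E) := by
  set b : 𝕜 := inner 𝕜 (T x) (T v) - ((l ^ 2 : ℝ) : 𝕜) * inner 𝕜 (x : E) (v : E) with hb
  set q : ℝ := ‖T v‖ ^ 2 - l ^ 2 * ‖(v : E)‖ ^ 2 with hq
  have hq0 : 0 ≤ q := by
    have := pow_le_pow_left₀ (by positivity) (hle v hv) 2
    nlinarith
  have hquad : ∀ s : 𝕜, 0 ≤ 2 * RCLike.re (s * b) + ‖s‖ ^ 2 * q := fun s => by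
    have h := pow_le_pow_left₀ (by positivity)
      (hle (x + s • v) (K.add_mem hxK (K.smul_mem s hv))) 2
    rw [T.map_add, T.map_smul, Submodule.coe_add, Submodule.coe_smul, mul_pow,
      norm_add_sq (𝕜 := 𝕜), norm_add_sq (𝕜 := 𝕜), inner_smul_right, inner_smul_right,
      norm_smul, norm_smul, hx] at h
    have hre : RCLike.re (s * b) = RCLike.re (s * inner 𝕜 (T x) (T v)) -
        l ^ 2 * RCLike.re (s * inner 𝕜 (x : E) (v : E)) := by
      rw [hb, mul_sub, map_sub, mul_left_comm, RCLike.re_ofReal_mul]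
    rw [hre, hq]
    nlinarith
  have h := hquad (((-(1 / (q + 1)) : ℝ) : 𝕜) * starRingEnd 𝕜 b)
  rw [mul_assoc, RCLike.re_ofReal_mul, RCLike.conj_mul, norm_mul, RCLike.norm_conj,
    RCLike.norm_ofReal, abs_neg, abs_of_pos (by positivity), ← RCLike.ofReal_pow,
    RCLike.ofReal_re] at h
  have h' : 2 * (-(1 / (q + 1)) * ‖b‖ ^ 2) + (1 / (q + 1) * ‖b‖) ^ 2 * q =
      -(‖b‖ ^ 2 * ((q + 2) / (q + 1) ^ 2)) := by
    field_simp
    ring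
  rw [h'] at h
  have hpos : 0 < (q + 2) / (q + 1) ^ 2 := by positivity
  have hb2 : ‖b‖ ^ 2 ≤ 0 := by
    by_contra! hlt
    linarith [mul_pos hlt hpos]
  have hb0 : ‖b‖ = 0 := by nlinarith [sq_nonneg ‖b‖]
  exact sub_eq_zero.1 (norm_eq_zero.1 hb0)

/-- If `D(𝒜) = D(T) ∩ closure (R(T*))` embeds compactly into `E` and is
nontrivial, then `λ_A²` is the smallest positive eigenvalue of `T*T`: there is a nonzero
`x ∈ D(T*T)` with `T*T x = λ_A² • x`, and every `μ > 0` admitting a nonzero solution of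
`T*T x = μ • x` satisfies `λ_A² ≤ μ`. -/
theorem lam_sq_smallest_positive_eigenvalue
    (T : E →ₗ.[𝕜] F) (hd : Dense (T.domain : Set E)) (hc : T.IsClosed)
    (hcpt : CompactEmbed T (closure (pRange T.adjoint)))
    (hne : ∃ x : T.domain, (x : E) ∈ closure (pRange T.adjoint) ∧ (x : E) ≠ 0) :
    (∃ x : T.domain, (x : E) ≠ 0 ∧ ∃ h : T x ∈ T.adjoint.domain,
      T.adjoint ⟨T x, h⟩ =
        (((lamSet T (closure (pRange T.adjoint))).toReal ^ 2 : ℝ) : 𝕜) • (x : E)) ∧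
    ∀ μ : ℝ, 0 < μ →
      (∃ x : T.domain, (x : E) ≠ 0 ∧ ∃ h : T x ∈ T.adjoint.domain,
        T.adjoint ⟨T x, h⟩ = ((μ : ℝ) : 𝕜) • (x : E)) →
      (lamSet T (closure (pRange T.adjoint))).toReal ^ 2 ≤ μ := by
  let K : Submodule 𝕜 E := (LinearMap.range T.adjoint.toFun).topologicalClosure
  have hKV : closure (pRange T.adjoint) = (K : Set E) := by
    rw [Submodule.topologicalClosure_coe]
    rfl
  have hKc : IsClosed (K : Set E) := Submodule.isClosed_topologicalClosure _
  have hrange : ∀ y : T.adjoint.domain, T.adjoint y ∈ K := fun y =>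
    Submodule.le_topologicalClosure _ ⟨y, rfl⟩
  rw [hKV] at hcpt hne ⊢
  set l := (lamSet T K).toReal with hl
  have hl0 : 0 ≤ l := ENNReal.toReal_nonneg
  constructor
  · obtain ⟨x, hxK, hx1, hxT⟩ := exists_unit_norm_eq_lamSet T hc K hKc hcpt hne
    have : CompleteSpace K := hKc.completeSpace_coe
    have key : ∀ v : T.domain,
        inner 𝕜 (((l ^ 2 : ℝ) : 𝕜) • (x : E)) (v : E) = inner 𝕜 (T x) (T v) := fun v => by
      have hperp : (v : E) - K.starProjection v ∈ Kᗮ := K.sub_starProjection_mem_orthogonal v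
      obtain ⟨u, hu, hTu⟩ := exists_domain_eq_zero_of_orthogonal_range_adjoint T hd hc
        fun y => (K.mem_orthogonal _).1 hperp _ (hrange y)
      have hvu : ((v - u : T.domain) : E) ∈ K := by
        rw [Submodule.coe_sub, hu, sub_sub_cancel]
        exact K.starProjection_apply_mem v
      have hxu : inner 𝕜 (x : E) (u : E) = 0 := by
        rw [hu]
        exact (K.mem_orthogonal _).1 hperp _ hxK
      have h := inner_map_eq_of_norm_map_eq T K hl0
        (fun x hx => lamSet_toReal_mul_norm_le T (V := K) hx) hxK (by rw [hxT, hx1, mul_one]) hvu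
      rw [T.map_sub, hTu, sub_zero, Submodule.coe_sub, inner_sub_right, hxu, sub_zero] at h
      rw [h, inner_smul_left, RCLike.conj_ofReal]
    have hmem : T x ∈ T.adjoint.domain := T.mem_adjoint_domain_of_exists _ ⟨_, key⟩
    exact ⟨x, norm_ne_zero_iff.1 (by simp [hx1]), hmem, LinearPMap.adjoint_apply_eq hd _ key⟩
  · rintro μ hμ ⟨x, hx0, hmem, hx⟩
    have hμ0 : ((μ : ℝ) : 𝕜) ≠ 0 := RCLike.ofReal_ne_zero.2 hμ.ne'
    have hxK : (x : E) ∈ K := by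
      rw [← inv_smul_smul₀ hμ0 (x : E), ← hx]
      exact K.smul_mem _ (hrange _)
    have hle := pow_le_pow_left₀ (by positivity) (lamSet_toReal_mul_norm_le T (V := K) hxK) 2
    have hform : inner 𝕜 (T.adjoint ⟨T x, hmem⟩) (x : E) = inner 𝕜 (T x) (T x) :=
      T.adjoint_isFormalAdjoint hd ⟨T x, hmem⟩ x
    rw [hx, inner_smul_left, RCLike.conj_ofReal, inner_self_eq_norm_sq_to_K,
      inner_self_eq_norm_sq_to_K] at hform
    have hnorm : μ * ‖(x : E)‖ ^ 2 = ‖T x‖ ^ 2 := by exact_mod_cast hform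
    rw [← hnorm, mul_pow] at hle
    exact le_of_mul_le_mul_right hle (pow_pos (norm_pos_iff.2 hx0) 2)
end

section
/- Let A : D(A) ⊆ H₀ → H₁ be a densely defined closed linear operator between Hilbert spaces. Assume the embedding D(𝒜) ↪ H₀ is compact and D(𝒜) ≠ {0}. Then for every z ∈ R(A*) there exists a unique x ∈ D(A*A) ∩ closure(R(A*)) with A*Ax = z, and the operator norm of this solution map equals c_A²: sup{ ‖x‖_{H₀}/‖z‖_{H₀} : 0 ≠ z ∈ R(A*), x the corresponding solution } = c_A², where c_A = 1/λ_A. -/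
open Filter Topology
open scoped ENNReal

variable {𝕜 E F : Type*} [RCLike 𝕜]
  [NormedAddCommGroup E] [InnerProductSpace 𝕜 E] [CompleteSpace E]
  [NormedAddCommGroup F] [InnerProductSpace 𝕜 F] [CompleteSpace F]

namespace LinearPMap

open scoped InnerProductSpace

omit [CompleteSpace E] [CompleteSpace F] in
theorem mem_closure_pRange_iff {T : E →ₗ.[𝕜] F} {y : F} :
    y ∈ _root_.closure (pRange T) ↔ y ∈ (LinearMap.range T.toFun).topologicalClosure := by
  rw [← SetLike.mem_coe, Submodule.topologicalClosure_coe]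
  rfl

/-- A closed densely defined operator vanishes on the orthogonal complement of the range of its
adjoint. -/
theorem mem_graph_zero_of_orthogonal_range_adjoint {T : E →ₗ.[𝕜] F}
    (hd : Dense (T.domain : Set E)) (hc : T.IsClosed) {n : E}
    (hn : ∀ y : T.adjoint.domain, ⟪T.adjoint y, n⟫_𝕜 = 0) : (n, (0 : F)) ∈ T.graph := by
  let G : Submodule 𝕜 (WithLp 2 (E × F)) :=
    T.graph.comap (WithLp.linearEquiv 2 𝕜 (E × F)).toLinearMap
  have hG : _root_.IsClosed (G : Set (WithLp 2 (E × F))) :=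
    hc.preimage (WithLp.prod_continuous_ofLp 2 E F)
  have : CompleteSpace G := hG.completeSpace_coe
  suffices h : WithLp.toLp 2 (n, (0 : F)) ∈ Gᗮᗮ by
    rw [Submodule.orthogonal_orthogonal] at h
    exact h
  rw [Submodule.mem_orthogonal]
  intro u hu
  have key : ∀ x : T.domain, ⟪-u.fst, (x : E)⟫_𝕜 = ⟪u.snd, T x⟫_𝕜 := by
    intro x
    have := (Submodule.mem_orthogonal' G u).1 hu (WithLp.toLp 2 ((x : E), T x)) (T.mem_graph x)
    simp only [WithLp.prod_inner_apply] at this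
    rw [inner_neg_left]
    exact neg_eq_of_add_eq_zero_right this
  have hmem : u.snd ∈ T.adjoint.domain := mem_adjoint_domain_of_exists _ ⟨_, key⟩
  have h0 := hn ⟨u.snd, hmem⟩
  rw [adjoint_apply_eq hd ⟨u.snd, hmem⟩ key, inner_neg_left, neg_eq_zero] at h0
  simpa [WithLp.prod_inner_apply] using h0

theorem exists_apply_eq_mem_closure_range_adjoint {T : E →ₗ.[𝕜] F}
    (hd : Dense (T.domain : Set E)) (hc : T.IsClosed) (x : T.domain) :
    ∃ x' : T.domain, (x' : E) ∈ (LinearMap.range T.adjoint.toFun).topologicalClosure ∧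
      T x' = T x := by
  set V := (LinearMap.range T.adjoint.toFun).topologicalClosure
  have : CompleteSpace V := (Submodule.isClosed_topologicalClosure _).completeSpace_coe
  obtain ⟨v, hv, n, hn, hx⟩ := V.exists_add_mem_mem_orthogonal (x : E)
  have hng : (n, (0 : F)) ∈ T.graph :=
    mem_graph_zero_of_orthogonal_range_adjoint hd hc fun y =>
      (V.mem_orthogonal n).1 hn _
        ((LinearMap.range T.adjoint.toFun).le_topologicalClosure ⟨y, rfl⟩)
  have hvg := T.graph.sub_mem (T.mem_graph x) hng
  have hvx : ((x : E), T x) - (n, (0 : F)) = (v, T x) := by simp [hx]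
  rw [hvx, mem_graph_iff] at hvg
  obtain ⟨w, hw, hwx⟩ := hvg
  exact ⟨w, by simpa [hw] using hv, hwx⟩

omit [CompleteSpace F] in
theorem eq_zero_of_mem_closure_range_adjoint {T : E →ₗ.[𝕜] F}
    (hd : Dense (T.domain : Set E)) {x : T.domain}
    (hx : (x : E) ∈ (LinearMap.range T.adjoint.toFun).topologicalClosure) (h : T x = 0) :
    (x : E) = 0 := by
  have hle : (LinearMap.range T.adjoint.toFun).topologicalClosure ≤ (𝕜 ∙ (x : E))ᗮ := by
    refine Submodule.topologicalClosure_minimal _ ?_ (Submodule.isClosed_orthogonal _)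
    rintro _ ⟨y, rfl⟩
    rw [Submodule.mem_orthogonal_singleton_iff_inner_left]
    exact (adjoint_isFormalAdjoint hd y x).trans (by rw [h, inner_zero_right])
  exact inner_self_eq_zero.1 (Submodule.mem_orthogonal_singleton_iff_inner_left.1 (hle hx))

omit [CompleteSpace F] in
/-- A closed operator that is bounded below on a subspace of its domain which already exhausts its
range has closed range. -/
theorem isClosed_range_of_bound {S : E →ₗ.[𝕜] F} (hS : S.IsClosed) (W : Submodule 𝕜 E)
    (hW : ∀ x : S.domain, ∃ x' : S.domain, (x' : E) ∈ W ∧ S x' = S x) {c : ℝ}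
    (hc : ∀ x : S.domain, (x : E) ∈ W → ‖(x : E)‖ ≤ c * ‖S x‖) :
    _root_.IsClosed (LinearMap.range S.toFun : Set F) := by
  refine IsSeqClosed.isClosed fun y l hy hl => ?_
  have hex : ∀ n, ∃ x : S.domain, (x : E) ∈ W ∧ S x = y n := by
    intro n
    obtain ⟨x, hx⟩ := hy n
    obtain ⟨x', h1, h2⟩ := hW x
    exact ⟨x', h1, h2.trans hx⟩
  choose x hxW hxy using hex
  have hcau : CauchySeq fun n => (x n : E) := by
    have hlip : ∀ m n, dist (x m : E) (x n) ≤ (|c| + 1) * dist (y m) (y n) := by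
      intro m n
      have h := hc (x m - x n) (W.sub_mem (hxW m) (hxW n))
      rw [map_sub, hxy, hxy] at h
      rw [dist_eq_norm, dist_eq_norm]
      refine h.trans (mul_le_mul_of_nonneg_right ?_ (norm_nonneg _))
      linarith [le_abs_self c]
    have hpos : 0 < |c| + 1 := by positivity
    rw [Metric.cauchySeq_iff]
    intro ε hε
    obtain ⟨N, hN⟩ := Metric.cauchySeq_iff.1 hl.cauchySeq (ε / (|c| + 1)) (by positivity)
    refine ⟨N, fun m hm n hn => (hlip m n).trans_lt ?_⟩
    have := hN m hm n hn
    rwa [lt_div_iff₀' hpos] at this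
  obtain ⟨u, hu⟩ := cauchySeq_tendsto_of_complete hcau
  have hg : (u, l) ∈ S.graph := by
    refine hS.mem_of_tendsto (hu.prodMk_nhds hl) (Eventually.of_forall fun n => ?_)
    rw [← hxy]
    exact S.mem_graph (x n)
  obtain ⟨w, -, hw⟩ := S.mem_graph_iff.1 hg
  exact ⟨w, hw⟩

omit [CompleteSpace F] in
/-- The Poincaré–Friedrichs inequality: a compact embedding makes `T` bounded below on
`D(T) ∩ closure (R(T*))`. -/
theorem exists_norm_le_mul_of_compactEmbed {T : E →ₗ.[𝕜] F}
    (hd : Dense (T.domain : Set E)) (hc : T.IsClosed)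
    (hcpt : CompactEmbed T (_root_.closure (pRange T.adjoint))) :
    ∃ c : ℝ, ∀ x : T.domain,
      (x : E) ∈ (LinearMap.range T.adjoint.toFun).topologicalClosure → ‖(x : E)‖ ≤ c * ‖T x‖ := by
  set V := (LinearMap.range T.adjoint.toFun).topologicalClosure
  by_contra! hcon
  choose x hxV hx using fun n : ℕ => hcon ((n : ℝ) + 1)
  have hpos : ∀ n, 0 < ‖(x n : E)‖ := fun n => lt_of_le_of_lt (by positivity) (hx n)
  let u : ℕ → T.domain := fun n => ((‖(x n : E)‖⁻¹ : ℝ) : 𝕜) • x n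
  have huV : ∀ n, (u n : E) ∈ V := fun n => V.smul_mem _ (hxV n)
  have hu1 : ∀ n, ‖(u n : E)‖ = 1 := by
    intro n
    have := (hpos n).ne'
    simp only [u, Submodule.coe_smul, norm_smul, RCLike.norm_ofReal, abs_inv, abs_norm]
    field_simp
  have huT : ∀ n : ℕ, ‖T (u n)‖ ≤ 1 / ((n : ℝ) + 1) := by
    intro n
    have h1 : ‖T (u n)‖ = ‖(x n : E)‖⁻¹ * ‖T (x n)‖ := by
      simp only [u, map_smul, norm_smul, RCLike.norm_ofReal, abs_inv, abs_norm]
    have h2 : (0 : ℝ) < n + 1 := by positivity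
    rw [h1, inv_mul_eq_div, div_le_div_iff₀ (hpos n) h2, one_mul, mul_comm]
    exact (hx n).le
  obtain ⟨φ, hφ, l, hl⟩ := hcpt u (fun n => mem_closure_pRange_iff.2 (huV n)) ⟨2, fun n => by
    have : 1 / ((n : ℝ) + 1) ≤ 1 := by
      rw [div_le_one (by positivity)]
      linarith [n.cast_nonneg (α := ℝ)]
    linarith [hu1 n, huT n]⟩
  have hT0 : Tendsto (fun k => T (u (φ k))) atTop (𝓝 0) :=
    (squeeze_zero_norm huT tendsto_one_div_add_atTop_nhds_zero_nat).comp hφ.tendsto_atTop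
  have hg : (l, (0 : F)) ∈ T.graph :=
    hc.mem_of_tendsto (hl.prodMk_nhds hT0) (Eventually.of_forall fun k => T.mem_graph _)
  have hlV : l ∈ V := (Submodule.isClosed_topologicalClosure _).mem_of_tendsto hl
    (Eventually.of_forall fun k => huV _)
  obtain ⟨w, rfl, hw⟩ := T.mem_graph_iff.1 hg
  have hl0 := eq_zero_of_mem_closure_range_adjoint hd hlV hw
  have hl1 := tendsto_nhds_unique hl.norm (by simp only [hu1]; exact tendsto_const_nhds)
  rw [hl0, norm_zero] at hl1
  exact zero_ne_one hl1

/-- If `R(T)` is closed, then every `y ∈ D(T*)` agrees with an element of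
`R(T) ∩ D(T*)` modulo the kernel of `T*`. -/
theorem exists_adjoint_apply_eq_mem_range {T : E →ₗ.[𝕜] F} (hd : Dense (T.domain : Set E))
    (hR : _root_.IsClosed (LinearMap.range T.toFun : Set F)) (y : T.adjoint.domain) :
    ∃ y' : T.adjoint.domain, (y' : F) ∈ LinearMap.range T.toFun ∧
      T.adjoint y' = T.adjoint y := by
  have : CompleteSpace (LinearMap.range T.toFun) := hR.completeSpace_coe
  obtain ⟨v, hv, n, hn, hy⟩ := (LinearMap.range T.toFun).exists_add_mem_mem_orthogonal (y : F)
  have key : ∀ x : T.domain, ⟪T.adjoint y, (x : E)⟫_𝕜 = ⟪v, T x⟫_𝕜 := by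
    intro x
    have h0 : ⟪n, T x⟫_𝕜 = 0 := (Submodule.mem_orthogonal' _ n).1 hn _ ⟨x, rfl⟩
    rw [adjoint_isFormalAdjoint hd y x, hy, inner_add_left, h0, add_zero]
  have hmem : v ∈ T.adjoint.domain := mem_adjoint_domain_of_exists _ ⟨_, key⟩
  exact ⟨⟨v, hmem⟩, hv, adjoint_apply_eq hd _ key⟩

theorem exists_adjoint_comp_eq {T : E →ₗ.[𝕜] F} (hd : Dense (T.domain : Set E))
    (hc : T.IsClosed) (hR : _root_.IsClosed (LinearMap.range T.toFun : Set F))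
    {z : E} (hz : z ∈ LinearMap.range T.adjoint.toFun) :
    ∃ x : T.domain, (x : E) ∈ (LinearMap.range T.adjoint.toFun).topologicalClosure ∧
      ∃ h : T x ∈ T.adjoint.domain, T.adjoint ⟨T x, h⟩ = z := by
  obtain ⟨y, rfl⟩ := hz
  obtain ⟨⟨_, hmem⟩, ⟨x, rfl⟩, hy⟩ := exists_adjoint_apply_eq_mem_range hd hR y
  obtain ⟨x', hx', hxx⟩ := exists_apply_eq_mem_closure_range_adjoint hd hc x
  have heq : T x' = T.toFun x := hxx
  refine ⟨x', hx', heq ▸ hmem, ?_⟩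
  simp only [heq]
  exact hy

omit [CompleteSpace F] in
theorem inner_eq_inner_of_adjoint_comp_eq {T : E →ₗ.[𝕜] F} (hd : Dense (T.domain : Set E))
    {x : T.domain} {z : E} (h : T x ∈ T.adjoint.domain) (hz : T.adjoint ⟨T x, h⟩ = z)
    (w : T.domain) : ⟪z, (w : E)⟫_𝕜 = ⟪T x, T w⟫_𝕜 := by
  rw [← hz]
  exact adjoint_isFormalAdjoint hd ⟨T x, h⟩ w

omit [CompleteSpace F] in
theorem norm_sq_le_of_adjoint_comp_eq {T : E →ₗ.[𝕜] F} (hd : Dense (T.domain : Set E))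
    {x : T.domain} {z : E} (h : T x ∈ T.adjoint.domain) (hz : T.adjoint ⟨T x, h⟩ = z) :
    ‖T x‖ ^ 2 ≤ ‖z‖ * ‖(x : E)‖ := by
  have h1 := norm_inner_le_norm (𝕜 := 𝕜) z (x : E)
  rwa [inner_eq_inner_of_adjoint_comp_eq hd h hz, inner_self_eq_norm_sq_to_K, norm_pow,
    RCLike.norm_ofReal, abs_norm] at h1

/-- If `T` is bounded below on `D(T) ∩ closure (R(T*))`, then `T*` has closed range. -/
theorem isClosed_range_adjoint_of_bound {T : E →ₗ.[𝕜] F} (hd : Dense (T.domain : Set E))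
    (hc : T.IsClosed) (hR : _root_.IsClosed (LinearMap.range T.toFun : Set F)) {c : ℝ}
    (hb : ∀ x : T.domain, (x : E) ∈ (LinearMap.range T.adjoint.toFun).topologicalClosure →
      ‖(x : E)‖ ≤ c * ‖T x‖) :
    _root_.IsClosed (LinearMap.range T.adjoint.toFun : Set E) := by
  refine isClosed_range_of_bound (adjoint_isClosed hd) (LinearMap.range T.toFun)
    (exists_adjoint_apply_eq_mem_range hd hR) (c := c) ?_
  rintro ⟨_, hmem⟩ ⟨x, rfl⟩
  obtain ⟨x', hx', hxx⟩ := exists_apply_eq_mem_closure_range_adjoint hd hc x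
  have heq : T.toFun x = T x' := hxx.symm
  simp only [heq] at hmem ⊢
  have h1 := norm_sq_le_of_adjoint_comp_eq hd hmem rfl
  have h2 := hb x' hx'
  rcases (norm_nonneg (T x')).eq_or_lt with h0 | h0
  · have h3 : T x' = 0 := norm_eq_zero.1 h0.symm
    have h4 : (⟨T x', hmem⟩ : T.adjoint.domain) = 0 := Subtype.ext h3
    rw [h4, map_zero, h3]
    simp
  · have h3 := mul_le_mul_of_nonneg_left h2 (norm_nonneg (T.adjoint ⟨T x', hmem⟩))
    nlinarith

end LinearPMap

/-- If `D(𝒜) = D(T) ∩ closure (R(T*))` embeds compactly into `E` and is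
nontrivial, then for every `z ∈ R(T*)` there is a unique `x ∈ D(T*T) ∩ closure (R(T*))`
with `T*T x = z`, and the operator norm of the solution map `z ↦ x` equals `c_A²`,
where `c_A = 1/λ_A`. -/
theorem inverse_of_adjoint_comp_norm_eq_sq
    (T : E →ₗ.[𝕜] F) (hd : Dense (T.domain : Set E)) (hc : T.IsClosed)
    (hcpt : CompactEmbed T (closure (pRange T.adjoint)))
    (hne : ∃ x : T.domain, (x : E) ∈ closure (pRange T.adjoint) ∧ (x : E) ≠ 0) :
    (∀ z ∈ pRange T.adjoint,
      ∃! x : {x : T.domain // (x : E) ∈ closure (pRange T.adjoint)},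
        ∃ h : T x.1 ∈ T.adjoint.domain, T.adjoint ⟨T x.1, h⟩ = z) ∧
    (⨆ p : {p : T.domain × E // ((p.1 : E)) ∈ closure (pRange T.adjoint) ∧
        p.2 ∈ pRange T.adjoint ∧ p.2 ≠ 0 ∧
        ∃ h : T p.1 ∈ T.adjoint.domain, T.adjoint ⟨T p.1, h⟩ = p.2},
      ENNReal.ofReal (‖(p.1.1 : E)‖ / ‖p.1.2‖)) =
      ((lamSet T (closure (pRange T.adjoint)))⁻¹) ^ 2 := by
  have hmemV : ∀ x : E, x ∈ closure (pRange T.adjoint) ↔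
      x ∈ (LinearMap.range T.adjoint.toFun).topologicalClosure :=
    fun x => LinearPMap.mem_closure_pRange_iff
  obtain ⟨c, hb⟩ := LinearPMap.exists_norm_le_mul_of_compactEmbed hd hc hcpt
  have hR := LinearPMap.isClosed_range_of_bound hc _
    (LinearPMap.exists_apply_eq_mem_closure_range_adjoint hd hc) hb
  have hR' := LinearPMap.isClosed_range_adjoint_of_bound hd hc hR hb
  have hinj : ∀ x : T.domain, (x : E) ∈ closure (pRange T.adjoint) → (x : E) ≠ 0 →
      0 < ‖T x‖ := fun x hx hx0 => norm_pos_iff.2 fun h0 =>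
    hx0 (LinearPMap.eq_zero_of_mem_closure_range_adjoint hd ((hmemV _).1 hx) h0)
  refine ⟨fun z hz => ?_, le_antisymm (iSup_le ?_) ?_⟩
  · obtain ⟨x, hx, h, hxz⟩ := LinearPMap.exists_adjoint_comp_eq hd hc hR hz
    refine ⟨⟨x, (hmemV _).2 hx⟩, ⟨h, hxz⟩, ?_⟩
    rintro ⟨x', hx'⟩ ⟨h', hxz'⟩
    have hsub : T (x' - x) ∈ T.adjoint.domain := by
      rw [LinearPMap.map_sub]
      exact Submodule.sub_mem _ h' h
    have hz0 : T.adjoint ⟨T (x' - x), hsub⟩ = 0 := by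
      have : (⟨T (x' - x), hsub⟩ : T.adjoint.domain) = ⟨T x', h'⟩ - ⟨T x, h⟩ :=
        Subtype.ext (T.map_sub x' x)
      rw [this, LinearPMap.map_sub, hxz', hxz, sub_self]
    have hn := LinearPMap.norm_sq_le_of_adjoint_comp_eq hd hsub hz0
    rw [norm_zero, zero_mul] at hn
    have hT0 : T (x' - x) = 0 :=
      norm_eq_zero.1 (pow_eq_zero_iff two_ne_zero |>.1 (le_antisymm hn (sq_nonneg _)))
    have h0 := LinearPMap.eq_zero_of_mem_closure_range_adjoint hd (x := x' - x)
      (Submodule.sub_mem _ ((hmemV _).1 hx') hx) hT0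
    exact Subtype.ext (Subtype.ext (sub_eq_zero.1 h0))
  · rintro ⟨⟨x, z⟩, hx, -, hz0, h, hxz⟩
    dsimp only at hx hz0 h hxz ⊢
    have hx0 : (x : E) ≠ 0 := by
      intro hx0
      have h1 : x = 0 := Subtype.ext hx0
      subst h1
      apply hz0
      have h2 : (⟨T 0, h⟩ : T.adjoint.domain) = 0 := Subtype.ext (T.map_zero)
      rw [← hxz, h2, LinearPMap.map_zero]
    have hTx := hinj x hx hx0
    have hxp : 0 < ‖(x : E)‖ := norm_pos_iff.2 hx0
    have hzp : 0 < ‖z‖ := norm_pos_iff.2 hz0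
    have hlam : lamSet T (closure (pRange T.adjoint)) ≤ ENNReal.ofReal (‖T x‖ / ‖(x : E)‖) :=
      iInf_le_of_le ⟨x, hx0, hx⟩ le_rfl
    calc ENNReal.ofReal (‖(x : E)‖ / ‖z‖)
        ≤ ENNReal.ofReal ((‖T x‖ / ‖(x : E)‖)⁻¹ ^ 2) := by
          apply ENNReal.ofReal_le_ofReal
          have := LinearPMap.norm_sq_le_of_adjoint_comp_eq hd h hxz
          rw [inv_div, div_pow, div_le_div_iff₀ hzp (by positivity)]
          nlinarith
      _ = (ENNReal.ofReal (‖T x‖ / ‖(x : E)‖))⁻¹ ^ 2 := by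
          rw [ENNReal.ofReal_pow (by positivity), ENNReal.ofReal_inv_of_pos (by positivity)]
      _ ≤ _ := by gcongr
  · rw [lamSet, ENNReal.inv_iInf, ENNReal.iSup_pow_of_ne_zero two_ne_zero]
    refine iSup_le ?_
    rintro ⟨x, hx0, hx⟩
    have hTx := hinj x hx hx0
    have hxp : 0 < ‖(x : E)‖ := norm_pos_iff.2 hx0
    have hxR : (x : E) ∈ LinearMap.range T.adjoint.toFun := by
      have := (hmemV _).1 hx
      rwa [hR'.submodule_topologicalClosure_eq] at this
    obtain ⟨u, hu, h, hux⟩ := LinearPMap.exists_adjoint_comp_eq hd hc hR hxR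
    refine le_trans ?_ (le_iSup _ ⟨(u, (x : E)), (hmemV _).2 hu, hxR, hx0, h, hux⟩)
    dsimp only
    rw [← ENNReal.ofReal_inv_of_pos (by positivity), ← ENNReal.ofReal_pow (by positivity)]
    apply ENNReal.ofReal_le_ofReal
    have h1 : ‖(x : E)‖ ^ 2 ≤ ‖T u‖ * ‖T x‖ := by
      have := norm_inner_le_norm (𝕜 := 𝕜) (T u) (T x)
      rwa [← LinearPMap.inner_eq_inner_of_adjoint_comp_eq hd h hux, inner_self_eq_norm_sq_to_K,
        norm_pow, RCLike.norm_ofReal, abs_norm] at this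
    have h2 := LinearPMap.norm_sq_le_of_adjoint_comp_eq hd h hux
    rw [inv_div, div_pow, div_le_div_iff₀ (by positivity) hxp]
    have h3 : (‖(x : E)‖ ^ 2) ^ 2 ≤ (‖T u‖ * ‖T x‖) ^ 2 := by gcongr
    have h4 : ‖T u‖ ^ 2 * ‖T x‖ ^ 2 ≤ ‖(x : E)‖ * ‖(u : E)‖ * ‖T x‖ ^ 2 := by gcongr
    refine le_of_mul_le_mul_left ?_ hxp
    nlinarith
end

section
/- Let A : D(A) ⊆ H₀ → H₁ be a densely defined closed linear operator between Hilbert spaces. If R(A) is closed, then R(AA*) = R(A) and R(A*A) = R(A*). -/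
open Filter Topology

variable {𝕜 E F : Type*} [RCLike 𝕜]
  [NormedAddCommGroup E] [InnerProductSpace 𝕜 E] [CompleteSpace E]
  [NormedAddCommGroup F] [InnerProductSpace 𝕜 F] [CompleteSpace F]

/-- A continuous functional vanishing on the kernel of a continuous surjection between Banach
spaces factors continuously through it. -/
theorem ContinuousLinearMap.exists_comp_eq_of_surjective {V W : Type*}
    [NormedAddCommGroup V] [NormedSpace 𝕜 V] [CompleteSpace V]
    [NormedAddCommGroup W] [NormedSpace 𝕜 W] [CompleteSpace W]
    (f : V →L[𝕜] W) (hf : Function.Surjective f) (l : V →L[𝕜] 𝕜)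
    (hl : ∀ v, f v = 0 → l v = 0) : ∃ g : W →L[𝕜] 𝕜, ∀ v, g (f v) = l v := by
  obtain ⟨s, hs⟩ := f.toLinearMap.exists_rightInverse_of_surjective (LinearMap.range_eq_top.2 hf)
  have hs' : ∀ w, f (s w) = w := fun w => LinearMap.congr_fun hs w
  have hls : ∀ v, l (s (f v)) = l v := fun v => by
    rw [← sub_eq_zero, ← map_sub l]
    exact hl _ (by rw [map_sub, hs', sub_self])
  obtain ⟨C, -, hC⟩ := f.exists_preimage_norm_le hf
  refine ⟨(l.toLinearMap ∘ₗ s).mkContinuous (‖l‖ * C) fun w => ?_, hls⟩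
  obtain ⟨v, rfl, hv⟩ := hC w
  calc ‖l (s (f v))‖ = ‖l v‖ := by rw [hls]
    _ ≤ ‖l‖ * ‖v‖ := l.le_opNorm v
    _ ≤ ‖l‖ * C * ‖f v‖ := by
      rw [mul_assoc]
      exact mul_le_mul_of_nonneg_left hv (norm_nonneg l)

namespace LinearPMap

/-- For a closed operator with closed range, every vector orthogonal to the kernel represents a
functional of the form `v ↦ ⟪y, T v⟫`. -/
theorem exists_inner_eq_of_orthogonal_ker (T : E →ₗ.[𝕜] F) (hc : T.IsClosed)
    (hR : _root_.IsClosed (pRange T)) (x : E)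
    (hx : ∀ v : T.domain, T v = 0 → inner 𝕜 x (v : E) = 0) :
    ∃ y : F, ∀ v : T.domain, inner 𝕜 x (v : E) = inner 𝕜 y (T v) := by
  let R : Submodule 𝕜 F := LinearMap.range T.toFun
  have hRc : _root_.IsClosed (R : Set F) := hR
  have : CompleteSpace R := hRc.completeSpace_coe
  have : CompleteSpace T.graph := IsClosed.completeSpace_coe (hs := hc)
  have hmem : ∀ p : T.graph, (p : E × F).2 ∈ R := fun p => by
    obtain ⟨v, -, hv⟩ := (mem_graph_iff T).1 p.2
    exact ⟨v, hv⟩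
  let f : T.graph →L[𝕜] R :=
    ((ContinuousLinearMap.snd 𝕜 E F).comp T.graph.subtypeL).codRestrict R hmem
  have hf : Function.Surjective f := by
    rintro ⟨_, v, rfl⟩
    exact ⟨⟨_, T.mem_graph v⟩, rfl⟩
  obtain ⟨g, hg⟩ := f.exists_comp_eq_of_surjective hf
    ((innerSL 𝕜 x).comp ((ContinuousLinearMap.fst 𝕜 E F).comp T.graph.subtypeL)) (by
      rintro ⟨⟨a, b⟩, hp⟩ h0
      obtain ⟨v, hv, hv'⟩ := (mem_graph_iff T).1 hp
      have hb : b = 0 := congrArg Subtype.val h0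
      have h := hx v (hv'.trans hb)
      rw [hv] at h
      exact h)
  refine ⟨((InnerProductSpace.toDual 𝕜 R).symm g : R), fun v => ?_⟩
  have h1 := hg ⟨_, T.mem_graph v⟩
  have h2 : inner 𝕜 ((InnerProductSpace.toDual 𝕜 R).symm g) (f ⟨_, T.mem_graph v⟩) =
    g (f ⟨_, T.mem_graph v⟩) := InnerProductSpace.toDual_symm_apply
  exact (h2.trans h1).symm

omit [CompleteSpace F] in
/-- Every value of a closed operator is attained at a vector orthogonal to the kernel. -/
theorem IsClosed.exists_apply_eq_orthogonal_ker {T : E →ₗ.[𝕜] F} (hc : T.IsClosed)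
    (x : T.domain) :
    ∃ u : T.domain, T u = T x ∧ ∀ v : T.domain, T v = 0 → inner 𝕜 (u : E) (v : E) = 0 := by
  let N : Submodule 𝕜 E := T.graph.comap (LinearMap.inl 𝕜 E F)
  have hN : _root_.IsClosed (N : Set E) :=
    _root_.IsClosed.preimage (f := fun a : E => (a, (0 : F))) (by fun_prop) hc
  have : CompleteSpace N := hN.completeSpace_coe
  obtain ⟨n, hn, hn0⟩ := (mem_graph_iff T).1 (N.starProjection_apply_mem (x : E))
  refine ⟨x - n, by rw [T.map_sub, hn0]; simp, fun v hv => ?_⟩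
  have hvN : (v : E) ∈ N := (mem_graph_iff T).2 ⟨v, rfl, hv⟩
  have h := N.sub_starProjection_mem_orthogonal (x : E)
  have := N.inner_left_of_mem_orthogonal hvN h
  rw [Submodule.coe_sub, hn]
  exact this

omit [CompleteSpace F] in
/-- A vector representing `v ↦ ⟪y, T v⟫` identifies `T† y`. -/
theorem exists_adjoint_apply_eq {T : E →ₗ.[𝕜] F} (hd : Dense (T.domain : Set E)) {x : E} {y : F}
    (h : ∀ v : T.domain, inner 𝕜 x (v : E) = inner 𝕜 y (T v)) :
    ∃ hy : y ∈ T.adjoint.domain, T.adjoint ⟨y, hy⟩ = x :=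
  ⟨mem_adjoint_domain_of_exists y ⟨x, h⟩, adjoint_apply_eq hd _ h⟩

end LinearPMap

/-- If `T` is densely defined, closed and `R(T)` is closed, then
`R(TT*) = R(T)` and `R(T*T) = R(T*)`. -/
theorem range_comp_eq_range_of_closed_range
    (T : E →ₗ.[𝕜] F) (hd : Dense (T.domain : Set E)) (hc : T.IsClosed)
    (hR : IsClosed (pRange T)) :
    {w : F | ∃ y : T.adjoint.domain, ∃ h : T.adjoint y ∈ T.domain,
      T ⟨T.adjoint y, h⟩ = w} = pRange T ∧
    {z : E | ∃ x : T.domain, ∃ h : T x ∈ T.adjoint.domain,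
      T.adjoint ⟨T x, h⟩ = z} = pRange T.adjoint := by
  constructor
  · ext w
    constructor
    · rintro ⟨y, h, rfl⟩
      exact ⟨_, rfl⟩
    · rintro ⟨x, rfl⟩
      obtain ⟨u, hu, hu0⟩ := hc.exists_apply_eq_orthogonal_ker x
      obtain ⟨y, hy⟩ := T.exists_inner_eq_of_orthogonal_ker hc hR u hu0
      obtain ⟨hyd, hyu⟩ := LinearPMap.exists_adjoint_apply_eq hd hy
      have hmem : T.adjoint ⟨y, hyd⟩ ∈ T.domain := hyu ▸ u.2
      refine ⟨⟨y, hyd⟩, hmem, Eq.trans ?_ hu⟩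
      congr 1
      exact Subtype.ext hyu
  · ext z
    constructor
    · rintro ⟨x, h, rfl⟩
      exact ⟨_, rfl⟩
    · rintro ⟨y, rfl⟩
      let R : Submodule 𝕜 F := LinearMap.range T.toFun
      have hRc : IsClosed (R : Set F) := hR
      have : CompleteSpace R := hRc.completeSpace_coe
      obtain ⟨x, hx⟩ := R.starProjection_apply_mem (y : F)
      have hx' : T x = R.starProjection (y : F) := hx
      obtain ⟨hxd, hxy⟩ := LinearPMap.exists_adjoint_apply_eq hd (x := T.adjoint y) (y := T x)
        fun v => by
          have h := R.inner_left_of_mem_orthogonal (⟨v, rfl⟩ : T v ∈ R)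
            (R.sub_starProjection_mem_orthogonal (y : F))
          rw [inner_sub_left, sub_eq_zero] at h
          rw [LinearPMap.adjoint_isFormalAdjoint hd y v, hx', h]
      exact ⟨x, hxd, hxy⟩
end

section
/- Let A₀ : D(A₀) ⊆ H₀ → H₁ and A₁ : D(A₁) ⊆ H₁ → H₂ be densely defined closed linear operators satisfying the complex property R(A₀) ⊆ N(A₁). Then the embedding D(A₁) ∩ D(A₀*) ↪ H₁ is compact if and only if all three of the following hold: the embedding D(𝒜₀) ↪ H₀ is compact, the embedding D(𝒜₁) ↪ H₁ is compact, and the cohomology group N₀,₁ is finite-dimensional. In this case N₀,₁ has finite dimension. -/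
open Filter Topology

/-- Compactness of the embedding `D(T) ∩ D(S) ↪ H₁` for two partially defined operators
`T : H₁ →ₗ.[𝕜] H₂` and `S : H₁ →ₗ.[𝕜] H₀` (with the joint graph norm). -/
def CompactPair {𝕜 H₀ H₁ H₂ : Type*} [RCLike 𝕜]
    [NormedAddCommGroup H₀] [InnerProductSpace 𝕜 H₀]
    [NormedAddCommGroup H₁] [InnerProductSpace 𝕜 H₁]
    [NormedAddCommGroup H₂] [InnerProductSpace 𝕜 H₂]
    (T : H₁ →ₗ.[𝕜] H₂) (S : H₁ →ₗ.[𝕜] H₀) : Prop :=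
  ∀ (x : ℕ → H₁) (h1 : ∀ n, x n ∈ T.domain) (h0 : ∀ n, x n ∈ S.domain),
    (∃ C : ℝ, ∀ n, ‖x n‖ + ‖T ⟨x n, h1 n⟩‖ + ‖S ⟨x n, h0 n⟩‖ ≤ C) →
    ∃ φ : ℕ → ℕ, StrictMono φ ∧ ∃ l : H₁, Tendsto (fun k => x (φ k)) atTop (𝓝 l)

/-- The cohomology group `N₀,₁ = N(A₁) ∩ N(A₀*)` of a Hilbert complex, as a submodule. -/
noncomputable def cohomSub {𝕜 H₀ H₁ H₂ : Type*} [RCLike 𝕜]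
    [NormedAddCommGroup H₀] [InnerProductSpace 𝕜 H₀] [CompleteSpace H₀]
    [NormedAddCommGroup H₁] [InnerProductSpace 𝕜 H₁]
    [NormedAddCommGroup H₂] [InnerProductSpace 𝕜 H₂]
    (T₀ : H₀ →ₗ.[𝕜] H₁) (T₁ : H₁ →ₗ.[𝕜] H₂) : Submodule 𝕜 H₁ :=
  (LinearMap.ker T₁.toFun).map T₁.domain.subtype ⊓
    (LinearMap.ker T₀.adjoint.toFun).map T₀.adjoint.domain.subtype

variable {𝕜 H₀ H₁ H₂ : Type*} [RCLike 𝕜]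
  [NormedAddCommGroup H₀] [InnerProductSpace 𝕜 H₀] [CompleteSpace H₀]
  [NormedAddCommGroup H₁] [InnerProductSpace 𝕜 H₁] [CompleteSpace H₁]
  [NormedAddCommGroup H₂] [InnerProductSpace 𝕜 H₂] [CompleteSpace H₂]

open scoped InnerProductSpace

namespace LinearPMap

section Closed

variable {𝕜 E F : Type*} [RCLike 𝕜]
  [NormedAddCommGroup E] [InnerProductSpace 𝕜 E]
  [NormedAddCommGroup F] [InnerProductSpace 𝕜 F]

/-- Sequential closedness of the graph of a closed operator. -/
theorem IsClosed.exists_apply_eq_of_tendsto_s14 {S : F →ₗ.[𝕜] E} (hS : S.IsClosed)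
    {y : ℕ → S.domain} {l : F} {m : E}
    (hy : Tendsto (fun n => (y n : F)) atTop (𝓝 l))
    (hSy : Tendsto (fun n => S (y n)) atTop (𝓝 m)) :
    ∃ z : S.domain, (z : F) = l ∧ S z = m := by
  have h : (l, m) ∈ (S.graph : Set (F × E)) :=
    _root_.IsClosed.mem_of_tendsto hS (hy.prodMk_nhds hSy)
      (Eventually.of_forall fun n => S.mem_graph (y n))
  simpa [mem_graph_iff] using h

/-- Every vector orthogonal to the range of the adjoint of a closed densely defined operator
lies in the kernel of that operator. -/
theorem IsClosed.exists_apply_eq_zero_of_inner_adjoint [CompleteSpace E] [CompleteSpace F]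
    {T : E →ₗ.[𝕜] F} (hd : Dense (T.domain : Set E)) (hT : T.IsClosed) (x : E)
    (hx : ∀ y : T.adjoint.domain, ⟪T.adjoint y, x⟫_𝕜 = 0) :
    ∃ z : T.domain, (z : E) = x ∧ T z = 0 := by
  let e := WithLp.linearEquiv 2 𝕜 (E × F)
  let G : Submodule 𝕜 (WithLp 2 (E × F)) := T.graph.comap e.toLinearMap
  have hG : _root_.IsClosed (G : Set (WithLp 2 (E × F))) :=
    _root_.IsClosed.preimage (WithLp.prod_continuous_ofLp 2 E F) hT
  have : CompleteSpace G := hG.completeSpace_coe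
  have hmem : WithLp.toLp 2 (x, (0 : F)) ∈ G := by
    rw [← Submodule.orthogonal_orthogonal G, Submodule.mem_orthogonal]
    intro u hu
    have h1 : ∀ z : T.domain, ⟪-u.fst, (z : E)⟫_𝕜 = ⟪u.snd, T z⟫_𝕜 := by
      intro z
      have h := (Submodule.mem_orthogonal' G u).1 hu (WithLp.toLp 2 ((z : E), T z))
        (T.mem_graph z)
      rw [WithLp.prod_inner_apply] at h
      rw [inner_neg_left]
      exact neg_eq_of_add_eq_zero_right h
    have h2 : u.snd ∈ T.adjoint.domain := mem_adjoint_domain_of_exists _ ⟨_, h1⟩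
    have h3 := hx ⟨u.snd, h2⟩
    rw [adjoint_apply_eq hd ⟨u.snd, h2⟩ h1, inner_neg_left, neg_eq_zero] at h3
    rw [WithLp.prod_inner_apply]
    simpa using h3
  have h : (x, (0 : F)) ∈ T.graph := hmem
  simpa [mem_graph_iff] using h

/-- Every vector orthogonal to the range of a densely defined operator lies in the kernel of
its adjoint. -/
theorem exists_adjoint_apply_eq_zero_of_inner [CompleteSpace E]
    {T : E →ₗ.[𝕜] F} (hd : Dense (T.domain : Set E)) (y : F)
    (hy : ∀ x : T.domain, ⟪T x, y⟫_𝕜 = 0) :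
    ∃ z : T.adjoint.domain, (z : F) = y ∧ T.adjoint z = 0 := by
  have h : ∀ x : T.domain, ⟪(0 : E), (x : E)⟫_𝕜 = ⟪y, T x⟫_𝕜 := fun x => by
    rw [inner_zero_left, inner_eq_zero_symm.1 (hy x)]
  exact ⟨⟨y, mem_adjoint_domain_of_exists _ ⟨0, h⟩⟩, rfl, adjoint_apply_eq hd _ h⟩

/-- The closure of the range of a partially defined operator, as a submodule. -/
def closedRange (T : E →ₗ.[𝕜] F) : Submodule 𝕜 F :=
  (LinearMap.range T.toFun).topologicalClosure

theorem mem_closedRange_iff {T : E →ₗ.[𝕜] F} {y : F} :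
    y ∈ T.closedRange ↔ y ∈ _root_.closure (pRange T) :=
  Iff.rfl

instance [CompleteSpace F] (T : E →ₗ.[𝕜] F) : CompleteSpace T.closedRange :=
  (Submodule.isClosed_topologicalClosure _).completeSpace_coe

theorem apply_mem_closedRange (T : E →ₗ.[𝕜] F) (x : T.domain) : T x ∈ T.closedRange :=
  Submodule.le_topologicalClosure _ ⟨x, rfl⟩

theorem inner_eq_zero_of_mem_closedRange {T : E →ₗ.[𝕜] F} {z : F}
    (hz : ∀ x : T.domain, ⟪T x, z⟫_𝕜 = 0) {y : F} (hy : y ∈ T.closedRange) : ⟪y, z⟫_𝕜 = 0 := by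
  refine closure_minimal (t := {w : F | ⟪w, z⟫_𝕜 = 0}) ?_
    (isClosed_eq (by fun_prop) continuous_const) (mem_closedRange_iff.1 hy)
  rintro _ ⟨x, rfl⟩
  exact hz x

end Closed

section DualPair

variable {𝕜 E F : Type*} [RCLike 𝕜]
  [NormedAddCommGroup E] [InnerProductSpace 𝕜 E]
  [NormedAddCommGroup F] [InnerProductSpace 𝕜 F]
  {T : E →ₗ.[𝕜] F} {S : F →ₗ.[𝕜] E}

/-- Projecting onto the closed range of `T` changes neither membership in the domain of `S`
nor the value of `S`, if the kernel of `S` contains the orthogonal complement of the range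
of `T`. -/
theorem exists_apply_eq_starProjection [CompleteSpace F]
    (hker : ∀ y : F, (∀ x : T.domain, ⟪T x, y⟫_𝕜 = 0) → ∃ z : S.domain, (z : F) = y ∧ S z = 0)
    (y : S.domain) :
    ∃ z : S.domain, (z : F) = T.closedRange.starProjection (y : F) ∧ S z = S y := by
  obtain ⟨w, hw, hSw⟩ := hker ((y : F) - T.closedRange.starProjection (y : F)) fun x =>
    (Submodule.mem_orthogonal _ _).1 (T.closedRange.sub_starProjection_mem_orthogonal (y : F)) _
      (T.apply_mem_closedRange x)
  exact ⟨y - w, by simp [hw], by rw [map_sub, hSw, sub_zero]⟩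

/-- A compact embedding on the reduced domain yields a Poincaré type estimate. -/
theorem exists_norm_le_mul_norm_apply (hST : S.IsFormalAdjoint T) (hS : S.IsClosed)
    (hc : CompactEmbed S (_root_.closure (pRange T))) :
    ∃ C : ℝ, ∀ y : S.domain, (y : F) ∈ T.closedRange → ‖(y : F)‖ ≤ C * ‖S y‖ := by
  by_contra! hcon
  choose y hyK hy using fun n : ℕ => hcon (n + 1)
  have hpos : ∀ n, 0 < ‖(y n : F)‖ := fun n => lt_of_le_of_lt (by positivity) (hy n)
  let u : ℕ → S.domain := fun n => ((‖(y n : F)‖⁻¹ : ℝ) : 𝕜) • y n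
  have hu1 : ∀ n, ‖(u n : F)‖ = 1 := by
    intro n
    simp [u, norm_smul, (hpos n).ne']
  have huS : ∀ n, ‖S (u n)‖ ≤ 1 / ((n : ℝ) + 1) := by
    intro n
    simp only [u, LinearPMap.map_smul, norm_smul, RCLike.norm_ofReal, abs_inv, abs_norm]
    rw [le_div_iff₀ (by positivity), mul_assoc, inv_mul_le_iff₀ (hpos n), mul_one, mul_comm]
    exact (hy n).le
  have huK : ∀ n, (u n : F) ∈ T.closedRange := fun n => T.closedRange.smul_mem _ (hyK n)
  have hS0 : Tendsto (fun n => S (u n)) atTop (𝓝 0) :=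
    squeeze_zero_norm huS tendsto_one_div_add_atTop_nhds_zero_nat
  obtain ⟨φ, hφ, l, hl⟩ := hc u (fun n => mem_closedRange_iff.1 (huK n))
    ⟨1 + 1, fun n => add_le_add (hu1 n).le ((huS n).trans
      ((div_le_one (by positivity)).2 (by linarith [n.cast_nonneg (α := ℝ)])))⟩
  obtain ⟨z, hz, hSz⟩ := hS.exists_apply_eq_of_tendsto_s14 hl (hS0.comp hφ.tendsto_atTop)
  have hlK : l ∈ T.closedRange :=
    (Submodule.isClosed_topologicalClosure _).mem_of_tendsto hl
      (Eventually.of_forall fun n => huK (φ n))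
  have hl0 : ⟪l, l⟫_𝕜 = 0 := by
    refine inner_eq_zero_of_mem_closedRange (fun x => ?_) hlK
    rw [inner_eq_zero_symm, ← hz, ← hST z x, hSz, inner_zero_left]
  have hl1 : ‖l‖ = 1 :=
    tendsto_nhds_unique hl.norm (by simp [hu1])
  rw [inner_self_eq_zero.1 hl0, norm_zero] at hl1
  exact zero_ne_one hl1

/-- If the embedding of the reduced domain of `S` is compact, then every element of the closed
range of `S` is attained on the reduced domain. -/
theorem exists_apply_eq_of_mem_closedRange [CompleteSpace F]
    (hST : S.IsFormalAdjoint T) (hS : S.IsClosed)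
    (hker : ∀ y : F, (∀ x : T.domain, ⟪T x, y⟫_𝕜 = 0) → ∃ z : S.domain, (z : F) = y ∧ S z = 0)
    (hc : CompactEmbed S (_root_.closure (pRange T))) {x : E}
    (hx : x ∈ _root_.closure (pRange S)) :
    ∃ y : S.domain, (y : F) ∈ T.closedRange ∧ S y = x := by
  obtain ⟨C, hC⟩ := exists_norm_le_mul_norm_apply hST hS hc
  obtain ⟨v, hv, hvx⟩ := mem_closure_iff_seq_limit.1 hx
  choose w hw using hv
  choose y hy hyw using fun n => exists_apply_eq_starProjection hker (w n)
  have hyK : ∀ n, (y n : F) ∈ T.closedRange := fun n => by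
    rw [hy]; exact Submodule.starProjection_apply_mem _ _
  have hSy : ∀ n, S (y n) = v n := fun n => (hyw n).trans (hw n)
  have hcau : CauchySeq fun n => (y n : F) := by
    have hlim : Tendsto (fun p : ℕ × ℕ => C * dist (v p.1) (v p.2)) atTop (𝓝 0) := by
      simpa using (cauchySeq_iff_tendsto_dist_atTop_0.1 hvx.cauchySeq).const_mul C
    refine cauchySeq_iff_tendsto_dist_atTop_0.2
      (squeeze_zero (fun _ => dist_nonneg) (fun p => ?_) hlim)
    have h := hC (y p.1 - y p.2) (T.closedRange.sub_mem (hyK _) (hyK _))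
    rw [map_sub, hSy, hSy] at h
    simpa [dist_eq_norm] using h
  obtain ⟨l, hl⟩ := cauchySeq_tendsto_of_complete hcau
  obtain ⟨z, hz, hSz⟩ := hS.exists_apply_eq_of_tendsto_s14 hl (by simpa only [hSy] using hvx)
  refine ⟨z, ?_, hSz⟩
  rw [hz]
  exact (Submodule.isClosed_topologicalClosure _).mem_of_tendsto hl
    (Eventually.of_forall hyK)

/-- Compactness of the embedding of the reduced domain passes from an operator to its dual. -/
theorem IsFormalAdjoint.compactEmbed [CompleteSpace E] [CompleteSpace F]
    (hST : S.IsFormalAdjoint T) (hS : S.IsClosed)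
    (hker : ∀ y : F, (∀ x : T.domain, ⟪T x, y⟫_𝕜 = 0) → ∃ z : S.domain, (z : F) = y ∧ S z = 0)
    (hc : CompactEmbed S (_root_.closure (pRange T))) :
    CompactEmbed T (_root_.closure (pRange S)) := by
  rintro x hx ⟨M, hM⟩
  obtain ⟨C, hC⟩ := exists_norm_le_mul_norm_apply hST hS hc
  choose y hyK hy using fun n => exists_apply_eq_of_mem_closedRange hST hS hker hc (hx n)
  have hxM : ∀ n, ‖(x n : E)‖ ≤ M := fun n => by linarith [hM n, norm_nonneg (T (x n))]
  have hTM : ∀ n, ‖T (x n)‖ ≤ M := fun n => by linarith [hM n, norm_nonneg (x n : E)]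
  obtain ⟨φ, hφ, l, hl⟩ := hc y (fun n => mem_closedRange_iff.1 (hyK n))
    ⟨|C| * M + M, fun n => by
      have h := hC (y n) (hyK n)
      rw [hy] at h ⊢
      refine add_le_add (h.trans ?_) (hxM n)
      exact mul_le_mul (le_abs_self C) (hxM n) (norm_nonneg _) (abs_nonneg C)⟩
  refine ⟨φ, hφ, cauchySeq_tendsto_of_complete ?_⟩
  have hlim : Tendsto (fun p : ℕ × ℕ =>
      √(dist (y (φ p.1) : F) (y (φ p.2)) * (2 * M))) atTop (𝓝 0) := by
    simpa using ((cauchySeq_iff_tendsto_dist_atTop_0.1 hl.cauchySeq).mul_const (2 * M)).sqrt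
  refine cauchySeq_iff_tendsto_dist_atTop_0.2
    (squeeze_zero (fun _ => dist_nonneg) (fun p => Real.le_sqrt_of_sq_le ?_) hlim)
  set i := φ p.1
  set j := φ p.2
  have h := hST (y i - y j) (x i - x j)
  rw [map_sub, hy, hy, map_sub] at h
  have h' := congrArg norm h
  rw [show (((x i - x j : T.domain)) : E) = (x i : E) - x j from rfl,
    inner_self_eq_norm_sq_to_K] at h'
  rw [dist_eq_norm, dist_eq_norm]
  calc ‖(x i : E) - x j‖ ^ 2
      = ‖⟪((y i - y j : S.domain) : F), T (x i) - T (x j)⟫_𝕜‖ := by rw [← h']; simp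
    _ ≤ ‖(y i : F) - y j‖ * ‖T (x i) - T (x j)‖ := norm_inner_le_norm _ _
    _ ≤ ‖(y i : F) - y j‖ * (2 * M) := by
      gcongr
      linarith [norm_sub_le (T (x i)) (T (x j)), hTM i, hTM j]

end DualPair

end LinearPMap

theorem mem_cohomSub_iff {𝕜 H₀ H₁ H₂ : Type*} [RCLike 𝕜]
    [NormedAddCommGroup H₀] [InnerProductSpace 𝕜 H₀] [CompleteSpace H₀]
    [NormedAddCommGroup H₁] [InnerProductSpace 𝕜 H₁]
    [NormedAddCommGroup H₂] [InnerProductSpace 𝕜 H₂]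
    {T₀ : H₀ →ₗ.[𝕜] H₁} {T₁ : H₁ →ₗ.[𝕜] H₂} {x : H₁} :
    x ∈ cohomSub T₀ T₁ ↔ (∃ z : T₁.domain, (z : H₁) = x ∧ T₁ z = 0) ∧
      ∃ z : T₀.adjoint.domain, (z : H₁) = x ∧ T₀.adjoint z = 0 := by
  simp only [cohomSub, Submodule.mem_inf, Submodule.mem_map, LinearMap.mem_ker]
  exact and_congr (exists_congr fun _ => and_comm) (exists_congr fun _ => and_comm)

/-- A compact pair has finite-dimensional cohomology. -/
theorem CompactPair.finiteDimensional_cohomSub {𝕜 H₀ H₁ H₂ : Type*} [RCLike 𝕜]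
    [NormedAddCommGroup H₀] [InnerProductSpace 𝕜 H₀] [CompleteSpace H₀]
    [NormedAddCommGroup H₁] [InnerProductSpace 𝕜 H₁]
    [NormedAddCommGroup H₂] [InnerProductSpace 𝕜 H₂]
    {T₀ : H₀ →ₗ.[𝕜] H₁} {T₁ : H₁ →ₗ.[𝕜] H₂} (h : CompactPair T₁ T₀.adjoint) :
    FiniteDimensional 𝕜 (cohomSub T₀ T₁) := by
  by_contra hfin
  obtain ⟨R, f, -, hR, hf⟩ := exists_seq_norm_le_one_le_norm_sub (𝕜 := 𝕜) hfin
  choose z hz hTz using fun n => (mem_cohomSub_iff.1 (f n).2).1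
  choose w hw hSw using fun n => (mem_cohomSub_iff.1 (f n).2).2
  have h1 : ∀ n, (f n : H₁) ∈ T₁.domain := fun n => hz n ▸ (z n).2
  have h0 : ∀ n, (f n : H₁) ∈ T₀.adjoint.domain := fun n => hw n ▸ (w n).2
  obtain ⟨φ, hφ, l, hl⟩ := h (fun n => (f n : H₁)) h1 h0 ⟨R, fun n => by
    rw [show (⟨(f n : H₁), h1 n⟩ : T₁.domain) = z n from Subtype.ext (hz n).symm,
      show (⟨(f n : H₁), h0 n⟩ : T₀.adjoint.domain) = w n from Subtype.ext (hw n).symm,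
      hTz, hSw, norm_zero, norm_zero, add_zero, add_zero]
    exact hR n⟩
  obtain ⟨N, hN⟩ := Metric.cauchySeq_iff'.1 hl.cauchySeq 1 one_pos
  have h2 := hN (N + 1) N.le_succ
  rw [dist_eq_norm] at h2
  exact absurd h2 (not_lt.2 (hf (hφ.injective.ne N.succ_ne_self)))

/-- For a Hilbert complex `A₀, A₁`, the embedding
`D(A₁) ∩ D(A₀*) ↪ H₁` is compact iff the embeddings `D(𝒜₀) ↪ H₀` and `D(𝒜₁) ↪ H₁` are
compact and the cohomology group `N₀,₁` is finite-dimensional; in this case `N₀,₁` has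
finite dimension. -/
theorem compactPair_iff_compactEmbeds_and_finiteDimensional
    (T₀ : H₀ →ₗ.[𝕜] H₁) (T₁ : H₁ →ₗ.[𝕜] H₂)
    (hd₀ : Dense (T₀.domain : Set H₀)) (hc₀ : T₀.IsClosed)
    (hd₁ : Dense (T₁.domain : Set H₁)) (hc₁ : T₁.IsClosed)
    (hcplx : ∀ x : T₀.domain, ∃ h : T₀ x ∈ T₁.domain, T₁ ⟨T₀ x, h⟩ = 0) :
    (CompactPair T₁ T₀.adjoint ↔
      CompactEmbed T₀ (closure (pRange T₀.adjoint)) ∧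
      CompactEmbed T₁ (closure (pRange T₁.adjoint)) ∧
      FiniteDimensional 𝕜 (cohomSub T₀ T₁)) ∧
    (CompactPair T₁ T₀.adjoint → FiniteDimensional 𝕜 (cohomSub T₀ T₁)) := by
  have hF₀ := LinearPMap.adjoint_isFormalAdjoint hd₀
  have hF₁ := LinearPMap.adjoint_isFormalAdjoint hd₁
  have hcl₀ : T₀.adjoint.IsClosed := LinearPMap.adjoint_isClosed hd₀
  have horth : ∀ (x : T₀.domain) (y : T₁.adjoint.domain),
      ⟪T₁.adjoint y, T₀ x⟫_𝕜 = 0 := by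
    intro x y
    obtain ⟨hx, hx0⟩ := hcplx x
    rw [hF₁ y ⟨T₀ x, hx⟩, hx0, inner_zero_right]
  have hker₀ := LinearPMap.exists_adjoint_apply_eq_zero_of_inner hd₀
  have hker₁ := hc₁.exists_apply_eq_zero_of_inner_adjoint hd₁
  have hK₁ : ∀ x ∈ T₁.adjoint.closedRange,
      ∃ z : T₀.adjoint.domain, (z : H₁) = x ∧ T₀.adjoint z = 0 := fun x hx =>
    hker₀ x fun u => inner_eq_zero_symm.1
      (LinearPMap.inner_eq_zero_of_mem_closedRange (horth u) hx)
  have hK₀ : ∀ x ∈ T₀.closedRange, ∃ z : T₁.domain, (z : H₁) = x ∧ T₁ z = 0 := fun x hx =>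
    hker₁ x fun u => inner_eq_zero_symm.1
      (LinearPMap.inner_eq_zero_of_mem_closedRange
        (fun v => inner_eq_zero_symm.1 (horth v u)) hx)
  refine ⟨⟨fun h => ⟨?_, ?_, h.finiteDimensional_cohomSub⟩, ?_⟩,
    fun h => h.finiteDimensional_cohomSub⟩
  · refine hF₀.compactEmbed hcl₀ hker₀ ?_
    rintro y hy ⟨C, hC⟩
    choose z hz hTz using fun n => hK₀ (y n) (LinearPMap.mem_closedRange_iff.2 (hy n))
    have h1 : ∀ n, (y n : H₁) ∈ T₁.domain := fun n => hz n ▸ (z n).2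
    refine h (fun n => (y n : H₁)) h1 (fun n => (y n).2) ⟨C, fun n => ?_⟩
    rw [show (⟨(y n : H₁), h1 n⟩ : T₁.domain) = z n from Subtype.ext (hz n).symm, hTz,
      norm_zero, add_zero]
    exact hC n
  · rintro y hy ⟨C, hC⟩
    choose z hz hTz using fun n => hK₁ (y n) (LinearPMap.mem_closedRange_iff.2 (hy n))
    have h0 : ∀ n, (y n : H₁) ∈ T₀.adjoint.domain := fun n => hz n ▸ (z n).2
    refine h (fun n => (y n : H₁)) (fun n => (y n).2) h0 ⟨C, fun n => ?_⟩
    rw [show (⟨(y n : H₁), h0 n⟩ : T₀.adjoint.domain) = z n from Subtype.ext (hz n).symm, hTz,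
      norm_zero, add_zero]
    exact hC n
  · rintro ⟨hE₀, hE₁, hfin⟩ x h1 h0 ⟨C, hC⟩
    have hE₀' : CompactEmbed T₀.adjoint (closure (pRange T₀)) :=
      hF₀.symm.compactEmbed hc₀ (hc₀.exists_apply_eq_zero_of_inner_adjoint hd₀) hE₀
    choose a ha hTa using fun n =>
      LinearPMap.exists_apply_eq_starProjection hker₀ ⟨x n, h0 n⟩
    choose b hb hTb using fun n =>
      LinearPMap.exists_apply_eq_starProjection hker₁ ⟨x n, h1 n⟩
    have haK : ∀ n, (a n : H₁) ∈ T₀.closedRange := fun n => by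
      rw [ha]; exact Submodule.starProjection_apply_mem _ _
    have hbK : ∀ n, (b n : H₁) ∈ T₁.adjoint.closedRange := fun n => by
      rw [hb]; exact Submodule.starProjection_apply_mem _ _
    have hna : ∀ n, ‖(a n : H₁)‖ ≤ ‖x n‖ := fun n => by
      rw [ha]; exact Submodule.norm_starProjection_apply_le _ _
    have hnb : ∀ n, ‖(b n : H₁)‖ ≤ ‖x n‖ := fun n => by
      rw [hb]; exact Submodule.norm_starProjection_apply_le _ _
    have hmem : ∀ n, x n - a n - b n ∈ cohomSub T₀ T₁ := by
      intro n
      obtain ⟨u, hu, hTu⟩ := hK₀ _ (haK n)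
      obtain ⟨v, hv, hTv⟩ := hK₁ _ (hbK n)
      refine mem_cohomSub_iff.2 ⟨⟨⟨x n, h1 n⟩ - u - b n, by simp [hu], ?_⟩,
        ⟨⟨x n, h0 n⟩ - a n - v, by simp [hv], ?_⟩⟩
      · rw [LinearPMap.map_sub, LinearPMap.map_sub, hTu, hTb, sub_zero, sub_self]
      · rw [LinearPMap.map_sub, LinearPMap.map_sub, hTv, hTa, sub_zero, sub_self]
    have hx : ∀ n, ‖x n‖ ≤ C := fun n =>
      le_trans (by rw [add_assoc]; exact le_add_of_nonneg_right (by positivity)) (hC n)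
    obtain ⟨φ, hφ, l, hl⟩ := hE₀' a
      (fun n => LinearPMap.mem_closedRange_iff.1 (haK n)) ⟨C, fun n => by
        rw [hTa]
        linarith [hC n, hna n, norm_nonneg (T₁ ⟨x n, h1 n⟩)]⟩
    obtain ⟨ψ, hψ, m, hm⟩ := hE₁ (b ∘ φ)
      (fun n => LinearPMap.mem_closedRange_iff.1 (hbK (φ n))) ⟨C, fun n => by
        simp only [Function.comp_apply]
        rw [hTb]
        linarith [hC (φ n), hnb (φ n), norm_nonneg (T₀.adjoint ⟨x (φ n), h0 (φ n)⟩)]⟩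
    have : ProperSpace (cohomSub T₀ T₁) := FiniteDimensional.proper_rclike 𝕜 _
    obtain ⟨k, -, θ, hθ, hk⟩ := tendsto_subseq_of_bounded
      (Metric.isBounded_closedBall (x := (0 : cohomSub T₀ T₁)) (r := 3 * C))
      (x := fun n => (⟨_, hmem (φ (ψ n))⟩ : cohomSub T₀ T₁)) fun n => by
        rw [mem_closedBall_zero_iff, Submodule.coe_norm]
        refine (norm_sub_le _ _).trans ?_
        linarith [norm_sub_le (x (φ (ψ n))) (a (φ (ψ n))), hx (φ (ψ n)), hna (φ (ψ n)),
          hnb (φ (ψ n))]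
    refine ⟨φ ∘ ψ ∘ θ, hφ.comp (hψ.comp hθ), k + l + m, ?_⟩
    have hk' := (continuous_subtype_val.tendsto k).comp hk
    have hl' := hl.comp (hψ.tendsto_atTop.comp hθ.tendsto_atTop)
    have hm' := hm.comp hθ.tendsto_atTop
    refine ((hk'.add hl').add hm').congr fun n => ?_
    simp only [Function.comp_apply]
    abel
end

section
/- Let A₀ : D(A₀) ⊆ H₀ → H₁ and A₁ : D(A₁) ⊆ H₁ → H₂ be densely defined closed linear operators satisfying the complex property R(A₀) ⊆ N(A₁), and assume R(A₀) and R(A₁) are closed. Then R(A₀*) and R(A₁*) are closed, the constants c_{A₀} = 1/λ_{A₀} and c_{A₁} = 1/λ_{A₁} are finite (with the convention 1/∞ := 0), and for all x ∈ D(A₁) ∩ D(A₀*) orthogonal to N₀,₁ in H₁: ‖x‖²_{H₁} ≤ c_{A₁}² ‖A₁x‖²_{H₂} + c_{A₀}² ‖A₀*x‖²_{H₀}. -/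
open Filter Topology
open scoped ENNReal

/-- The cohomology group `N₀,₁ = N(A₁) ∩ N(A₀*)` of a Hilbert complex, as a set. -/
def cohomSet {𝕜 H₀ H₁ H₂ : Type*} [RCLike 𝕜]
    [NormedAddCommGroup H₀] [InnerProductSpace 𝕜 H₀] [CompleteSpace H₀]
    [NormedAddCommGroup H₁] [InnerProductSpace 𝕜 H₁]
    [NormedAddCommGroup H₂] [InnerProductSpace 𝕜 H₂]
    (T₀ : H₀ →ₗ.[𝕜] H₁) (T₁ : H₁ →ₗ.[𝕜] H₂) : Set H₁ :=
  {x : H₁ | (∃ h : x ∈ T₁.domain, T₁ ⟨x, h⟩ = 0) ∧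
    (∃ h : x ∈ T₀.adjoint.domain, T₀.adjoint ⟨x, h⟩ = 0)}

variable {𝕜 H₀ H₁ H₂ : Type*} [RCLike 𝕜]
  [NormedAddCommGroup H₀] [InnerProductSpace 𝕜 H₀] [CompleteSpace H₀]
  [NormedAddCommGroup H₁] [InnerProductSpace 𝕜 H₁] [CompleteSpace H₁]
  [NormedAddCommGroup H₂] [InnerProductSpace 𝕜 H₂] [CompleteSpace H₂]

local notation "⟪" x ", " y "⟫" => @inner 𝕜 _ _ x y

section ClosedRange

variable {E F G : Type*} [NormedAddCommGroup E] [InnerProductSpace 𝕜 E]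
  [NormedAddCommGroup F] [InnerProductSpace 𝕜 F]
  [NormedAddCommGroup G] [InnerProductSpace 𝕜 G]

/-- The kernel of a partially defined linear map, as a submodule of the ambient space. -/
def pKer (T : E →ₗ.[𝕜] F) : Submodule 𝕜 E :=
  T.graph.comap (LinearMap.inl 𝕜 E F)

theorem mem_pKer_iff_graph {T : E →ₗ.[𝕜] F} {x : E} : x ∈ pKer T ↔ (x, (0 : F)) ∈ T.graph :=
  Iff.rfl

theorem mem_pKer_iff {T : E →ₗ.[𝕜] F} {x : E} :
    x ∈ pKer T ↔ ∃ h : x ∈ T.domain, T ⟨x, h⟩ = 0 := by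
  rw [mem_pKer_iff_graph, LinearPMap.mem_graph_iff]
  constructor
  · rintro ⟨y, rfl, h⟩
    exact ⟨y.2, h⟩
  · rintro ⟨h, h'⟩
    exact ⟨⟨x, h⟩, rfl, h'⟩

theorem sub_mem_pKer {T : E →ₗ.[𝕜] F} {x y : T.domain} (h : T x = T y) :
    (x : E) - y ∈ pKer T :=
  mem_pKer_iff.2 ⟨T.domain.sub_mem x.2 y.2, (T.map_sub x y).trans (sub_eq_zero.2 h)⟩

theorem isClosed_pKer {T : E →ₗ.[𝕜] F} (hT : T.IsClosed) : IsClosed (pKer T : Set E) :=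
  IsClosed.preimage (f := fun x : E => (x, (0 : F))) (by fun_prop) hT

/-- The value of a partially defined map does not change when its argument is projected onto the
orthogonal complement of the kernel. -/
theorem exists_mem_orthogonal_pKer [CompleteSpace E] {T : E →ₗ.[𝕜] F} (hT : T.IsClosed)
    (x : T.domain) :
    ∃ z : T.domain, (z : E) ∈ (pKer T)ᗮ ∧ (x : E) - z ∈ pKer T ∧ T z = T x := by
  have : CompleteSpace (pKer T) := (isClosed_pKer hT).completeSpace_coe
  obtain ⟨p, hp, q, hq, hx⟩ := (pKer T).exists_add_mem_mem_orthogonal (x : E)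
  obtain ⟨hpd, hp0⟩ := mem_pKer_iff.1 hp
  refine ⟨x - ⟨p, hpd⟩, ?_, ?_, ?_⟩
  · simpa [hx] using hq
  · simpa using hp
  · rw [T.map_sub, hp0, sub_zero]

theorem exists_preimage_norm_le_of_isClosed_pRange [CompleteSpace E] [CompleteSpace F]
    {T : E →ₗ.[𝕜] F} (hT : T.IsClosed) (hR : IsClosed (pRange T)) :
    ∃ C > 0, ∀ x : T.domain, ∃ z : T.domain, T z = T x ∧ ‖(z : E)‖ ≤ C * ‖T x‖ := by
  have : CompleteSpace T.graph := IsClosed.completeSpace_coe (hs := hT)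
  have : CompleteSpace (LinearMap.range T.toFun) := IsClosed.completeSpace_coe (hs := hR)
  let f : T.graph →L[𝕜] LinearMap.range T.toFun :=
    ((ContinuousLinearMap.snd 𝕜 E F).comp T.graph.subtypeL).codRestrict _ (by
      rintro ⟨g, hg⟩
      obtain ⟨x, -, hx⟩ := (LinearPMap.mem_graph_iff T).1 hg
      exact ⟨x, hx⟩)
  have hf : Function.Surjective f := by
    rintro ⟨_, x, rfl⟩
    exact ⟨⟨(x, T x), T.mem_graph x⟩, rfl⟩
  obtain ⟨C, hC, h⟩ := f.exists_preimage_norm_le hf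
  refine ⟨C, hC, fun x => ?_⟩
  obtain ⟨⟨g, hg⟩, hgx, hgn⟩ := h ⟨T x, x, rfl⟩
  obtain ⟨z, hz, hz'⟩ := (LinearPMap.mem_graph_iff T).1 hg
  refine ⟨z, hz'.trans (congrArg Subtype.val hgx), ?_⟩
  rw [hz]
  exact (norm_fst_le g).trans hgn

/-- The Friedrichs–Poincaré estimate for a closed operator with closed range. -/
theorem exists_norm_le_of_isClosed_pRange [CompleteSpace E] [CompleteSpace F]
    {T : E →ₗ.[𝕜] F} (hT : T.IsClosed) (hR : IsClosed (pRange T)) :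
    ∃ C > 0, ∀ x : T.domain, (x : E) ∈ (pKer T)ᗮ → ‖(x : E)‖ ≤ C * ‖T x‖ := by
  obtain ⟨C, hC, h⟩ := exists_preimage_norm_le_of_isClosed_pRange hT hR
  refine ⟨C, hC, fun x hx => ?_⟩
  obtain ⟨z, hz, hzn⟩ := h x
  refine le_trans ?_ hzn
  have hker : (z : E) - x ∈ pKer T :=
    sub_mem_pKer hz
  have h0 : ⟪(x : E), (z : E) - x⟫ = 0 := (Submodule.mem_orthogonal' _ _).1 hx _ hker
  have hpyth := norm_add_sq_eq_norm_sq_add_norm_sq_of_inner_eq_zero (x : E) ((z : E) - x) h0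
  rw [add_sub_cancel] at hpyth
  nlinarith [norm_nonneg (x : E), norm_nonneg (z : E), norm_nonneg ((z : E) - x)]

theorem mem_graph_adjoint_iff [CompleteSpace E] {T : E →ₗ.[𝕜] F}
    (hd : Dense (T.domain : Set E)) {y : F} {w : E} :
    (y, w) ∈ T.adjoint.graph ↔ ∀ x : T.domain, ⟪w, (x : E)⟫ = ⟪y, T x⟫ := by
  rw [LinearPMap.mem_graph_iff]
  constructor
  · rintro ⟨z, rfl, rfl⟩ x
    exact LinearPMap.adjoint_isFormalAdjoint hd z x
  · intro h
    exact ⟨⟨y, LinearPMap.mem_adjoint_domain_of_exists y ⟨w, h⟩⟩, rfl,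
      LinearPMap.adjoint_apply_eq hd _ h⟩

theorem mem_pKer_adjoint_iff [CompleteSpace E] {T : E →ₗ.[𝕜] F}
    (hd : Dense (T.domain : Set E)) {y : F} :
    y ∈ pKer T.adjoint ↔ ∀ x : T.domain, ⟪y, T x⟫ = 0 := by
  simp [mem_pKer_iff_graph, mem_graph_adjoint_iff hd, eq_comm]

/-- The closed range theorem: the adjoint of a closed operator with closed range has as range the
orthogonal complement of the kernel. -/
theorem pRange_adjoint_eq [CompleteSpace E] [CompleteSpace F] {T : E →ₗ.[𝕜] F}
    (hd : Dense (T.domain : Set E)) (hT : T.IsClosed) (hR : IsClosed (pRange T)) :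
    pRange T.adjoint = ((pKer T)ᗮ : Submodule 𝕜 E) := by
  ext w
  rw [SetLike.mem_coe, Submodule.mem_orthogonal']
  constructor
  · rintro ⟨y, rfl⟩ u hu
    obtain ⟨hud, hu0⟩ := mem_pKer_iff.1 hu
    have := LinearPMap.adjoint_isFormalAdjoint hd y ⟨u, hud⟩
    rwa [hu0, inner_zero_right] at this
  · intro hw
    have hker : ∀ a b : T.domain, T a = T b → ⟪w, (a : E)⟫ = ⟪w, (b : E)⟫ := by
      intro a b hab
      rw [← sub_eq_zero, ← inner_sub_right]
      exact hw _ (sub_mem_pKer hab)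
    obtain ⟨C, hC, h⟩ := exists_preimage_norm_le_of_isClosed_pRange hT hR
    have hpre : ∀ y : LinearMap.range T.toFun, ∃ z : T.domain,
        T z = y ∧ ‖(z : E)‖ ≤ C * ‖y‖ := by
      rintro ⟨_, x, rfl⟩
      exact h x
    choose s hs hsn using hpre
    have : CompleteSpace (LinearMap.range T.toFun) := IsClosed.completeSpace_coe (hs := hR)
    let φ : LinearMap.range T.toFun →ₗ[𝕜] 𝕜 :=
      { toFun := fun y => ⟪w, (s y : E)⟫
        map_add' := fun a b => by
          rw [← inner_add_right]
          exact hker _ (s a + s b) (by rw [T.map_add, hs, hs, hs]; rfl)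
        map_smul' := fun c a => by
          rw [RingHom.id_apply, smul_eq_mul, ← inner_smul_right]
          exact hker _ (c • s a) (by rw [T.map_smul, hs, hs]; rfl) }
    let ψ : StrongDual 𝕜 (LinearMap.range T.toFun) :=
      φ.mkContinuous (‖w‖ * C) fun y => by
        calc ‖⟪w, (s y : E)⟫‖ ≤ ‖w‖ * ‖(s y : E)‖ := norm_inner_le_norm _ _
          _ ≤ ‖w‖ * (C * ‖y‖) := by gcongr; exact hsn y
          _ = ‖w‖ * C * ‖y‖ := by ring
    let y := (InnerProductSpace.toDual 𝕜 (LinearMap.range T.toFun)).symm ψ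
    have hy : ((y : F), w) ∈ T.adjoint.graph := by
      rw [mem_graph_adjoint_iff hd]
      intro x
      have h1 : ⟪y, (⟨T x, x, rfl⟩ : LinearMap.range T.toFun)⟫ = ψ ⟨T x, x, rfl⟩ :=
        InnerProductSpace.toDual_symm_apply
      exact (hker x _ (hs ⟨T x, x, rfl⟩).symm).trans h1.symm
    obtain ⟨z, -, hz⟩ := (LinearPMap.mem_graph_iff _).1 hy
    exact ⟨z, hz⟩

theorem inv_lamSet_ne_top {T : E →ₗ.[𝕜] F} {V : Set E} {C : ℝ} (hC : 0 < C)
    (h : ∀ x : T.domain, (x : E) ∈ V → ‖(x : E)‖ ≤ C * ‖T x‖) : (lamSet T V)⁻¹ ≠ ⊤ := by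
  rw [Ne, ENNReal.inv_eq_top, ← Ne, ← pos_iff_ne_zero]
  refine lt_of_lt_of_le (ENNReal.ofReal_pos.2 (inv_pos.2 hC)) (le_iInf fun x => ?_)
  refine ENNReal.ofReal_le_ofReal ?_
  rw [le_div_iff₀ (norm_pos_iff.2 x.2.1), inv_mul_le_iff₀ hC]
  exact h x.1 x.2.2

theorem norm_le_inv_lamSet_mul {T : E →ₗ.[𝕜] F} {V : Set E} (hV : (lamSet T V)⁻¹ ≠ ⊤)
    (x : T.domain) (hx : (x : E) ∈ V) : ‖(x : E)‖ ≤ ((lamSet T V)⁻¹).toReal * ‖T x‖ := by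
  by_cases hx0 : (x : E) = 0
  · rw [hx0, norm_zero]
    positivity
  have hle : lamSet T V ≤ ENNReal.ofReal (‖T x‖ / ‖(x : E)‖) :=
    iInf_le (fun x : {x : T.domain // (x : E) ≠ 0 ∧ (x : E) ∈ V} =>
      ENNReal.ofReal (‖T x.1‖ / ‖(x.1 : E)‖)) ⟨x, hx0, hx⟩
  have hne : lamSet T V ≠ 0 := by simpa using hV
  have hpos : 0 < (lamSet T V).toReal :=
    ENNReal.toReal_pos hne (ne_top_of_le_ne_top ENNReal.ofReal_ne_top hle)
  have hle' := ENNReal.toReal_le_of_le_ofReal (by positivity) hle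
  rw [le_div_iff₀ (norm_pos_iff.2 hx0)] at hle'
  rwa [ENNReal.toReal_inv, inv_mul_eq_div, le_div_iff₀' hpos]

/-- In a complex with closed `R(A₀)`, a vector of `N(A₁)` orthogonal to the cohomology group lies
in `R(A₀)`. -/
theorem mem_pRange_of_orthogonal_cohomSet [CompleteSpace E] [CompleteSpace F]
    {T₀ : E →ₗ.[𝕜] F} {T₁ : F →ₗ.[𝕜] G}
    (hd₀ : Dense (T₀.domain : Set E)) (hcplx : ∀ x : T₀.domain, T₀ x ∈ pKer T₁)
    (hR₀ : IsClosed (pRange T₀)) {p : F} (hp : p ∈ pKer T₁)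
    (hortho : ∀ n ∈ cohomSet T₀ T₁, ⟪n, p⟫ = 0) : p ∈ pRange T₀ := by
  have : CompleteSpace (LinearMap.range T₀.toFun) := IsClosed.completeSpace_coe (hs := hR₀)
  obtain ⟨_, ⟨z, rfl⟩, s, hs, hps⟩ :=
    (LinearMap.range T₀.toFun).exists_add_mem_mem_orthogonal p
  change p = T₀ z + s at hps
  have hs' := (Submodule.mem_orthogonal' _ _).1 hs
  have hsker : s ∈ pKer T₁ := by
    have := (pKer T₁).sub_mem hp (hcplx z)
    rwa [hps, add_sub_cancel_left] at this
  have hsadj : s ∈ pKer T₀.adjoint :=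
    (mem_pKer_adjoint_iff hd₀).2 fun x => hs' _ ⟨x, rfl⟩
  have h0 := hortho s ⟨mem_pKer_iff.1 hsker, mem_pKer_iff.1 hsadj⟩
  have hsz : ⟪s, T₀ z⟫ = 0 := hs' _ ⟨z, rfl⟩
  rw [hps, inner_add_right, hsz, zero_add, inner_self_eq_zero] at h0
  exact ⟨z, by rw [hps, h0, add_zero]⟩

/-- An estimate `‖z‖ ≤ c ‖T z‖` on the orthogonal complement of the kernel passes to the adjoint
on the range. -/
theorem norm_le_mul_norm_adjoint [CompleteSpace E] {T : E →ₗ.[𝕜] F}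
    (hd : Dense (T.domain : Set E)) (hT : T.IsClosed) {c : ℝ}
    (hc : ∀ z : T.domain, (z : E) ∈ (pKer T)ᗮ → ‖(z : E)‖ ≤ c * ‖T z‖)
    (p : T.adjoint.domain) (hp : (p : F) ∈ pRange T) : ‖(p : F)‖ ≤ c * ‖T.adjoint p‖ := by
  obtain ⟨z', hz'⟩ := hp
  obtain ⟨z, hz, -, hzz'⟩ := exists_mem_orthogonal_pKer hT z'
  have hzp : T z = p := hzz'.trans hz'
  have hbound := hc z hz
  rw [hzp] at hbound
  by_cases hp0 : ‖(p : F)‖ = 0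
  · have hpz : p = 0 := Subtype.ext (norm_eq_zero.1 hp0)
    simp [hpz]
  have hppos : 0 < ‖(p : F)‖ := (norm_nonneg _).lt_of_ne' hp0
  refine le_of_mul_le_mul_right ?_ hppos
  calc ‖(p : F)‖ * ‖(p : F)‖ = ‖⟪(p : F), (p : F)⟫‖ := by
        rw [inner_self_eq_norm_sq_to_K, norm_pow, RCLike.norm_ofReal, abs_norm, sq]
    _ = ‖⟪T.adjoint p, (z : E)⟫‖ := by
        rw [LinearPMap.adjoint_isFormalAdjoint hd p z, hzp]
    _ ≤ ‖T.adjoint p‖ * ‖(z : E)‖ := norm_inner_le_norm _ _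
    _ ≤ ‖T.adjoint p‖ * (c * ‖(p : F)‖) := by gcongr
    _ = c * ‖T.adjoint p‖ * ‖(p : F)‖ := by ring

end ClosedRange

/-- For a Hilbert complex `A₀, A₁` with closed ranges `R(A₀)` and `R(A₁)`,
the ranges `R(A₀*)` and `R(A₁*)` are closed, the Poincaré–Friedrichs constants
`c_{A₀} = 1/λ_{A₀}` and `c_{A₁} = 1/λ_{A₁}` are finite, and for all
`x ∈ D(A₁) ∩ D(A₀*)` orthogonal to `N₀,₁` one has
`‖x‖² ≤ c_{A₁}² ‖A₁ x‖² + c_{A₀}² ‖A₀* x‖²`. -/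
theorem mixed_poincare_friedrichs_estimate
    (T₀ : H₀ →ₗ.[𝕜] H₁) (T₁ : H₁ →ₗ.[𝕜] H₂)
    (hd₀ : Dense (T₀.domain : Set H₀)) (hc₀ : T₀.IsClosed)
    (hd₁ : Dense (T₁.domain : Set H₁)) (hc₁ : T₁.IsClosed)
    (hcplx : ∀ x : T₀.domain, ∃ h : T₀ x ∈ T₁.domain, T₁ ⟨T₀ x, h⟩ = 0)
    (hR₀ : IsClosed (pRange T₀)) (hR₁ : IsClosed (pRange T₁)) :
    IsClosed (pRange T₀.adjoint) ∧ IsClosed (pRange T₁.adjoint) ∧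
    (lamSet T₀ (closure (pRange T₀.adjoint)))⁻¹ ≠ ⊤ ∧
    (lamSet T₁ (closure (pRange T₁.adjoint)))⁻¹ ≠ ⊤ ∧
    ∀ (x : H₁) (h1 : x ∈ T₁.domain) (h0 : x ∈ T₀.adjoint.domain),
      (∀ n ∈ cohomSet T₀ T₁, ⟪n, x⟫ = 0) →
      ‖x‖ ^ 2 ≤
        ((lamSet T₁ (closure (pRange T₁.adjoint)))⁻¹).toReal ^ 2 * ‖T₁ ⟨x, h1⟩‖ ^ 2 +
        ((lamSet T₀ (closure (pRange T₀.adjoint)))⁻¹).toReal ^ 2 *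
          ‖T₀.adjoint ⟨x, h0⟩‖ ^ 2 := by
  have hr₀ := pRange_adjoint_eq hd₀ hc₀ hR₀
  have hr₁ := pRange_adjoint_eq hd₁ hc₁ hR₁
  have hcl₀ : IsClosed (pRange T₀.adjoint) := hr₀ ▸ Submodule.isClosed_orthogonal _
  have hcl₁ : IsClosed (pRange T₁.adjoint) := hr₁ ▸ Submodule.isClosed_orthogonal _
  refine ⟨hcl₀, hcl₁, ?_⟩
  rw [hcl₀.closure_eq, hcl₁.closure_eq, hr₀, hr₁]
  obtain ⟨C₀, hC₀, hle₀⟩ := exists_norm_le_of_isClosed_pRange hc₀ hR₀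
  obtain ⟨C₁, hC₁, hle₁⟩ := exists_norm_le_of_isClosed_pRange hc₁ hR₁
  have hfin₀ := inv_lamSet_ne_top (T := T₀) (V := ((pKer T₀)ᗮ : Submodule 𝕜 H₀)) hC₀ hle₀
  have hfin₁ := inv_lamSet_ne_top (T := T₁) (V := ((pKer T₁)ᗮ : Submodule 𝕜 H₁)) hC₁ hle₁
  refine ⟨hfin₀, hfin₁, fun x h1 h0 hx => ?_⟩
  have hcplx' : ∀ z : T₀.domain, T₀ z ∈ pKer T₁ := fun z => mem_pKer_iff.2 (hcplx z)
  obtain ⟨q, hq, hpker, hqx⟩ := exists_mem_orthogonal_pKer hc₁ ⟨x, h1⟩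
  have hq' := (Submodule.mem_orthogonal' _ _).1 hq
  have hqadj : (q : H₁) ∈ pKer T₀.adjoint :=
    (mem_pKer_adjoint_iff hd₀).2 fun z => hq' _ (hcplx' z)
  obtain ⟨hqd, hq0⟩ := mem_pKer_iff.1 hqadj
  let p : T₀.adjoint.domain := ⟨x, h0⟩ - ⟨q, hqd⟩
  have hpx : T₀.adjoint p = T₀.adjoint ⟨x, h0⟩ := by
    rw [LinearPMap.map_sub, hq0, sub_zero]
  have hprange : (p : H₁) ∈ pRange T₀ := by
    refine mem_pRange_of_orthogonal_cohomSet hd₀ hcplx' hR₀ hpker fun n hn => ?_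
    have hnq : ⟪n, (q : H₁)⟫ = 0 :=
      (Submodule.mem_orthogonal _ _).1 hq n (mem_pKer_iff.2 hn.1)
    change ⟪n, x - (q : H₁)⟫ = 0
    rw [inner_sub_right, hx n hn, hnq, sub_zero]
  have hpn := norm_le_mul_norm_adjoint hd₀ hc₀
    (fun z hz => norm_le_inv_lamSet_mul hfin₀ z hz) p hprange
  have hqn := norm_le_inv_lamSet_mul hfin₁ q hq
  rw [hpx] at hpn
  rw [hqx] at hqn
  have hpyth := norm_add_sq_eq_norm_sq_add_norm_sq_of_inner_eq_zero (q : H₁) (p : H₁)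
    (hq' _ hpker)
  have hsum : (q : H₁) + p = x := add_sub_cancel _ _
  rw [hsum] at hpyth
  rw [sq, hpyth, ← mul_pow, ← mul_pow, ← sq, ← sq]
  gcongr
end

section
/- Let A₀ : D(A₀) ⊆ H₀ → H₁ and A₁ : D(A₁) ⊆ H₁ → H₂ be densely defined closed linear operators satisfying the complex property R(A₀) ⊆ N(A₁), and assume R(A₀) and R(A₁) are closed. Then inf{ (‖A₁x‖²_{H₂} + ‖A₀*x‖²_{H₀}) / ‖x‖²_{H₁} : 0 ≠ x ∈ D(A₁) ∩ D(A₀*), x ⊥ N₀,₁ } = min{ λ_{A₀}², λ_{A₁}² } (taken in [0,∞] with inf ∅ := ∞); equivalently, the best constant c_{A₀,A₁} in the mixed Poincaré-type estimate equals max{ c_{A₀}, c_{A₁} }. -/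
open Filter Topology
open scoped ENNReal

variable {𝕜 H₀ H₁ H₂ : Type*} [RCLike 𝕜]
  [NormedAddCommGroup H₀] [InnerProductSpace 𝕜 H₀] [CompleteSpace H₀]
  [NormedAddCommGroup H₁] [InnerProductSpace 𝕜 H₁] [CompleteSpace H₁]
  [NormedAddCommGroup H₂] [InnerProductSpace 𝕜 H₂] [CompleteSpace H₂]

local notation "⟪" x ", " y "⟫" => @inner 𝕜 _ _ x y

/-- A constant bounds the Poincaré–Friedrichs infimum from below iff the corresponding
estimate holds on `D(T) ∩ V`. -/
theorem coe_le_lamSet_iff {E F : Type*}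
    [NormedAddCommGroup E] [InnerProductSpace 𝕜 E]
    [NormedAddCommGroup F] [InnerProductSpace 𝕜 F]
    (T : E →ₗ.[𝕜] F) (V : Set E) (c : NNReal) :
    (c : ℝ≥0∞) ≤ lamSet T V ↔ ∀ x : T.domain, (x : E) ∈ V → c * ‖(x : E)‖ ≤ ‖T x‖ := by
  rw [lamSet, le_iInf_iff]
  constructor
  · intro h x hx
    by_cases h0 : (x : E) = 0
    · simp [h0]
    · have := h ⟨x, h0, hx⟩
      rwa [← ENNReal.ofReal_coe_nnreal, ENNReal.ofReal_le_ofReal_iff (by positivity),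
        le_div_iff₀ (norm_pos_iff.2 h0)] at this
  · rintro h ⟨x, h0, hx⟩
    rw [← ENNReal.ofReal_coe_nnreal]
    exact ENNReal.ofReal_le_ofReal ((le_div_iff₀ (norm_pos_iff.2 h0)).2 (h x hx))

/-- A lower bound for `S` transfers to a formal adjoint `T` on the closure of the range of `S`. -/
theorem LinearPMap.IsFormalAdjoint.mul_norm_le {E F : Type*}
    [NormedAddCommGroup E] [InnerProductSpace 𝕜 E]
    [NormedAddCommGroup F] [InnerProductSpace 𝕜 F]
    {T : E →ₗ.[𝕜] F} {S : F →ₗ.[𝕜] E} (hST : S.IsFormalAdjoint T) {c : ℝ} (hc : 0 ≤ c)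
    (h : ∀ y : S.domain, ∃ x : S.domain, S x = S y ∧ c * ‖(x : F)‖ ≤ ‖S x‖)
    (z : T.domain) (hz : (z : E) ∈ _root_.closure (pRange S)) : c * ‖(z : E)‖ ≤ ‖T z‖ := by
  have hcl : _root_.IsClosed {u : E | c * ‖⟪u, (z : E)⟫‖ ≤ ‖u‖ * ‖T z‖} :=
    isClosed_le (by fun_prop) (by fun_prop)
  have hsub : pRange S ⊆ {u : E | c * ‖⟪u, (z : E)⟫‖ ≤ ‖u‖ * ‖T z‖} := by
    rintro _ ⟨y, rfl⟩
    obtain ⟨x, hxy, hx⟩ := h y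
    change c * ‖⟪S y, (z : E)⟫‖ ≤ ‖S y‖ * ‖T z‖
    rw [← hxy, hST x z]
    calc c * ‖⟪(x : F), T z⟫‖ ≤ c * (‖(x : F)‖ * ‖T z‖) := by
          gcongr
          exact norm_inner_le_norm _ _
      _ = c * ‖(x : F)‖ * ‖T z‖ := by ring
      _ ≤ ‖S x‖ * ‖T z‖ := by gcongr
  have hzz : c * ‖⟪(z : E), (z : E)⟫‖ ≤ ‖(z : E)‖ * ‖T z‖ := closure_minimal hsub hcl hz
  rw [inner_self_eq_norm_sq_to_K, norm_pow, RCLike.norm_ofReal, abs_norm] at hzz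
  rcases (norm_nonneg (z : E)).eq_or_lt with h0 | h0
  · simp [← h0]
  · refine le_of_mul_le_mul_left ?_ h0
    linarith [sq ‖(z : E)‖, mul_left_comm ‖(z : E)‖ c ‖(z : E)‖]

/-- `R(T)ᗮ = N(T†)`. -/
theorem LinearPMap.mem_orthogonal_range_iff {E F : Type*}
    [NormedAddCommGroup E] [InnerProductSpace 𝕜 E] [CompleteSpace E]
    [NormedAddCommGroup F] [InnerProductSpace 𝕜 F]
    {T : E →ₗ.[𝕜] F} (hT : Dense (T.domain : Set E)) {y : F} :
    y ∈ (LinearMap.range T.toFun)ᗮ ↔ ∃ h : y ∈ T.adjoint.domain, T.adjoint ⟨y, h⟩ = 0 := by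
  rw [Submodule.mem_orthogonal']
  constructor
  · intro hy
    have h0 : ∀ x : T.domain, ⟪(0 : E), (x : E)⟫ = ⟪y, T x⟫ := fun x => by
      rw [inner_zero_left]
      exact (hy _ ⟨x, rfl⟩).symm
    exact ⟨LinearPMap.mem_adjoint_domain_of_exists y ⟨0, h0⟩, LinearPMap.adjoint_apply_eq hT _ h0⟩
  · rintro ⟨h, h0⟩ _ ⟨x, rfl⟩
    have := LinearPMap.adjoint_isFormalAdjoint hT ⟨y, h⟩ x
    rw [h0, inner_zero_left] at this
    exact this.symm

/-- `R(T†)ᗮ = N(T)` for closed densely defined `T`. -/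
theorem LinearPMap.IsClosed.mem_orthogonal_range_adjoint_iff {E F : Type*}
    [NormedAddCommGroup E] [InnerProductSpace 𝕜 E] [CompleteSpace E]
    [NormedAddCommGroup F] [InnerProductSpace 𝕜 F] [CompleteSpace F]
    {T : E →ₗ.[𝕜] F} (hc : T.IsClosed) (hT : Dense (T.domain : Set E)) {y : E} :
    y ∈ (LinearMap.range T.adjoint.toFun)ᗮ ↔ ∃ h : y ∈ T.domain, T ⟨y, h⟩ = 0 := by
  have hadj := LinearPMap.adjoint_isFormalAdjoint hT
  rw [Submodule.mem_orthogonal]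
  constructor
  · intro hy
    let G : Submodule 𝕜 (WithLp 2 (E × F)) :=
      T.graph.comap (WithLp.linearEquiv 2 𝕜 (E × F)).toLinearMap
    have hG : _root_.IsClosed (G : Set (WithLp 2 (E × F))) :=
      IsClosed.preimage (WithLp.prod_continuous_ofLp 2 E F) hc
    have hmem : WithLp.toLp 2 (y, (0 : F)) ∈ Gᗮᗮ := by
      rw [Submodule.mem_orthogonal]
      intro u hu
      rw [Submodule.mem_orthogonal'] at hu
      have h1 : ∀ x : T.domain, ⟪-u.fst, (x : E)⟫ = ⟪u.snd, T x⟫ := fun x => by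
        have := hu (WithLp.toLp 2 ((x : E), T x)) (T.mem_graph x)
        rw [WithLp.prod_inner_apply] at this
        rw [inner_neg_left]
        exact neg_eq_of_add_eq_zero_right this
      have h2 := hy _ ⟨⟨u.snd, LinearPMap.mem_adjoint_domain_of_exists _ ⟨_, h1⟩⟩, rfl⟩
      have h3 := LinearPMap.adjoint_apply_eq hT
        ⟨u.snd, LinearPMap.mem_adjoint_domain_of_exists _ ⟨_, h1⟩⟩ h1
      have h4 : ⟪-u.fst, y⟫ = 0 := by
        rw [← h3]
        exact h2
      rw [inner_neg_left, neg_eq_zero] at h4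
      rw [WithLp.prod_inner_apply]
      simpa using h4
    rw [Submodule.orthogonal_orthogonal_eq_closure, hG.submodule_topologicalClosure_eq] at hmem
    obtain ⟨z, hz, hz0⟩ := (LinearPMap.mem_graph_iff T).1 hmem
    change (z : E) = y at hz
    subst hz
    exact ⟨z.2, hz0⟩
  · rintro ⟨h, h0⟩ _ ⟨x, rfl⟩
    refine (hadj x ⟨y, h⟩).trans ?_
    rw [h0, inner_zero_right]

/-- Elements of the domain of `L` may be projected along a subspace of the kernel of `L`. -/
theorem LinearPMap.exists_sub_mem_apply_eq {E F : Type*}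
    [NormedAddCommGroup E] [InnerProductSpace 𝕜 E] [CompleteSpace E]
    [NormedAddCommGroup F] [InnerProductSpace 𝕜 F]
    (L : E →ₗ.[𝕜] F) (K : Submodule 𝕜 E)
    (hK : ∀ y ∈ Kᗮ, ∃ h : y ∈ L.domain, L ⟨y, h⟩ = 0) (x : L.domain) :
    ∃ a : L.domain, (a : E) ∈ K.topologicalClosure ∧ (x : E) - a ∈ Kᗮ ∧ L a = L x := by
  have : CompleteSpace K.topologicalClosure :=
    K.isClosed_topologicalClosure.completeSpace_coe
  have hb := K.topologicalClosure.sub_starProjection_mem_orthogonal (x : E)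
  rw [Submodule.orthogonal_closure] at hb
  obtain ⟨hd, h0⟩ := hK _ hb
  refine ⟨x - ⟨_, hd⟩, ?_, ?_, ?_⟩
  · simp
  · simpa using hb
  · rw [LinearPMap.map_sub, h0, sub_zero]

/-- A constant bounds the mixed Rayleigh quotient from below iff the corresponding
mixed Poincaré-type estimate holds. -/
theorem coe_sq_le_iInf_mixed_iff (T₀ : H₀ →ₗ.[𝕜] H₁) (T₁ : H₁ →ₗ.[𝕜] H₂) (c : NNReal) :
    ((c : ℝ≥0∞) ^ 2 ≤ ⨅ p : {p : T₁.domain × T₀.adjoint.domain //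
        (p.1 : H₁) = (p.2 : H₁) ∧ (p.1 : H₁) ≠ 0 ∧
        ∀ n ∈ cohomSet T₀ T₁, ⟪n, (p.1 : H₁)⟫ = 0},
      ENNReal.ofReal ((‖T₁ p.1.1‖ ^ 2 + ‖T₀.adjoint p.1.2‖ ^ 2) / ‖(p.1.1 : H₁)‖ ^ 2)) ↔
    ∀ (x : H₁) (h₁ : x ∈ T₁.domain) (h₀ : x ∈ T₀.adjoint.domain),
      (∀ n ∈ cohomSet T₀ T₁, ⟪n, x⟫ = 0) →
      (c : ℝ) ^ 2 * ‖x‖ ^ 2 ≤ ‖T₁ ⟨x, h₁⟩‖ ^ 2 + ‖T₀.adjoint ⟨x, h₀⟩‖ ^ 2 := by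
  rw [le_iInf_iff, ← ENNReal.ofReal_coe_nnreal, ← ENNReal.ofReal_pow c.coe_nonneg]
  constructor
  · intro h x h₁ h₀ hn
    by_cases hx : x = 0
    · rw [norm_eq_zero.2 hx, zero_pow two_ne_zero, mul_zero]
      positivity
    · have := h ⟨(⟨x, h₁⟩, ⟨x, h₀⟩), rfl, hx, hn⟩
      rwa [ENNReal.ofReal_le_ofReal_iff (by positivity),
        le_div_iff₀ (pow_pos (norm_pos_iff.2 hx) 2)] at this
  · rintro h ⟨⟨⟨x, h₁⟩, ⟨y, h₀⟩⟩, hxy, hx, hn⟩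
    obtain rfl : x = y := hxy
    exact ENNReal.ofReal_le_ofReal ((le_div_iff₀ (pow_pos (norm_pos_iff.2 hx) 2)).2 (h x h₁ h₀ hn))

/-- The mixed Poincaré-type estimate of a Hilbert complex holds with a given constant iff the
Poincaré–Friedrichs estimates of both reduced operators do. -/
theorem mixed_estimate_iff {T₀ : H₀ →ₗ.[𝕜] H₁} {T₁ : H₁ →ₗ.[𝕜] H₂}
    (hd₀ : Dense (T₀.domain : Set H₀)) (hc₀ : T₀.IsClosed)
    (hd₁ : Dense (T₁.domain : Set H₁)) (hc₁ : T₁.IsClosed)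
    (hcplx : ∀ x : T₀.domain, ∃ h : T₀ x ∈ T₁.domain, T₁ ⟨T₀ x, h⟩ = 0)
    {c : ℝ} (hc : 0 ≤ c) :
    (∀ (x : H₁) (h₁ : x ∈ T₁.domain) (h₀ : x ∈ T₀.adjoint.domain),
      (∀ n ∈ cohomSet T₀ T₁, ⟪n, x⟫ = 0) →
      c ^ 2 * ‖x‖ ^ 2 ≤ ‖T₁ ⟨x, h₁⟩‖ ^ 2 + ‖T₀.adjoint ⟨x, h₀⟩‖ ^ 2) ↔
    (∀ z : T₀.domain, (z : H₀) ∈ closure (pRange T₀.adjoint) → c * ‖(z : H₀)‖ ≤ ‖T₀ z‖) ∧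
    (∀ x : T₁.domain, (x : H₁) ∈ closure (pRange T₁.adjoint) → c * ‖(x : H₁)‖ ≤ ‖T₁ x‖) := by
  have hadj := LinearPMap.adjoint_isFormalAdjoint hd₀
  set R₀ := LinearMap.range T₀.toFun
  set S₁ := LinearMap.range T₁.adjoint.toFun
  have ker₀ : ∀ y, y ∈ R₀ᗮ ↔ ∃ h : y ∈ T₀.adjoint.domain, T₀.adjoint ⟨y, h⟩ = 0 :=
    fun y => LinearPMap.mem_orthogonal_range_iff hd₀
  have ker₁ : ∀ y, y ∈ S₁ᗮ ↔ ∃ h : y ∈ T₁.domain, T₁ ⟨y, h⟩ = 0 :=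
    fun y => hc₁.mem_orthogonal_range_adjoint_iff hd₁
  have hcoh : ∀ n, n ∈ cohomSet T₀ T₁ ↔ n ∈ S₁ᗮ ∧ n ∈ R₀ᗮ := fun n => by
    rw [ker₀, ker₁]
    rfl
  have hle : R₀.topologicalClosure ≤ S₁ᗮ := by
    refine R₀.topologicalClosure_minimal ?_ S₁.isClosed_orthogonal
    rintro _ ⟨x, rfl⟩
    exact (ker₁ _).2 (hcplx x)
  constructor
  · intro h
    constructor
    · refine fun z hz => hadj.mul_norm_le hc (fun y => ?_) z hz
      obtain ⟨a, ha, -, hay⟩ := T₀.adjoint.exists_sub_mem_apply_eq R₀ (fun y => (ker₀ y).1) y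
      obtain ⟨ha₁, ha0⟩ := (ker₁ _).1 (hle ha)
      refine ⟨a, hay, ?_⟩
      have := h a ha₁ a.2 fun n hn => by
        refine Submodule.inner_left_of_mem_orthogonal ha ?_
        rw [Submodule.orthogonal_closure]
        exact ((hcoh n).1 hn).2
      rw [ha0, norm_zero, ← mul_pow] at this
      exact (pow_le_pow_iff_left₀ (by positivity) (by positivity) two_ne_zero).1
        (by simpa using this)
    · intro x hx
      have hx' : (x : H₁) ∈ S₁.topologicalClosure := hx
      rw [← Submodule.orthogonal_orthogonal_eq_closure] at hx'
      have hxR : (x : H₁) ∈ R₀ᗮ := by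
        rw [← Submodule.orthogonal_closure]
        exact Submodule.orthogonal_le hle hx'
      obtain ⟨hx₀, hx0⟩ := (ker₀ _).1 hxR
      have := h x x.2 hx₀ fun n hn =>
        Submodule.inner_right_of_mem_orthogonal ((hcoh n).1 hn).1 hx'
      rw [hx0, norm_zero, ← mul_pow] at this
      exact (pow_le_pow_iff_left₀ (by positivity) (by positivity) two_ne_zero).1
        (by simpa using this)
  · rintro ⟨h₀, h₁⟩ x hx₁ hx₀ hn
    obtain ⟨a, ha, hb, hax⟩ :=
      T₀.adjoint.exists_sub_mem_apply_eq R₀ (fun y => (ker₀ y).1) ⟨x, hx₀⟩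
    change x - a ∈ R₀ᗮ at hb
    obtain ⟨ha₁, ha0⟩ := (ker₁ _).1 (hle ha)
    have hbound₀ : c * ‖(a : H₁)‖ ≤ ‖T₀.adjoint a‖ := by
      refine hadj.symm.mul_norm_le hc (fun y => ?_) a ha
      obtain ⟨z, hz, -, hzy⟩ := T₀.exists_sub_mem_apply_eq (LinearMap.range T₀.adjoint.toFun)
        (fun y => (hc₀.mem_orthogonal_range_adjoint_iff hd₀).1) y
      exact ⟨z, hzy, h₀ z hz⟩
    have hbS : x - a ∈ S₁ᗮᗮ := by
      have : CompleteSpace R₀.topologicalClosure :=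
        R₀.isClosed_topologicalClosure.completeSpace_coe
      rw [Submodule.mem_orthogonal]
      intro n hnS
      have hp := R₀.topologicalClosure.starProjection_apply_mem n
      have hq := R₀.topologicalClosure.sub_starProjection_mem_orthogonal n
      rw [Submodule.orthogonal_closure] at hq
      have e₁ := hn _ ((hcoh _).2 ⟨S₁ᗮ.sub_mem hnS (hle hp), hq⟩)
      rw [← Submodule.orthogonal_closure] at hq hb
      have e₂ := Submodule.inner_left_of_mem_orthogonal ha hq
      have e₃ := Submodule.inner_right_of_mem_orthogonal hp hb
      rw [← sub_add_cancel n (R₀.topologicalClosure.starProjection n), inner_add_left, e₃,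
        inner_sub_right, e₁, e₂, sub_zero, add_zero]
    have hbT : x - a ∈ T₁.domain := T₁.domain.sub_mem hx₁ ha₁
    have hTb : T₁ ⟨x - a, hbT⟩ = T₁ ⟨x, hx₁⟩ := by
      have := T₁.map_sub ⟨x, hx₁⟩ ⟨a, ha₁⟩
      rw [ha0, sub_zero] at this
      exact this
    have hbound₁ : c * ‖x - a‖ ≤ ‖T₁ ⟨x, hx₁⟩‖ := by
      rw [← hTb]
      refine h₁ ⟨x - a, hbT⟩ ?_
      rw [Submodule.orthogonal_orthogonal_eq_closure] at hbS
      exact hbS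
    have hpyth : ‖x‖ ^ 2 = ‖x - a‖ ^ 2 + ‖(a : H₁)‖ ^ 2 := by
      rw [← Submodule.orthogonal_closure] at hb
      have := norm_add_sq_eq_norm_sq_add_norm_sq_of_inner_eq_zero (x - a) (a : H₁)
        (Submodule.inner_left_of_mem_orthogonal ha hb)
      rw [sub_add_cancel] at this
      linarith [sq ‖x‖, sq ‖x - a‖, sq ‖(a : H₁)‖]
    rw [← hax, hpyth, mul_add, ← mul_pow, ← mul_pow]
    gcongr

/-- For a Hilbert complex `A₀, A₁` with closed ranges, the infimum of the
mixed Rayleigh quotient `(‖A₁ x‖² + ‖A₀* x‖²)/‖x‖²` over `0 ≠ x ∈ D(A₁) ∩ D(A₀*)`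
orthogonal to `N₀,₁` equals `min {λ_{A₀}², λ_{A₁}²}` (in `[0,∞]`, `inf ∅ = ∞`);
equivalently, the best constant in the mixed Poincaré-type estimate is
`max {c_{A₀}, c_{A₁}}`. -/
theorem mixed_rayleigh_quotient_eq_min
    (T₀ : H₀ →ₗ.[𝕜] H₁) (T₁ : H₁ →ₗ.[𝕜] H₂)
    (hd₀ : Dense (T₀.domain : Set H₀)) (hc₀ : T₀.IsClosed)
    (hd₁ : Dense (T₁.domain : Set H₁)) (hc₁ : T₁.IsClosed)
    (hcplx : ∀ x : T₀.domain, ∃ h : T₀ x ∈ T₁.domain, T₁ ⟨T₀ x, h⟩ = 0)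
    (hR₀ : IsClosed (pRange T₀)) (hR₁ : IsClosed (pRange T₁)) :
    (⨅ p : {p : T₁.domain × T₀.adjoint.domain //
        (p.1 : H₁) = (p.2 : H₁) ∧ (p.1 : H₁) ≠ 0 ∧
        ∀ n ∈ cohomSet T₀ T₁, ⟪n, (p.1 : H₁)⟫ = 0},
      ENNReal.ofReal ((‖T₁ p.1.1‖ ^ 2 + ‖T₀.adjoint p.1.2‖ ^ 2) / ‖(p.1.1 : H₁)‖ ^ 2)) =
    min ((lamSet T₀ (closure (pRange T₀.adjoint))) ^ 2)
      ((lamSet T₁ (closure (pRange T₁.adjoint))) ^ 2) := by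
  refine ENNReal.eq_of_forall_nnreal_le_iff fun r => ?_
  rw [← NNReal.sq_sqrt r, ENNReal.coe_pow, coe_sq_le_iInf_mixed_iff,
    mixed_estimate_iff hd₀ hc₀ hd₁ hc₁ hcplx (NNReal.sqrt r).coe_nonneg, le_min_iff,
    ENNReal.pow_le_pow_left_iff two_ne_zero, ENNReal.pow_le_pow_left_iff two_ne_zero,
    coe_le_lamSet_iff, coe_le_lamSet_iff]
end
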